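/- arXiv:2303.14905 — 5 statements merged into one kernel-verified Lean document; each statement's English description precedes it below -/
import Mathlib

section
/- Let δ > 0 and let F : ℂ → ℂ be an entire function of exponential type at most 2πδ whose restriction to ℝ is integrable. Then sup_{x ∈ ℝ} |F(x)| ≤ 2πδ ∫_ℝ |F(x)| dx. -/
open MeasureTheory Real

lemma pl_upper (G : ℂ → ℂ) (hG : Differentiable ℂ G) (σ C M : ℝ) (hσ : 0 ≤ σ)
    (hC : ∀ z, ‖G z‖ ≤ C * Real.exp (σ * ‖z‖)) (hM : ∀ x : ℝ, ‖G x‖ ≤ M) (y : ℝ) (hy : 0 ≤ y) :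
    ‖G (y * Complex.I)‖ ≤ M * Real.exp (σ * y) := by
  let f : ℂ → ℂ := fun w => G (w * Complex.I) * Complex.exp (-(σ * w))
  have hf : Differentiable ℂ f := by
    have : Differentiable ℂ (fun w : ℂ => G (w * Complex.I)) := hG.comp (by fun_prop)
    exact this.mul (by fun_prop)
  have hn : ∀ w, ‖f w‖ = ‖G (w * Complex.I)‖ * Real.exp (-(σ * w.re)) := by
    intro w
    simp [f, Complex.norm_exp]
  have hC0 : 0 ≤ C := by
    have := (norm_nonneg _).trans (hC 0)
    simpa using this
  have key : ‖f y‖ ≤ M := by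
    apply PhragmenLindelof.right_half_plane_of_bounded_on_real (f := f) hf.diffContOnCl
    · refine ⟨1, by norm_num, σ, ?_⟩
      apply Asymptotics.IsBigO.of_bound C
      rw [Filter.eventually_inf_principal]
      refine Filter.Eventually.of_forall fun z hz => ?_
      have hz : 0 < z.re := hz
      rw [hn]
      have h1 := hC (z * Complex.I)
      simp only [norm_mul, Complex.norm_I, mul_one] at h1
      have h2 : Real.exp (-(σ * z.re)) ≤ 1 := Real.exp_le_one_iff.2 (by
        have := mul_nonneg hσ hz.le; linarith)
      rw [Real.rpow_one, Real.norm_of_nonneg (Real.exp_pos _).le]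
      calc _ ≤ ‖G (z * Complex.I)‖ * 1 := by gcongr
        _ ≤ _ := by simpa using h1
    · refine Filter.isBoundedUnder_of_eventually_le (a := C) ?_
      filter_upwards [Filter.eventually_ge_atTop 0] with x hx
      rw [hn]
      have h1 := hC (x * Complex.I)
      simp only [norm_mul, Complex.norm_I, mul_one, Complex.norm_real, Real.norm_of_nonneg hx] at h1
      calc _ ≤ C * Real.exp (σ * x) * Real.exp (-(σ * x)) := by
            simp only [Complex.ofReal_re]; gcongr
        _ = C := by rw [mul_assoc, ← Real.exp_add]; simp
    · intro x
      rw [hn]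
      have : (x : ℂ) * Complex.I * Complex.I = ((-x : ℝ) : ℂ) := by
        rw [mul_assoc, Complex.I_mul_I]; simp
      rw [this]
      simpa using hM (-x)
    · simpa using hy
  rw [hn, Complex.ofReal_re] at key
  calc _ = ‖G (y * Complex.I)‖ * Real.exp (-(σ * y)) * Real.exp (σ * y) := by
        rw [mul_assoc, ← Real.exp_add]; simp
    _ ≤ _ := by gcongr

lemma pl_line (G : ℂ → ℂ) (hG : Differentiable ℂ G) (σ C M : ℝ) (hσ : 0 ≤ σ)
    (hC : ∀ z, ‖G z‖ ≤ C * Real.exp (σ * ‖z‖)) (hM : ∀ x : ℝ, ‖G x‖ ≤ M) (y : ℝ) :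
    ‖G (y * Complex.I)‖ ≤ M * Real.exp (σ * |y|) := by
  rcases le_total 0 y with hy | hy
  · rw [abs_of_nonneg hy]; exact pl_upper G hG σ C M hσ hC hM y hy
  · rw [abs_of_nonpos hy]
    have := pl_upper (fun z => G (-z)) (hG.comp (by fun_prop)) σ C M hσ
      (fun z => by simpa using hC (-z)) (fun x => by simpa using hM (-x)) (-y) (by linarith)
    simpa using this

lemma diff_param (F : ℂ → ℂ) (hF : Differentiable ℂ F) (g : ℝ → ℂ) (hg : Measurable g)
    (hg1 : ∀ t, ‖g t‖ ≤ 1) (A : ℝ) :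
    Differentiable ℂ (fun z : ℂ => ∫ t in Set.Icc (-A) A, F (z + t) * g t) := by
  intro z₀
  have hd : Continuous (deriv F) := (hF.contDiff (n := 1)).continuous_deriv le_rfl
  obtain ⟨B, hB⟩ := (isCompact_closedBall (0 : ℂ) (‖z₀‖ + 1 + |A|)).exists_bound_of_continuousOn
    hd.continuousOn
  have hFc := hF.continuous
  have hint : ∀ z : ℂ, Integrable (fun t : ℝ => F (z + t)) (volume.restrict (Set.Icc (-A) A)) := by
    intro z
    exact (Continuous.continuousOn (by fun_prop)).integrableOn_compact isCompact_Icc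
  have := hasDerivAt_integral_of_dominated_loc_of_deriv_le (μ := volume.restrict (Set.Icc (-A) A))
    (F := fun z t => F (z + (t:ℝ)) * g t) (F' := fun z t => deriv F (z + (t:ℝ)) * g t)
    (bound := fun _ => B) (x₀ := z₀) (Metric.ball_mem_nhds z₀ one_pos)
    (Filter.Eventually.of_forall fun z => by
      exact (Measurable.mul (by fun_prop) hg).aestronglyMeasurable)
    ((hint z₀).mul_bdd (c := 1) hg.aestronglyMeasurable (Filter.Eventually.of_forall hg1))
    ((Measurable.mul (by fun_prop) hg).aestronglyMeasurable)
    ?_ (integrable_const B) ?_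
  · exact this.2.differentiableAt
  · refine (ae_restrict_iff' measurableSet_Icc).2 (Filter.Eventually.of_forall fun t ht z hz => ?_)
    have h1 : ‖deriv F (z + t)‖ ≤ B := by
      apply hB
      rw [mem_closedBall_zero_iff]
      have h2 : ‖z - z₀‖ < 1 := by simpa [dist_eq_norm] using hz
      have h3 : ‖z‖ ≤ ‖z₀‖ + ‖z - z₀‖ := by
        simpa using norm_add_le z₀ (z - z₀)
      have h4 : ‖(t:ℂ)‖ ≤ |A| := by
        rw [Complex.norm_real, Real.norm_eq_abs, abs_le]
        constructor <;> linarith [ht.1, ht.2, le_abs_self A]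
      linarith [norm_add_le z t]
    rw [norm_mul]
    calc _ ≤ B * 1 := mul_le_mul h1 (hg1 t) (norm_nonneg _) ((norm_nonneg _).trans h1)
      _ = B := mul_one B
  · refine Filter.Eventually.of_forall fun t z _ => ?_
    have h1 : HasDerivAt F (deriv F (z + t)) (z + t) := (hF _).hasDerivAt
    exact (h1.comp_add_const z (t:ℂ)).mul_const (g t)

lemma plancherel_polya (F : ℂ → ℂ) (hF : Differentiable ℂ F) (σ C : ℝ) (hσ : 0 ≤ σ)
    (hC : ∀ z, ‖F z‖ ≤ C * Real.exp (σ * ‖z‖)) (hint : Integrable (fun x : ℝ => F x)) (y : ℝ) :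
    ∫⁻ t : ℝ, ‖F (t + y * Complex.I)‖ₑ ≤
      ENNReal.ofReal ((∫ x : ℝ, ‖F x‖) * Real.exp (σ * |y|)) := by
  have hFc := hF.continuous
  have hC0 : 0 ≤ C := by
    have := (norm_nonneg _).trans (hC 0)
    simpa using this
  refine le_of_tendsto' ((aecover_Icc (μ := volume) Filter.tendsto_neg_atTop_atBot
    (Filter.tendsto_id (α := ℝ) (x := Filter.atTop))).lintegral_tendsto_of_countably_generated
    (f := fun t : ℝ => ‖F (t + y * Complex.I)‖ₑ) (by fun_prop)) fun A => ?_
  simp only [id]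
  let g : ℝ → ℂ := fun t =>
    (starRingEnd ℂ) (F (y * Complex.I + t)) / (‖F (y * Complex.I + t)‖ : ℂ)
  have hg : Measurable g := by
    apply Measurable.div
    · exact (Complex.continuous_conj.comp (by fun_prop)).measurable
    · exact (Complex.continuous_ofReal.comp (by fun_prop)).measurable
  have hg1 : ∀ t, ‖g t‖ ≤ 1 := by
    intro t
    simp only [g, norm_div, RCLike.norm_conj, Complex.norm_real, norm_norm]
    exact div_self_le_one _
  have key := pl_line _ (diff_param F hF g hg hg1 A) σ
    (C * Real.exp (σ * |A|) * (volume (Set.Icc (-A) A)).toReal) (∫ x : ℝ, ‖F x‖) hσ ?_ ?_ y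
  · have e : (fun t : ℝ => F (y * Complex.I + t) * g t) =
        fun t : ℝ => ((‖F (t + y * Complex.I)‖ : ℝ) : ℂ) := by
      funext t
      rw [add_comm (t : ℂ)]
      simp only [g]
      rw [← mul_div_assoc, Complex.mul_conj, Complex.normSq_eq_norm_sq]
      push_cast
      by_cases h : (‖F (y * Complex.I + t)‖ : ℂ) = 0
      · rw [h]; simp
      · field_simp
    rw [e, integral_complex_ofReal, Complex.norm_real, Real.norm_eq_abs] at key
    have hi : Integrable (fun t : ℝ => F (t + y * Complex.I))
        (volume.restrict (Set.Icc (-A) A)) :=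
      (Continuous.continuousOn (by fun_prop)).integrableOn_compact isCompact_Icc
    rw [← ofReal_integral_norm_eq_lintegral_enorm hi]
    exact ENNReal.ofReal_le_ofReal ((le_abs_self _).trans key)
  · intro z
    have := norm_setIntegral_le_of_norm_le_const (μ := volume) (s := Set.Icc (-A) A)
      (f := fun t : ℝ => F (z + t) * g t) (C := C * Real.exp (σ * |A|) * Real.exp (σ * ‖z‖))
      (by simp) ?_
    · refine this.trans (le_of_eq ?_)
      rw [Measure.real]; ring
    · intro t ht
      have h4 : ‖(t:ℂ)‖ ≤ |A| := by
        rw [Complex.norm_real, Real.norm_eq_abs, abs_le]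
        constructor <;> linarith [ht.1, ht.2, le_abs_self A]
      have h5 : ‖z + t‖ ≤ |A| + ‖z‖ := by linarith [norm_add_le z t]
      calc _ = ‖F (z + t)‖ * ‖g t‖ := norm_mul _ _
        _ ≤ ‖F (z + t)‖ * 1 := by gcongr; exact hg1 t
        _ ≤ C * Real.exp (σ * ‖z + t‖) := by simpa using hC (z + t)
        _ ≤ C * Real.exp (σ * (|A| + ‖z‖)) := by gcongr
        _ = _ := by rw [mul_add, Real.exp_add]; ring
  · intro x
    have hx : Integrable (fun t : ℝ => F (x + t)) := by
      have := hint.comp_add_left x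
      simpa using this
    calc _ ≤ ∫ t in Set.Icc (-A) A, ‖F (x + t) * g t‖ := norm_integral_le_integral_norm _
      _ ≤ ∫ t in Set.Icc (-A) A, ‖F (x + t)‖ := by
        apply integral_mono_of_nonneg (Filter.Eventually.of_forall fun _ => norm_nonneg _)
          hx.norm.integrableOn
        refine Filter.Eventually.of_forall fun t => ?_
        simp only [norm_mul]
        exact mul_le_of_le_one_right (norm_nonneg _) (hg1 t)
      _ ≤ ∫ t : ℝ, ‖F (x + t)‖ := setIntegral_le_integral hx.norm
          (Filter.Eventually.of_forall fun _ => norm_nonneg _)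
      _ = ∫ t : ℝ, ‖F t‖ := by
        have := integral_add_left_eq_self (μ := (volume : Measure ℝ)) (fun t : ℝ => ‖F t‖) x
        simpa using this

lemma circle_mean (F : ℂ → ℂ) (hF : Differentiable ℂ F) (x : ℂ) (r : ℝ) :
    ENNReal.ofReal (2 * π) * ‖F x‖ₑ ≤
      ∫⁻ θ in Set.Ioo (-π) π, ‖F (x + r * (Real.cos θ + Real.sin θ * Complex.I))‖ₑ := by
  have h := DiffContOnCl.circleAverage (f := F) (c := x) (R := r) hF.diffContOnCl
  rw [Real.circleAverage_def] at h
  have hp : Function.Periodic (fun θ => F (circleMap x r θ)) (2 * π) := fun θ => by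
    simp [periodic_circleMap x r θ]
  have h2 := hp.intervalIntegral_add_eq 0 (-π)
  rw [zero_add] at h2
  rw [h2, show -π + 2 * π = π by ring, intervalIntegral.integral_of_le (by linarith [pi_pos]),
    integral_Ioc_eq_integral_Ioo] at h
  have e : ∀ θ : ℝ, x + r * (Real.cos θ + Real.sin θ * Complex.I) = circleMap x r θ := by
    intro θ
    simp [circleMap, Complex.exp_mul_I]
  simp_rw [e]
  have h3 : ((2 * π : ℝ)) • F x = ∫ θ in Set.Ioo (-π) π, F (circleMap x r θ) := by
    rw [← h, smul_inv_smul₀ (by positivity)]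
  calc _ = ‖((2 * π : ℝ)) • F x‖ₑ := by
        rw [enorm_smul, Real.enorm_eq_ofReal (by positivity)]
    _ ≤ _ := by rw [h3]; exact enorm_integral_le_lintegral_enorm _

lemma area_mean (F : ℂ → ℂ) (hF : Differentiable ℂ F) (x : ℂ) (R : ℝ) (hR : 0 ≤ R) :
    ENNReal.ofReal (π * R ^ 2) * ‖F x‖ₑ ≤ ∫⁻ w in Metric.ball (0:ℂ) R, ‖F (x + w)‖ₑ := by
  have hFc := hF.continuous
  rw [← lintegral_indicator Metric.isOpen_ball.measurableSet,
    ← Complex.lintegral_comp_polarCoord_symm, polarCoord_target]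
  have hm : Measurable (Set.indicator (Metric.ball (0:ℂ) R) (fun w => ‖F (x + w)‖ₑ)) :=
    Measurable.indicator (Continuous.measurable (by fun_prop)) Metric.isOpen_ball.measurableSet
  rw [Measure.volume_eq_prod, setLIntegral_prod]
  swap
  · simp only [smul_eq_mul, Complex.polarCoord_symm_apply]
    exact (Measurable.mul (by fun_prop) (hm.comp (by fun_prop))).aemeasurable
  calc _ = ∫⁻ r in Set.Ioo 0 R, ENNReal.ofReal r * (ENNReal.ofReal (2 * π) * ‖F x‖ₑ) := by
        rw [lintegral_mul_const _ (by fun_prop), ← mul_assoc]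
        congr 1
        rw [← ofReal_integral_eq_lintegral_ofReal, ← integral_Ioc_eq_integral_Ioo,
          ← intervalIntegral.integral_of_le hR, integral_id, ← ENNReal.ofReal_mul (by rw [zero_pow two_ne_zero, sub_zero]; positivity)]
        · congr 1; ring
        · exact (continuous_id.continuousOn.integrableOn_compact isCompact_Icc).mono_set
            Set.Ioo_subset_Icc_self
        · exact (ae_restrict_iff' measurableSet_Ioo).2 (Filter.Eventually.of_forall
            fun t ht => ht.1.le)
    _ ≤ ∫⁻ r in Set.Ioo 0 R, _ := by
        apply setLIntegral_mono' measurableSet_Ioo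
        intro r hr
        have e : ∀ θ : ℝ, Set.indicator (Metric.ball (0:ℂ) R) (fun w => ‖F (x + w)‖ₑ)
            (Complex.polarCoord.symm (r, θ)) =
            ‖F (x + r * (Real.cos θ + Real.sin θ * Complex.I))‖ₑ := by
          intro θ
          rw [Set.indicator_of_mem]
          · rw [Complex.polarCoord_symm_apply]
          · rw [mem_ball_zero_iff, Complex.norm_polarCoord_symm, abs_of_pos hr.1]; exact hr.2
        calc _ ≤ _ := mul_le_mul_right (circle_mean F hF x r) _
          _ = _ := by
            rw [← lintegral_const_mul _ (Continuous.measurable (by fun_prop))]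
            simp only [e, smul_eq_mul]
    _ ≤ _ := lintegral_mono_set Set.Ioo_subset_Ioi_self

lemma int_exp (σ R : ℝ) (hσ : 0 < σ) (hR : 0 ≤ R) :
    ∫ y in (-R)..R, Real.exp (σ * |y|) = 2 * (Real.exp (σ * R) - 1) / σ := by
  have hc : Continuous fun y : ℝ => Real.exp (σ * |y|) := by fun_prop
  have h1 : ∫ y in (0:ℝ)..R, Real.exp (σ * |y|) = (Real.exp (σ * R) - 1) / σ := by
    rw [intervalIntegral.integral_congr (g := fun y => Real.exp (σ * y))]
    · rw [intervalIntegral.integral_comp_mul_left _ hσ.ne']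
      simp [div_eq_inv_mul]
    · intro y hy
      rw [Set.uIcc_of_le hR] at hy
      simp [abs_of_nonneg hy.1]
  have h2 : ∫ y in (-R)..0, Real.exp (σ * |y|) = (Real.exp (σ * R) - 1) / σ := by
    rw [← h1]
    have := intervalIntegral.integral_comp_neg (a := 0) (b := R)
      (fun y : ℝ => Real.exp (σ * |y|))
    simp only [abs_neg, neg_zero] at this
    exact this.symm
  rw [← intervalIntegral.integral_add_adjacent_intervals (b := 0)
    (hc.intervalIntegrable _ _) (hc.intervalIntegrable _ _), h1, h2]
  ring

lemma main_bound (F : ℂ → ℂ) (hF : Differentiable ℂ F) (σ M : ℝ) (hσ : 0 < σ) (hM : 0 ≤ M)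
    (h : ∀ y : ℝ, ∫⁻ t : ℝ, ‖F (t + y * Complex.I)‖ₑ ≤ ENNReal.ofReal (M * Real.exp (σ * |y|)))
    (x : ℝ) : ‖F x‖ ≤ σ * M := by
  have hFc := hF.continuous
  set R : ℝ := 3 / 2 / σ with hRdef
  have hR : 0 < R := by positivity
  have h1 := area_mean F hF x R hR.le
  have h2 : ∫⁻ w in Metric.ball (0:ℂ) R, ‖F (x + w)‖ₑ ≤
      ENNReal.ofReal (M * (2 * (Real.exp (σ * R) - 1) / σ)) := by
    rw [← lintegral_indicator Metric.isOpen_ball.measurableSet]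
    have hm : Measurable (Set.indicator (Metric.ball (0:ℂ) R) (fun w => ‖F (x + w)‖ₑ)) :=
      Measurable.indicator (Continuous.measurable (by fun_prop)) Metric.isOpen_ball.measurableSet
    rw [← (Complex.volume_preserving_equiv_real_prod.symm).lintegral_comp_emb
      Complex.measurableEquivRealProd.symm.measurableEmbedding, Measure.volume_eq_prod]
    have hsw := lintegral_prod_symm' (μ := (volume : Measure ℝ)) (ν := (volume : Measure ℝ)) _
      (hm.comp Complex.measurableEquivRealProd.symm.measurable)
    simp only [Function.comp_def] at hsw
    rw [hsw]
    calc _ ≤ ∫⁻ y : ℝ, Set.indicator (Set.Ioc (-R) R)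
          (fun y => ENNReal.ofReal (M * Real.exp (σ * |y|))) y := by
          apply lintegral_mono
          intro y
          have e : ∀ t : ℝ, Complex.measurableEquivRealProd.symm (t, y) = t + y * Complex.I := by
            intro t
            apply Complex.ext <;> simp [Complex.measurableEquivRealProd]
          simp only [e]
          by_cases hy : y ∈ Set.Ioc (-R) R
          · rw [Set.indicator_of_mem hy]
            refine le_trans (lintegral_mono fun t => Set.indicator_le_self _ _ _) ?_
            refine le_trans (le_of_eq ?_) (h y)
            have := lintegral_add_left_eq_self (μ := (volume : Measure ℝ))
              (fun t : ℝ => ‖F (t + y * Complex.I)‖ₑ) x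
            simpa [add_assoc] using this
          · rw [Set.indicator_of_notMem hy]
            refine le_of_eq ?_
            rw [lintegral_eq_zero_iff' (by
              apply Measurable.aemeasurable; exact hm.comp (by fun_prop))]
            refine Filter.Eventually.of_forall fun t => ?_
            apply Set.indicator_of_notMem
            intro hh
            rw [mem_ball_zero_iff] at hh
            have h3 := Complex.abs_im_le_norm (t + y * Complex.I)
            simp at h3
            have h4 := abs_lt.1 (h3.trans_lt hh)
            exact hy ⟨h4.1, h4.2.le⟩
      _ = _ := by
          rw [lintegral_indicator measurableSet_Ioc, ← ofReal_integral_eq_lintegral_ofReal,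
            ← intervalIntegral.integral_of_le (by linarith), intervalIntegral.integral_const_mul,
            int_exp σ R hσ hR.le]
          · exact (Continuous.continuousOn (by fun_prop)).integrableOn_compact isCompact_Icc
              |>.mono_set Set.Ioc_subset_Icc_self
          · exact Filter.Eventually.of_forall fun t => by positivity
  have h3 := h1.trans h2
  have hs : σ * R = 3 / 2 := by rw [hRdef]; field_simp
  have hexp : Real.exp (3 / 2) ≤ 4.49 := by
    have h5 : Real.exp (3 / 2) ^ 2 = Real.exp 1 ^ 3 := by
      rw [← Real.exp_nat_mul, ← Real.exp_nat_mul]; norm_num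
    have h6 : Real.exp 1 ^ 3 ≤ 2.7182818286 ^ 3 := by
      gcongr; exact Real.exp_one_lt_d9.le
    refine le_of_sq_le_sq ?_ (by norm_num)
    rw [h5]; exact h6.trans (by norm_num)
  rw [hs, ← ofReal_norm, ← ENNReal.ofReal_mul (by positivity),
    ENNReal.ofReal_le_ofReal_iff (by
      have : 1 ≤ Real.exp (3/2) := Real.one_le_exp (by norm_num)
      have : 0 ≤ Real.exp (3/2) - 1 := by linarith
      positivity)] at h3
  have h7 : π * R ^ 2 * ‖F x‖ ≤ π * R ^ 2 * (σ * M) := by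
    refine h3.trans ?_
    have h8 : π * R ^ 2 * (σ * M) = M * (π * (9/4) / σ) := by
      rw [hRdef]; field_simp; ring
    rw [h8]
    refine mul_le_mul_of_nonneg_left (div_le_div_of_nonneg_right ?_ hσ.le) hM
    linarith [Real.pi_gt_d2]
  exact le_of_mul_le_mul_left h7 (by positivity)

/-- If `F` is entire of exponential type at most `2πδ` and integrable on `ℝ`,
then `sup_{x ∈ ℝ} |F x| ≤ 2πδ ∫_ℝ |F|`. -/
theorem stmt0 (δ : ℝ) (hδ : 0 < δ) (F : ℂ → ℂ)
    (hF : Differentiable ℂ F)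
    (htype : ∀ ε > 0, ∃ C : ℝ, ∀ z : ℂ, ‖F z‖ ≤ C * Real.exp ((2 * π * δ + ε) * ‖z‖))
    (hint : Integrable (fun x : ℝ => F x)) :
    ∀ x : ℝ, ‖F x‖ ≤ 2 * π * δ * ∫ x : ℝ, ‖F x‖ := by
  intro x
  refine le_of_forall_pos_le_add fun η hη => ?_
  set M := ∫ x : ℝ, ‖F x‖ with hMdef
  have hM : 0 ≤ M := integral_nonneg fun _ => norm_nonneg _
  have hε : 0 < η / (M + 1) := by positivity
  obtain ⟨C, hC⟩ := htype _ hε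
  have hσ : 0 < 2 * π * δ + η / (M + 1) := by positivity
  have h := main_bound F hF _ M hσ hM (plancherel_polya F hF _ C hσ.le hC hint) x
  have h2 : η / (M + 1) * M ≤ η := by
    rw [div_mul_eq_mul_div, div_le_iff₀ (by positivity)]
    nlinarith
  rw [add_mul] at h
  linarith
end

section
/- Let δ > 0 and let F : ℂ → ℂ be an entire function of exponential type at most 2πδ whose restriction to ℝ is integrable. Then (∫_ℝ |F(x)|² dx)^{1/2} ≤ (2πδ)^{1/2} ∫_ℝ |F(x)| dx. -/
open MeasureTheory Real

theorem aux_half (H : ℂ → ℂ) (hH : Differentiable ℂ H) (σ C M : ℝ) (hσ : 0 < σ)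
    (hC : ∀ z, ‖H z‖ ≤ C * Real.exp (σ * ‖z‖))
    (hM : ∀ x : ℝ, ‖H (x * Complex.I)‖ ≤ M) (z : ℂ) (hz : 0 ≤ z.re) :
    ‖H z‖ ≤ M * Real.exp (σ * z.re) := by
  have hn : ∀ w : ℂ, ‖H w * Complex.exp (-(σ * w))‖ = ‖H w‖ * Real.exp (-(σ * w.re)) := by
    intro w
    rw [norm_mul, Complex.norm_exp]
    simp
  have hC0 : 0 ≤ C := by
    have := (norm_nonneg _).trans (hC 0)
    simpa using this
  have key : ‖H z * Complex.exp (-(σ * z))‖ ≤ M := by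
    refine PhragmenLindelof.right_half_plane_of_bounded_on_real
      (f := fun w => H w * Complex.exp (-(σ * w))) ?_ ?_ ?_ ?_ hz
    · exact Differentiable.diffContOnCl (by fun_prop)
    · refine ⟨1, by norm_num, σ, ?_⟩
      refine Asymptotics.IsBigO.of_bound C ?_
      refine Filter.eventually_inf_principal.2 <| Filter.Eventually.of_forall fun w hw => ?_
      have hw : 0 < w.re := hw
      rw [hn, Real.norm_eq_abs, abs_of_pos (Real.exp_pos _), Real.rpow_one]
      have : Real.exp (-(σ * w.re)) ≤ 1 := by
        rw [Real.exp_le_one_iff]; nlinarith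
      calc _ ≤ ‖H w‖ * 1 := by gcongr
        _ ≤ _ := by rw [mul_one]; exact hC w
    · refine ⟨C, ?_⟩
      rw [Filter.eventually_map]
      filter_upwards [Filter.eventually_ge_atTop 0] with x hx
      rw [hn]
      have := hC x
      rw [Complex.norm_real, Real.norm_eq_abs, abs_of_nonneg hx] at this
      rw [Complex.ofReal_re]
      calc _ ≤ C * Real.exp (σ * x) * Real.exp (-(σ * x)) := by gcongr
        _ = C := by rw [mul_assoc, ← Real.exp_add]; simp
    · intro x
      rw [hn]
      simpa using hM x
  rw [hn] at key
  calc ‖H z‖ = ‖H z‖ * Real.exp (-(σ * z.re)) * Real.exp (σ * z.re) := by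
        rw [mul_assoc, ← Real.exp_add]; simp
    _ ≤ _ := by gcongr

theorem aux_pl (G : ℂ → ℂ) (hG : Differentiable ℂ G) (σ C M : ℝ) (hσ : 0 < σ)
    (hC : ∀ z, ‖G z‖ ≤ C * Real.exp (σ * ‖z‖))
    (hM : ∀ x : ℝ, ‖G x‖ ≤ M) (z : ℂ) :
    ‖G z‖ ≤ M * Real.exp (σ * |z.im|) := by
  rcases le_total 0 z.im with h | h
  · have := aux_half (fun w => G (Complex.I * w)) (by fun_prop) σ C M hσ
      (fun w => by simpa using hC (Complex.I * w))
      (fun x => by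
        have e : Complex.I * (x * Complex.I) = ((-x : ℝ) : ℂ) := by
          push_cast; linear_combination (x : ℂ) * Complex.I_mul_I
        simp only [e]; exact hM _)
      (-Complex.I * z) (by simpa using h)
    have e : Complex.I * (-Complex.I * z) = z := by
      linear_combination (-z) * Complex.I_mul_I
    simp only [e] at this
    simpa [abs_of_nonneg h] using this
  · have := aux_half (fun w => G (-Complex.I * w)) (by fun_prop) σ C M hσ
      (fun w => by simpa using hC (-Complex.I * w))
      (fun x => by
        have e : -Complex.I * (x * Complex.I) = ((x : ℝ) : ℂ) := by
          linear_combination (-x : ℂ) * Complex.I_mul_I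
        simp only [e]; exact hM _)
      (Complex.I * z) (by simpa using h)
    have e : -Complex.I * (Complex.I * z) = z := by
      linear_combination (-z) * Complex.I_mul_I
    simp only [e] at this
    simpa [abs_of_nonpos h] using this

theorem aux_exp (w : ℝ) (h0 : 0 ≤ w) (h1 : w ≤ 5 / 4) : Real.exp w ≤ 7 / 5 * (1 + w ^ 2) := by
  have hmono : MonotoneOn (fun w : ℝ => Real.exp w / (1 + w ^ 2)) (Set.Icc 0 (5/4)) := by
    apply Monotone.monotoneOn
    have hd : ∀ x : ℝ, HasDerivAt (fun w : ℝ => Real.exp w / (1 + w ^ 2))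
        ((Real.exp x * (1 + x ^ 2) - Real.exp x * (2 * x)) / (1 + x ^ 2) ^ 2) x := by
      intro x
      have h2 : HasDerivAt (fun w : ℝ => 1 + w ^ 2) (2 * x) x := by
        simpa using (hasDerivAt_pow 2 x).const_add 1
      exact (Real.hasDerivAt_exp x).div h2 (by positivity)
    refine monotone_of_deriv_nonneg (fun x => (hd x).differentiableAt) fun x => ?_
    rw [(hd x).deriv]
    apply div_nonneg _ (by positivity)
    have := Real.exp_pos x
    nlinarith [mul_nonneg this.le (sq_nonneg (x - 1))]
  have h := hmono ⟨h0, h1⟩ ⟨by norm_num, le_rfl⟩ h1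
  simp only at h
  have he : Real.exp (5 / 4) ≤ 7 / 5 * (1 + (5 / 4) ^ 2) := by
    have h4 : Real.exp (5 / 4) ^ 4 = Real.exp 1 ^ 5 := by
      rw [← Real.exp_nat_mul, ← Real.exp_nat_mul]; norm_num
    have := Real.exp_one_lt_d9
    have h5 : Real.exp 1 ^ 5 ≤ 2.7182818286 ^ 5 := by gcongr
    by_contra hcon
    push Not at hcon
    have : (7 / 5 * (1 + (5 / 4 : ℝ) ^ 2)) ^ 4 < Real.exp (5 / 4) ^ 4 := by gcongr
    rw [h4] at this
    norm_num at this h5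
    linarith
  have h6 : Real.exp (5 / 4) / (1 + (5 / 4) ^ 2) ≤ 7 / 5 := by
    rw [div_le_iff₀ (by norm_num)]; exact he
  have := h.trans h6
  rwa [div_le_iff₀ (by positivity)] at this

/-- Bernstein type inequality with constant less than two. -/
theorem aux_bern (G : ℂ → ℂ) (hG : Differentiable ℂ G) (σ M : ℝ) (hσ : 0 < σ) (hM0 : 0 ≤ M)
    (hM : ∀ z : ℂ, ‖G z‖ ≤ M * Real.exp (σ * |z.im|)) (x : ℝ) :
    ‖deriv G x‖ ≤ 2 * σ * M := by
  set R : ℝ := 5 / 4 / σ with hR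
  have hRpos : 0 < R := by positivity
  have hσR : σ * R = 5 / 4 := by rw [hR]; field_simp
  have h1 := Complex.two_pi_I_inv_smul_circleIntegral_sub_sq_inv_smul_of_differentiable
    (U := Set.univ) isOpen_univ (c := (x : ℂ)) (w₀ := (x : ℂ)) (R := R) (f := G)
    (Set.subset_univ _) hG.differentiableOn (Metric.mem_ball_self hRpos)
  rw [← h1, norm_smul]
  have h2 : ‖∮ z in C((x : ℂ), R), ((z - x) ^ 2)⁻¹ • G z‖ ≤
      ∫ θ in (0 : ℝ)..2 * π, R⁻¹ * M * (7 / 5) * (1 + (5 / 4) ^ 2 * Real.sin θ ^ 2) := by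
    rw [circleIntegral]
    refine intervalIntegral.norm_integral_le_of_norm_le (by positivity) ?_ ?_
    · refine Filter.Eventually.of_forall fun θ _ => ?_
      have e1 : ‖circleMap (x : ℂ) R θ - x‖ = R := by
        simp [circleMap, abs_of_pos hRpos]
      have e2 : |(circleMap (x : ℂ) R θ).im| = R * |Real.sin θ| := by
        simp [circleMap, Complex.exp_im, abs_mul, abs_of_pos hRpos]
      have e3 : ‖deriv (circleMap (x : ℂ) R) θ‖ = R := by
        simp [deriv_circleMap, abs_of_pos hRpos]
      rw [norm_smul, norm_smul, norm_inv, norm_pow, e1, e3]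
      have h3 := hM (circleMap (x : ℂ) R θ)
      rw [e2, ← mul_assoc, hσR] at h3
      have h4 := aux_exp (5 / 4 * |Real.sin θ|) (by positivity)
        (by have := Real.abs_sin_le_one θ; linarith)
      rw [mul_pow, sq_abs] at h4
      have h5 := h3.trans (mul_le_mul_of_nonneg_left h4 hM0)
      have h6 : R * ((R ^ 2)⁻¹ * ‖G (circleMap (x : ℂ) R θ)‖) =
        R⁻¹ * ‖G (circleMap (x : ℂ) R θ)‖ := by field_simp
      rw [h6]
      calc _ ≤ R⁻¹ * (M * (7 / 5 * (1 + (5 / 4) ^ 2 * Real.sin θ ^ 2))) := by gcongr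
        _ = _ := by ring
    · exact Continuous.intervalIntegrable (by fun_prop) _ _
  have h7 : ∫ θ in (0 : ℝ)..2 * π, R⁻¹ * M * (7 / 5) * (1 + (5 / 4) ^ 2 * Real.sin θ ^ 2)
      = R⁻¹ * M * (7 / 5) * (2 * π + (5 / 4) ^ 2 * π) := by
    rw [intervalIntegral.integral_const_mul, intervalIntegral.integral_add (by simp)
      (Continuous.intervalIntegrable (by fun_prop) _ _), intervalIntegral.integral_const_mul,
      integral_sin_sq]
    simp
  rw [h7] at h2
  have h8 : ‖(2 * π * Complex.I : ℂ)⁻¹‖ = (2 * π)⁻¹ := by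
    simp [abs_of_pos Real.pi_pos]
  rw [h8]
  have h9 : R⁻¹ = σ * (4 / 5) := by rw [hR]; field_simp
  rw [h9] at h2
  calc _ ≤ (2 * π)⁻¹ * (σ * (4 / 5) * M * (7 / 5) * (2 * π + (5 / 4) ^ 2 * π)) := by gcongr
    _ = σ * M * ((4 / 5) * (7 / 5) * (2 + (5 / 4) ^ 2) / 2) := by field_simp
    _ ≤ σ * M * 2 := by gcongr; norm_num
    _ = _ := by ring

theorem aux_sup (τ : ℝ) (hτ : 0 < τ) (F : ℂ → ℂ)
    (hF : Differentiable ℂ F)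
    (htype : ∀ ε > 0, ∃ C : ℝ, ∀ z : ℂ, ‖F z‖ ≤ C * Real.exp ((τ + ε) * ‖z‖))
    (hint : Integrable (fun x : ℝ => F x)) (x : ℝ) :
    ‖F x‖ ≤ τ * ∫ x : ℝ, ‖F x‖ := by
  set L := ∫ x : ℝ, ‖F x‖ with hL
  have hL0 : 0 ≤ L := integral_nonneg fun _ => norm_nonneg _
  obtain ⟨G, hG0, hG'⟩ := hF.isExactOn_univ.with_val_at 0
    ((∫ t in Set.Iic (0 : ℝ), F t) - (1 / 2) * ∫ t : ℝ, F t)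
  have hG : ∀ z, HasDerivAt G (F z) z := fun z => hG' z (Set.mem_univ _)
  have hGd : Differentiable ℂ G := fun z => (hG z).differentiableAt
  have hreal : ∀ y : ℝ, ‖G y‖ ≤ L / 2 := by
    intro y
    have h1 : ∫ t in (0 : ℝ)..y, F t = G y - G (0 : ℝ) :=
      intervalIntegral.integral_eq_sub_of_hasDerivAt (f := fun t : ℝ => G t)
        (fun t _ => (hG t).comp_ofReal) hint.intervalIntegrable
    have h2 := intervalIntegral.integral_Iic_sub_Iic (a := (0 : ℝ)) (b := y)
      hint.integrableOn hint.integrableOn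
    have h3 := intervalIntegral.integral_Iic_add_Ioi (b := y)
      hint.integrableOn hint.integrableOn
    have h4 := intervalIntegral.integral_Iic_add_Ioi (b := y)
      hint.norm.integrableOn hint.norm.integrableOn
    have h5 : G y = (1 / 2) * ((∫ t in Set.Iic y, F t) - ∫ t in Set.Ioi y, F t) := by
      rw [Complex.ofReal_zero, hG0] at h1
      linear_combination -h1 - h2 + (1 / 2) * h3
    rw [h5, norm_mul]
    have h6 : ‖(∫ t in Set.Iic y, F t) - ∫ t in Set.Ioi y, F t‖ ≤ L := by
      rw [hL, ← h4]
      exact (norm_sub_le _ _).trans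
        (add_le_add (norm_integral_le_integral_norm _) (norm_integral_le_integral_norm _))
    have h7 : ‖(1 / 2 : ℂ)‖ = 1 / 2 := by norm_num
    rw [h7]; linarith
  have main : ∀ ε > 0, ‖F x‖ ≤ (τ + ε) * L := by
    intro ε hε
    obtain ⟨C, hC⟩ := htype (ε / 2) (by positivity)
    have hC0 : 0 ≤ C := by
      have := (norm_nonneg _).trans (hC 0)
      simpa using this
    have hb : ∀ z, ‖G z‖ ≤ (‖G 0‖ + C * (2 / ε)) * Real.exp ((τ + ε) * ‖z‖) := by
      intro z
      have h1 : ‖G z - G 0‖ ≤ C * Real.exp ((τ + ε / 2) * ‖z‖) * ‖z - 0‖ := by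
        refine Convex.norm_image_sub_le_of_norm_hasDerivWithin_le
          (s := Metric.closedBall 0 ‖z‖) (f' := F)
          (fun w _ => (hG w).hasDerivWithinAt) (fun w hw => ?_) (convex_closedBall _ _)
          (by simp) (by simp)
        have hw : ‖w‖ ≤ ‖z‖ := by simpa using hw
        refine (hC w).trans ?_
        gcongr
      rw [sub_zero] at h1
      have h2 : ‖z‖ ≤ (2 / ε) * Real.exp (ε / 2 * ‖z‖) := by
        have := Real.add_one_le_exp (ε / 2 * ‖z‖)
        calc ‖z‖ = (2 / ε) * (ε / 2 * ‖z‖) := by field_simp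
          _ ≤ _ := by gcongr; linarith
      have h3 : C * Real.exp ((τ + ε / 2) * ‖z‖) * ‖z‖ ≤
          C * (2 / ε) * Real.exp ((τ + ε) * ‖z‖) := by
        calc _ ≤ C * Real.exp ((τ + ε / 2) * ‖z‖) * ((2 / ε) * Real.exp (ε / 2 * ‖z‖)) := by
              gcongr
          _ = C * (2 / ε) * (Real.exp ((τ + ε / 2) * ‖z‖) * Real.exp (ε / 2 * ‖z‖)) := by ring
          _ = _ := by rw [← Real.exp_add]; ring_nf
      have h4 : 1 ≤ Real.exp ((τ + ε) * ‖z‖) := Real.one_le_exp (by positivity)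
      have h5 : ‖G z‖ ≤ ‖G 0‖ + ‖G z - G 0‖ := by
        simpa using norm_add_le (G 0) (G z - G 0)
      nlinarith [norm_nonneg (G 0)]
    have := aux_bern G hGd (τ + ε) (L / 2) (by positivity) (by positivity)
      (aux_pl G hGd (τ + ε) _ (L / 2) (by positivity) hb hreal) x
    rw [(hG x).deriv] at this
    linarith
  refine le_of_forall_pos_le_add fun η hη => ?_
  refine (main (η / (L + 1)) (by positivity)).trans ?_
  have : η / (L + 1) * L ≤ η := by
    rw [div_mul_eq_mul_div, div_le_iff₀ (by positivity)]; nlinarith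
  linarith

/-- If `F` is entire of exponential type at most `2πδ` and integrable on `ℝ`,
then `‖F‖_2 ≤ (2πδ)^{1/2} ‖F‖_1`. -/
theorem stmt1 (δ : ℝ) (hδ : 0 < δ) (F : ℂ → ℂ)
    (hF : Differentiable ℂ F)
    (htype : ∀ ε > 0, ∃ C : ℝ, ∀ z : ℂ, ‖F z‖ ≤ C * Real.exp ((2 * π * δ + ε) * ‖z‖))
    (hint : Integrable (fun x : ℝ => F x)) :
    Real.sqrt (∫ x : ℝ, ‖F x‖ ^ 2) ≤ Real.sqrt (2 * π * δ) * ∫ x : ℝ, ‖F x‖ := by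
  have hs := aux_sup (2 * π * δ) (by positivity) F hF htype hint
  set L := ∫ x : ℝ, ‖F x‖ with hL
  have hL0 : 0 ≤ L := integral_nonneg fun _ => norm_nonneg _
  have h1 : ∫ x : ℝ, ‖F x‖ ^ 2 ≤ ∫ x : ℝ, (2 * π * δ * L) * ‖F x‖ := by
    refine integral_mono_of_nonneg (Filter.Eventually.of_forall fun x => by positivity)
      (hint.norm.const_mul _) (Filter.Eventually.of_forall fun x => ?_)
    simp only
    rw [sq]
    exact mul_le_mul_of_nonneg_right (hs x) (norm_nonneg _)
  rw [integral_const_mul, ← hL] at h1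
  calc _ ≤ Real.sqrt (2 * π * δ * (L ^ 2)) := Real.sqrt_le_sqrt (by linarith)
    _ = _ := by rw [Real.sqrt_mul (by positivity), Real.sqrt_sq hL0]
end

section
/- Let δ > 0 and let F : ℂ → ℂ be an entire function of exponential type at most 2πδ with F integrable on ℝ. Then the Fourier transform t ↦ ∫_ℝ F(x) e^{-2πitx} dx is continuous and vanishes for |t| > δ, and for every z ∈ ℂ one has F(z) = ∫_{-δ}^{δ} F̂(t) e^{2πitz} dt. -/
open MeasureTheory Real

/-- Phragmen-Lindelof in the upper half plane. -/
lemma pl_upper_s2 (P : ℂ → ℂ) (hP : Differentiable ℂ P) (c A M : ℝ)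
    (hA : ∀ z, ‖P z‖ ≤ A * Real.exp (c * ‖z‖)) (hM : ∀ x : ℝ, ‖P x‖ ≤ M)
    (z : ℂ) (hz : 0 ≤ z.im) : ‖P z‖ ≤ M * Real.exp (c * z.im) := by
  have hnorm : ∀ w : ℂ, ‖P (Complex.I * w) * Complex.exp (-c * w)‖
      = ‖P (Complex.I * w)‖ * Real.exp (-c * w.re) := by
    intro w
    rw [norm_mul, Complex.norm_exp]
    simp
  have key := PhragmenLindelof.right_half_plane_of_bounded_on_real
    (f := fun w => P (Complex.I * w) * Complex.exp (-c * w)) (C := M) (z := -Complex.I * z)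
    ?_ ?_ ?_ ?_ ?_
  · rw [hnorm] at key
    have e1 : Complex.I * (-Complex.I * z) = z := by
      rw [← mul_assoc]; simp
    have e2 : (-Complex.I * z).re = z.im := by simp
    rw [e1, e2] at key
    calc ‖P z‖ = (‖P z‖ * Real.exp (-c * z.im)) * Real.exp (c * z.im) := by
          rw [mul_assoc, ← Real.exp_add]; simp
      _ ≤ _ := by gcongr
  · apply Differentiable.diffContOnCl
    fun_prop
  · refine ⟨1, by norm_num, c + |c|, ?_⟩
    refine Asymptotics.IsBigO.of_bound A (Filter.Eventually.of_forall fun w => ?_)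
    rw [hnorm]
    have h1 := hA (Complex.I * w)
    simp only [norm_mul, Complex.norm_I, one_mul] at h1
    have h2 : -c * w.re ≤ |c| * ‖w‖ := by
      calc -c * w.re ≤ |-c * w.re| := le_abs_self _
        _ = |c| * |w.re| := by rw [abs_mul, abs_neg]
        _ ≤ _ := by gcongr; exact Complex.abs_re_le_norm w
    rw [Real.norm_of_nonneg (Real.exp_pos _).le, Real.rpow_one]
    calc ‖P (Complex.I * w)‖ * Real.exp (-c * w.re)
        ≤ (A * Real.exp (c * ‖w‖)) * Real.exp (|c| * ‖w‖) := by
          gcongr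
          exact (norm_nonneg _).trans h1
      _ = _ := by rw [mul_assoc, ← Real.exp_add]; ring_nf
  · refine ⟨A, ?_⟩
    simp only [Filter.eventually_map]
    filter_upwards [Filter.eventually_ge_atTop 0] with x hx
    rw [hnorm]
    have h1 := hA (Complex.I * x)
    simp only [norm_mul, Complex.norm_I, one_mul, Complex.norm_real, Real.norm_of_nonneg hx] at h1
    calc ‖P (Complex.I * x)‖ * Real.exp (-c * (x:ℂ).re)
        ≤ (A * Real.exp (c * x)) * Real.exp (-c * x) := by simp only [Complex.ofReal_re]; gcongr
      _ = A := by rw [mul_assoc, ← Real.exp_add]; simp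
  · intro x
    rw [hnorm]
    have := hM (-x)
    have e : Complex.I * (x * Complex.I) = ((-x : ℝ) : ℂ) := by
      rw [mul_left_comm]; simp
    rw [e]
    simpa using this
  · simpa using hz

lemma pl_all (P : ℂ → ℂ) (hP : Differentiable ℂ P) (c A M : ℝ)
    (hA : ∀ z, ‖P z‖ ≤ A * Real.exp (c * ‖z‖)) (hM : ∀ x : ℝ, ‖P x‖ ≤ M)
    (z : ℂ) : ‖P z‖ ≤ M * Real.exp (c * |z.im|) := by
  rcases le_total 0 z.im with h | h
  · rw [abs_of_nonneg h]; exact pl_upper_s2 P hP c A M hA hM z h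
  · rw [abs_of_nonpos h]
    have := pl_upper_s2 (fun w => P (-w)) (by fun_prop) c A M (fun w => by simpa using hA (-w))
      (fun x => by simpa using hM (-x)) (-z) (by simpa using h)
    simpa using this

/-- Bound off the real line for `F`, through a primitive. -/
lemma F_bound (F : ℂ → ℂ) (hF : Differentiable ℂ F) (c ε A : ℝ) (hc : 0 ≤ c) (hε : 0 < ε)
    (hA : ∀ z, ‖F z‖ ≤ A * Real.exp (c * ‖z‖)) (hint : Integrable (fun x : ℝ => F x)) :
    ∃ M, 0 ≤ M ∧ ∀ z : ℂ, ‖F z‖ ≤ M * Real.exp ((c + ε) * |z.im|) := by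
  have hA0 : 0 ≤ A := by simpa using (norm_nonneg _).trans (hA 0)
  obtain ⟨P, hP0, hP⟩ := (Complex.IsConservativeOn.isExactOn_univ hF.continuous
    hF.differentiableOn.isConservativeOn).with_val_at 0 0
  replace hP := fun z => hP z (Set.mem_univ z)
  have hPd : Differentiable ℂ P := fun z => (hP z).differentiableAt
  have hPA : ∀ z, ‖P z‖ ≤ (A / ε) * Real.exp ((c + ε) * ‖z‖) := by
    intro z
    have h1 := (convex_closedBall (0:ℂ) ‖z‖).norm_image_sub_le_of_norm_hasDerivWithin_le
      (f := P) (f' := F) (C := A * Real.exp (c * ‖z‖)) (x := 0) (y := z)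
      (fun w _ => (hP w).hasDerivWithinAt) (fun w hw => (hA w).trans (by
        have : ‖w‖ ≤ ‖z‖ := by simpa using hw
        gcongr)) (by simp) (by simp)
    rw [hP0, sub_zero, sub_zero] at h1
    have h2 : ‖z‖ ≤ Real.exp (ε * ‖z‖) / ε := by
      rw [le_div_iff₀ hε]
      have := Real.add_one_le_exp (ε * ‖z‖)
      linarith
    calc ‖P z‖ ≤ A * Real.exp (c * ‖z‖) * (Real.exp (ε * ‖z‖) / ε) := h1.trans (by gcongr)
      _ = _ := by rw [add_mul, Real.exp_add]; ring
  have hPM : ∀ x : ℝ, ‖P x‖ ≤ ∫ x : ℝ, ‖F x‖ := by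
    intro x
    have : ∫ s in (0:ℝ)..x, F s = P x - P (0:ℝ) :=
      intervalIntegral.integral_eq_sub_of_hasDerivAt (f := fun s : ℝ => P s)
        (fun s _ => (hP s).comp_ofReal) (hint.intervalIntegrable)
    rw [Complex.ofReal_zero, hP0, sub_zero] at this
    rw [← this]
    refine intervalIntegral.norm_integral_le_integral_norm_uIoc.trans ?_
    exact setIntegral_le_integral hint.norm (Filter.Eventually.of_forall fun _ => norm_nonneg _)
  have hall := pl_all P hPd _ _ _ hPA hPM
  have hM0 : 0 ≤ ∫ x : ℝ, ‖F x‖ := integral_nonneg fun _ => norm_nonneg _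
  refine ⟨(∫ x : ℝ, ‖F x‖) * Real.exp (c + ε), by positivity, fun z => ?_⟩
  have := Complex.norm_deriv_le_of_forall_mem_sphere_norm_le (c := z) (R := 1) (f := P)
    (C := (∫ x : ℝ, ‖F x‖) * Real.exp ((c + ε) * (|z.im| + 1))) one_pos hPd.diffContOnCl
    (fun w hw => (hall w).trans (by
      have h3 : |w.im| ≤ |z.im| + 1 := by
        have h4 : |(w - z).im| ≤ 1 := (Complex.abs_im_le_norm _).trans (by
          simpa [dist_eq_norm] using le_of_eq (mem_sphere_iff_norm.1 hw))
        have h5 : w.im = z.im + (w - z).im := by simp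
        rw [h5]
        exact (abs_add_le _ _).trans (by gcongr)
      gcongr))
  rw [(hP z).deriv, div_one] at this
  refine this.trans (le_of_eq ?_)
  rw [mul_assoc, ← Real.exp_add]
  ring_nf

/-- regularized contour integral vanishes -/
lemma contour_zero (f : ℂ → ℂ) (hf : Differentiable ℂ f) (M η : ℝ) (hη : 0 < η)
    (hM : ∀ z : ℂ, 0 ≤ z.im → ‖f z‖ ≤ M) (hint : Integrable (fun x : ℝ => f x)) :
    ∫ x : ℝ, f x / (1 - Complex.I * η * x) ^ 2 = 0 := by
  have hM0 : 0 ≤ M := (norm_nonneg _).trans (hM 0 le_rfl)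
  have hre : ∀ z : ℂ, (1 - Complex.I * η * z).re = 1 + η * z.im := by
    intro z; simp
  have him : ∀ z : ℂ, (1 - Complex.I * η * z).im = - (η * z.re) := by
    intro z; simp
  have hne : ∀ z : ℂ, 0 ≤ z.im → 1 ≤ ‖1 - Complex.I * η * z‖ := by
    intro z hz
    refine le_trans ?_ (Complex.abs_re_le_norm _)
    rw [hre]
    exact le_trans (by nlinarith [mul_nonneg hη.le hz]) (le_abs_self _)
  set g : ℂ → ℂ := fun z => f z / (1 - Complex.I * η * z) ^ 2 with hg
  have hgi : Integrable (fun x : ℝ => g x) := by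
    refine hint.mono ?_ (Filter.Eventually.of_forall fun x => ?_)
    · refine Continuous.aestronglyMeasurable ?_
      refine Continuous.div (hf.continuous.comp Complex.continuous_ofReal) (by fun_prop) ?_
      intro x h
      have := hne x (by simp)
      rw [pow_eq_zero_iff two_ne_zero] at h
      rw [h] at this
      norm_num at this
    · simp only [hg, norm_div, norm_pow]
      exact div_le_self (norm_nonneg _) (one_le_pow₀ (hne x (by simp)))
  have hbd : ∀ R : ℝ, 0 < R → ∀ z : ℂ, 0 ≤ z.im → (R ≤ |z.re| ∨ R ≤ z.im) →
      ‖g z‖ ≤ M / (η * R) ^ 2 := by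
    intro R hR z hz h
    simp only [hg, norm_div, norm_pow]
    have : η * R ≤ ‖1 - Complex.I * η * z‖ := by
      rcases h with h | h
      · refine le_trans ?_ (Complex.abs_im_le_norm _)
        rw [him, abs_neg, abs_mul, abs_of_pos hη]; gcongr
      · refine le_trans ?_ (Complex.abs_re_le_norm _)
        rw [hre]
        refine le_trans ?_ (le_abs_self _)
        nlinarith [mul_le_mul_of_nonneg_left h hη.le]
    have := hM z hz
    gcongr
  have hR : ∀ R : ℝ, 0 < R → ‖∫ x in (-R)..R, g x‖ ≤ 4 * M / η ^ 2 / R := by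
    intro R hR
    have H := Complex.integral_boundary_rect_eq_zero_of_differentiableOn g
      ((-R : ℝ) : ℂ) (R + R * Complex.I) ?_
    · simp only [Complex.ofReal_re, Complex.ofReal_im, Complex.add_re, Complex.add_im,
        Complex.mul_re, Complex.mul_im, Complex.I_re, Complex.I_im, mul_zero, mul_one, sub_zero,
        zero_mul, add_zero, zero_add, Complex.ofReal_zero] at H
      have b1 : ‖∫ x : ℝ in (-R)..R, g (x + R * Complex.I)‖ ≤ M / (η * R) ^ 2 * |R - -R| :=
        intervalIntegral.norm_integral_le_of_norm_le_const fun x _ =>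
          hbd R hR _ (by simp [hR.le]) (by simp)
      have b2 : ‖∫ y : ℝ in (0)..R, g (R + y * Complex.I)‖ ≤ M / (η * R) ^ 2 * |R - 0| :=
        intervalIntegral.norm_integral_le_of_norm_le_const fun x hx => by
          rw [Set.uIoc_of_le hR.le] at hx
          exact hbd R hR _ (by simp [hx.1.le]) (by simp [le_abs_self])
      have b3 : ‖∫ y : ℝ in (0)..R, g ((-R : ℝ) + y * Complex.I)‖ ≤ M / (η * R) ^ 2 * |R - 0| :=
        intervalIntegral.norm_integral_le_of_norm_le_const fun x hx => by
          rw [Set.uIoc_of_le hR.le] at hx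
          exact hbd R hR _ (by simp [hx.1.le]) (by simp [le_abs_self])
      have e : ∫ x in (-R)..R, g x = (∫ x : ℝ in (-R)..R, g (x + R * Complex.I))
          - Complex.I • (∫ y : ℝ in (0)..R, g (R + y * Complex.I))
          + Complex.I • (∫ y : ℝ in (0)..R, g ((-R : ℝ) + y * Complex.I)) := by
        linear_combination H
      rw [e]
      refine (norm_add_le _ _).trans ((add_le_add (norm_sub_le _ _) le_rfl).trans ?_)
      rw [norm_smul, norm_smul, Complex.norm_I, one_mul, one_mul]
      rw [sub_zero, abs_of_pos hR] at b2 b3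
      rw [sub_neg_eq_add, abs_of_pos (by linarith)] at b1
      refine (add_le_add (add_le_add b1 b2) b3).trans (le_of_eq ?_)
      field_simp
      ring
    · intro z hz
      have hz2 : 0 ≤ z.im := by
        have := hz.2
        simp [Set.uIcc_of_le hR.le] at this
        exact this.1
      refine (DifferentiableAt.div hf.differentiableAt (by fun_prop) ?_).differentiableWithinAt
      intro h
      have := hne z hz2
      rw [pow_eq_zero_iff two_ne_zero] at h
      rw [h] at this
      norm_num at this
  have t1 : Filter.Tendsto (fun R : ℝ => ∫ x in (-R)..R, g x) Filter.atTop
      (nhds (∫ x : ℝ, g x)) :=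
    intervalIntegral_tendsto_integral hgi Filter.tendsto_neg_atTop_atBot Filter.tendsto_id
  have t2 : Filter.Tendsto (fun R : ℝ => ∫ x in (-R)..R, g x) Filter.atTop (nhds 0) := by
    refine squeeze_zero_norm' ?_ (Filter.Tendsto.const_div_atTop Filter.tendsto_id (4 * M / η ^ 2))
    filter_upwards [Filter.eventually_gt_atTop 0] with R h using hR R h
  exact tendsto_nhds_unique t1 t2

lemma int_zero (f : ℂ → ℂ) (hf : Differentiable ℂ f) (M : ℝ)
    (hM : ∀ z : ℂ, 0 ≤ z.im → ‖f z‖ ≤ M) (hint : Integrable (fun x : ℝ => f x)) :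
    ∫ x : ℝ, f x = 0 := by
  have t : Filter.Tendsto (fun n : ℕ => ∫ x : ℝ, f x / (1 - Complex.I * (1 / ((n:ℝ) + 1) : ℝ) * x) ^ 2)
      Filter.atTop (nhds (∫ x : ℝ, f x)) := by
    refine tendsto_integral_of_dominated_convergence (fun x => ‖f x‖) ?_ hint.norm ?_ ?_
    · intro n
      refine AEStronglyMeasurable.div₀ hint.1 ?_
      exact Continuous.aestronglyMeasurable (by fun_prop)
    · intro n
      refine Filter.Eventually.of_forall fun x => ?_
      rw [norm_div, norm_pow]
      refine div_le_self (norm_nonneg _) (one_le_pow₀ ?_)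
      refine le_trans ?_ (Complex.abs_re_le_norm _)
      have : (1 - Complex.I * (1 / ((n:ℝ) + 1) : ℝ) * x).re = 1 := by
        rw [Complex.sub_re, mul_assoc, ← Complex.ofReal_mul, Complex.I_mul_re]
        simp
      rw [this]; simp
    · refine Filter.Eventually.of_forall fun x => ?_
      have h0 : Filter.Tendsto (fun n : ℕ => ((1 / ((n:ℝ) + 1) : ℝ) : ℂ)) Filter.atTop (nhds 0) := by
        have := (Complex.continuous_ofReal.tendsto 0).comp
          (tendsto_one_div_add_atTop_nhds_zero_nat (𝕜 := ℝ))
        simpa [Function.comp_def] using this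
      have hc : ContinuousAt (fun w : ℂ => f x / (1 - Complex.I * w * x) ^ 2) 0 := by
        refine ContinuousAt.div (by fun_prop) (by fun_prop) (by simp)
      have := hc.tendsto.comp h0
      simpa [Function.comp_def] using this
  have : (fun n : ℕ => ∫ x : ℝ, f x / (1 - Complex.I * (1 / ((n:ℝ) + 1) : ℝ) * x) ^ 2)
      = fun _ => 0 := by
    funext n
    exact contour_zero f hf M _ (by positivity) hM hint
  rw [this] at t
  exact tendsto_nhds_unique t tendsto_const_nhds

lemma hat_zero (F : ℂ → ℂ) (hF : Differentiable ℂ F) (M κ : ℝ)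
    (hM : ∀ z : ℂ, ‖F z‖ ≤ M * Real.exp (κ * |z.im|))
    (hint : Integrable (fun x : ℝ => F x)) :
    ∫ x : ℝ, F x * Complex.exp (κ * x * Complex.I) = 0 := by
  refine int_zero (fun z => F z * Complex.exp (κ * z * Complex.I)) (by fun_prop) M ?_ ?_
  · intro z hz
    have h := hM z
    rw [abs_of_nonneg hz] at h
    rw [norm_mul, Complex.norm_exp]
    have : (κ * z * Complex.I).re = - (κ * z.im) := by simp
    rw [this]
    calc _ ≤ (M * Real.exp (κ * z.im)) * Real.exp (-(κ * z.im)) := by gcongr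
      _ = M := by rw [mul_assoc, ← Real.exp_add]; simp
  · refine hint.mono (hint.1.mul (Continuous.aestronglyMeasurable (by fun_prop)))
      (Filter.Eventually.of_forall fun x => ?_)
    rw [norm_mul, ← Complex.ofReal_mul, Complex.norm_exp_ofReal_mul_I, mul_one]

lemma integral_entire (δ : ℝ) (h : ℝ → ℂ) (hc : Continuous h) :
    Differentiable ℂ (fun z : ℂ => ∫ t in (-δ)..δ, h t * Complex.exp (2 * π * t * z * Complex.I)) := by
  intro z₀
  have hcont : Continuous (fun p : ℂ × ℝ =>
      h p.2 * (Complex.exp (2 * π * p.2 * p.1 * Complex.I) * (2 * π * p.2 * Complex.I))) := by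
    fun_prop
  obtain ⟨B, hB⟩ := ((isCompact_closedBall z₀ 1).prod (isCompact_uIcc (a := -δ) (b := δ))).exists_bound_of_continuousOn
    hcont.continuousOn
  refine (intervalIntegral.hasDerivAt_integral_of_dominated_loc_of_deriv_le (bound := fun _ => B)
    (F := fun z t => h t * Complex.exp (2 * π * t * z * Complex.I))
    (F' := fun z t => h t * (Complex.exp (2 * π * t * z * Complex.I) * (2 * π * t * Complex.I)))
    (Metric.closedBall_mem_nhds z₀ one_pos) ?_ ?_ ?_ ?_ ?_ ?_).2.differentiableAt
  · exact Filter.Eventually.of_forall fun z => Continuous.aestronglyMeasurable (by fun_prop)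
  · exact Continuous.intervalIntegrable (by fun_prop) _ _
  · exact Continuous.aestronglyMeasurable (by fun_prop)
  · exact Filter.Eventually.of_forall fun t ht z hz => hB (z, t) ⟨hz, Set.uIoc_subset_uIcc ht⟩
  · exact intervalIntegrable_const
  · refine Filter.Eventually.of_forall fun t ht z hz => ?_
    have h1 : HasDerivAt (fun z : ℂ => 2 * π * t * z * Complex.I) (2 * π * t * Complex.I) z := by
      have := ((hasDerivAt_id z).const_mul (2 * π * t : ℂ)).mul_const Complex.I
      simpa using this
    exact h1.cexp.const_mul _

/-- If `F` is entire of exponential type at most `2πδ` and integrable on `ℝ`,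
then its Fourier transform is continuous, vanishes for `|t| > δ`, and `F` is recovered at
every complex point by Fourier inversion over `[-δ, δ]`. -/
theorem stmt2 (δ : ℝ) (hδ : 0 < δ) (F : ℂ → ℂ)
    (hF : Differentiable ℂ F)
    (htype : ∀ ε > 0, ∃ C : ℝ, ∀ z : ℂ, ‖F z‖ ≤ C * Real.exp ((2 * π * δ + ε) * ‖z‖))
    (hint : Integrable (fun x : ℝ => F x))
    (Fhat : ℝ → ℂ)
    (hFhat : ∀ t : ℝ, Fhat t = ∫ x : ℝ, F x * Complex.exp (-(2 * π * t * x : ℝ) * Complex.I)) :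
    Continuous Fhat ∧ (∀ t : ℝ, δ < |t| → Fhat t = 0) ∧
      ∀ z : ℂ, F z = ∫ t in (-δ)..δ, Fhat t * Complex.exp (2 * π * t * z * Complex.I) := by
  have hcF : Continuous (fun x : ℝ => F x) := hF.continuous.comp Complex.continuous_ofReal
  have hfour : Fhat = FourierTransform.fourier (fun x : ℝ => F x) := by
    funext t
    rw [hFhat, Real.fourier_real_eq_integral_exp_smul]
    refine integral_congr_ae (Filter.Eventually.of_forall fun x => ?_)
    simp only [smul_eq_mul]
    rw [mul_comm]
    congr 2
    push_cast
    ring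
  have hcont : Continuous Fhat := by
    rw [hfour]
    exact VectorFourier.fourierIntegral_continuous Real.continuous_fourierChar
      (by fun_prop) hint
  have hzero : ∀ t : ℝ, δ < |t| → Fhat t = 0 := by
    intro t ht
    have hε : 0 < π * (|t| - δ) := mul_pos Real.pi_pos (by linarith)
    obtain ⟨A, hA⟩ := htype _ hε
    obtain ⟨M, _, hM⟩ := F_bound F hF _ _ A (by positivity) hε hA hint
    have hk : 2 * π * δ + π * (|t| - δ) + π * (|t| - δ) = 2 * π * |t| := by ring
    rw [hk] at hM
    rw [hFhat]
    rcases le_total 0 t with h0 | h0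
    · rw [abs_of_nonneg h0] at hM
      have := hat_zero (fun z => F (-z)) (by fun_prop) M (2 * π * t)
        (fun z => by simpa using hM (-z)) (by simpa using hint.comp_neg)
      rw [← integral_neg_eq_self] at this
      rw [← this]
      refine integral_congr_ae (Filter.Eventually.of_forall fun x => ?_)
      simp
    · rw [abs_of_nonpos h0] at hM
      have := hat_zero F hF M (2 * π * (-t)) hM hint
      rw [← this]
      refine integral_congr_ae (Filter.Eventually.of_forall fun x => ?_)
      simp
  refine ⟨hcont, hzero, ?_⟩
  have hsupp : Function.support Fhat ⊆ Set.Icc (-δ) δ := by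
    intro t ht
    by_contra h
    exact ht (hzero t (by
      by_contra h'
      exact h (abs_le.1 (not_lt.1 h'))))
  have hFi : Integrable Fhat :=
    hcont.integrable_of_hasCompactSupport (HasCompactSupport.intro isCompact_Icc
      (fun t ht => by
        by_contra h'
        exact ht (hsupp h')))
  have hreal : ∀ x : ℝ, F x = ∫ t in (-δ)..δ, Fhat t * Complex.exp (2 * π * t * x * Complex.I) := by
    intro x
    have h1 := congrFun (hcF.fourierInv_fourier_eq hint (hfour ▸ hFi)) x
    rw [← hfour, Real.fourierInv_eq'] at h1
    rw [← h1, intervalIntegral.integral_of_le (by linarith), ← integral_Icc_eq_integral_Ioc,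
      setIntegral_eq_integral_of_forall_compl_eq_zero]
    · refine integral_congr_ae (Filter.Eventually.of_forall fun t => ?_)
      simp only [smul_eq_mul]
      rw [mul_comm]
      congr 2
      simp
      ring
    · intro t ht
      have : Fhat t = 0 := by
        by_contra h'
        exact ht (hsupp h')
      rw [this, zero_mul]
  have hfreq : ∃ᶠ z in nhdsWithin (0:ℂ) {0}ᶜ, F z
      = ∫ t in (-δ)..δ, Fhat t * Complex.exp (2 * π * t * z * Complex.I) := by
    have ht : Filter.Tendsto (fun x : ℝ => (x : ℂ)) (nhdsWithin 0 {0}ᶜ) (nhdsWithin 0 {0}ᶜ) := by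
      refine tendsto_nhdsWithin_iff.2 ⟨?_, ?_⟩
      · exact (Complex.continuous_ofReal.tendsto' 0 0 (by simp)).mono_left nhdsWithin_le_nhds
      · filter_upwards [self_mem_nhdsWithin] with x hx
        simpa using hx
    exact ht.frequently (Filter.Frequently.of_forall hreal)
  have := AnalyticOnNhd.eq_of_frequently_eq (z₀ := (0:ℂ))
    (fun z _ => hF.analyticAt z) (fun z _ => (integral_entire δ Fhat hcont).analyticAt z) hfreq
  exact fun z => congrFun this z
end

section
/- For ν > −1 and ξ > 0, ξ J_ν(ξ)² + ξ J_{ν+1}(ξ)² − (2ν+1) J_ν(ξ) J_{ν+1}(ξ) = 2/π − (2ν+1) ∫_ξ^∞ x^{-1} J_ν(x) J_{ν+1}(x) dx. -/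
open Real MeasureTheory

/-- The Bessel function of the first kind of real order `ν`, defined by its power series
(for `x > 0`, using real powers). -/
noncomputable def besselJ (ν : ℝ) (x : ℝ) : ℝ :=
  ∑' m : ℕ, (-1) ^ m / (Nat.factorial m * Real.Gamma ((m : ℝ) + ν + 1)) *
    (x / 2) ^ (2 * (m : ℝ) + ν)

open Filter Topology Set

noncomputable def bc (ν : ℝ) (m : ℕ) : ℝ := (-1) ^ m / (Nat.factorial m * Real.Gamma ((m : ℝ) + ν + 1))

noncomputable def bg (ν z : ℝ) : ℝ := ∑' m : ℕ, bc ν m * z ^ m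

lemma bc_gpos {ν : ℝ} (hν : -1 < ν) (m : ℕ) : 0 < Real.Gamma ((m : ℝ) + ν + 1) := by
  apply Real.Gamma_pos_of_pos
  have : (0 : ℝ) ≤ m := m.cast_nonneg
  linarith

lemma bc_ne {ν : ℝ} (hν : -1 < ν) (m : ℕ) : bc ν m ≠ 0 := by
  have := bc_gpos hν m
  unfold bc
  positivity

lemma bc_succ {ν : ℝ} (m : ℕ) : ((m : ℝ) + 1) * bc ν (m + 1) = - bc (ν + 1) m := by
  unfold bc
  rw [Nat.factorial_succ]
  push_cast
  rw [show (m : ℝ) + 1 + ν + 1 = m + (ν + 1) + 1 by ring, pow_succ]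
  have : (m : ℝ) + 1 ≠ 0 := by positivity
  field_simp

lemma bc_shift {ν : ℝ} (hν : -1 < ν) (m : ℕ) : ((m : ℝ) + ν + 1) * bc (ν + 1) m = bc ν m := by
  unfold bc
  have h0 : (0 : ℝ) ≤ m := m.cast_nonneg
  have h1 : (m : ℝ) + ν + 1 ≠ 0 := by linarith
  have h2 := (bc_gpos hν m).ne'
  rw [show (m : ℝ) + (ν + 1) + 1 = (m + ν + 1) + 1 by ring, Real.Gamma_add_one h1]
  field_simp

lemma bc_summable {ν : ℝ} (hν : -1 < ν) (z : ℝ) : Summable (fun m => bc ν m * z ^ m) := by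
  rcases eq_or_ne z 0 with rfl | hz
  · apply summable_of_ne_finset_zero (s := {0})
    intro b hb
    have : b ≠ 0 := by simpa using hb
    simp [this]
  apply summable_of_ratio_test_tendsto_lt_one (l := 0) one_pos
  · exact Eventually.of_forall fun m => mul_ne_zero (bc_ne hν m) (pow_ne_zero _ hz)
  · have key : ∀ m : ℕ, ‖bc ν (m + 1) * z ^ (m + 1)‖ / ‖bc ν m * z ^ m‖
        = |z| * (((m : ℝ) + 1)⁻¹ * ((m : ℝ) + (ν + 1))⁻¹) := by
      intro m
      have h0 : (0 : ℝ) ≤ m := m.cast_nonneg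
      have h1 : 0 < (m : ℝ) + (ν + 1) := by linarith
      have e1 : bc ν (m + 1) = - (((m : ℝ) + 1)⁻¹ * ((m : ℝ) + (ν + 1))⁻¹) * bc ν m := by
        have a := bc_succ (ν := ν) m
        have b := bc_shift hν m
        rw [← b]
        have : (m : ℝ) + 1 ≠ 0 := by positivity
        field_simp
        rw [add_assoc]
        field_simp
        linarith
      rw [← norm_div, e1, pow_succ]
      have := bc_ne hν m
      rw [show (- (((m : ℝ) + 1)⁻¹ * ((m : ℝ) + (ν + 1))⁻¹) * bc ν m) * (z ^ m * z) / (bc ν m * z ^ m) = - (z * (((m : ℝ) + 1)⁻¹ * ((m : ℝ) + (ν + 1))⁻¹)) by field_simp]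
      rw [norm_neg, norm_mul, Real.norm_eq_abs, Real.norm_eq_abs, abs_of_pos (a := ((m : ℝ) + 1)⁻¹ * _)]
      positivity
    simp_rw [key]
    have t1 : Tendsto (fun m : ℕ => ((m : ℝ) + 1)⁻¹) atTop (𝓝 0) :=
      tendsto_inv_atTop_zero.comp (tendsto_atTop_add_const_right _ _ tendsto_natCast_atTop_atTop)
    have t2 : Tendsto (fun m : ℕ => ((m : ℝ) + (ν + 1))⁻¹) atTop (𝓝 0) :=
      tendsto_inv_atTop_zero.comp (tendsto_atTop_add_const_right _ _ tendsto_natCast_atTop_atTop)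
    simpa using (t1.mul t2).const_mul |z|

lemma bg_hasDerivAt {ν : ℝ} (hν : -1 < ν) (z : ℝ) : HasDerivAt (bg ν) (- bg (ν + 1) z) z := by
  have hs : ∀ w : ℝ, Summable (fun n : ℕ => bc ν n * ((n : ℝ) * w ^ (n - 1))) := by
    intro w
    rw [← summable_nat_add_iff 1]
    have := (bc_summable (ν := ν + 1) (by linarith) w).neg
    refine this.congr fun n => ?_
    have := bc_succ (ν := ν) n
    push_cast
    linear_combination (-w ^ n) * this
  have hd : HasDerivAt (bg ν) (∑' n : ℕ, bc ν n * ((n : ℝ) * z ^ (n - 1))) z := by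
    unfold bg
    refine hasDerivAt_tsum_of_isPreconnected (u := fun n : ℕ => ‖bc ν n * ((n : ℝ) * (|z| + 1) ^ (n - 1))‖)
      (t := Ioo (-(|z| + 1)) (|z| + 1)) (y₀ := 0) (g := fun n w => bc ν n * w ^ n)
      (g' := fun n w => bc ν n * ((n : ℝ) * w ^ (n - 1))) (hs _).norm isOpen_Ioo isPreconnected_Ioo ?_ ?_ ?_ (bc_summable hν 0) ?_
    · intro n y _
      exact (hasDerivAt_pow n y).const_mul _
    · intro n y hy
      have : |y| ≤ |z| + 1 := abs_le.2 ⟨hy.1.le, hy.2.le⟩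
      simp only [norm_mul, norm_pow, Real.norm_eq_abs]
      rw [abs_of_nonneg (a := |z| + 1) (by positivity)]
      gcongr
    · constructor <;> nlinarith [abs_nonneg z]
    · constructor <;> nlinarith [abs_nonneg z, neg_abs_le z, le_abs_self z]
  convert hd using 1
  rw [(hs z).tsum_eq_zero_add]
  simp only [Nat.cast_zero, zero_mul, mul_zero, zero_add]
  rw [bg, ← tsum_neg]
  refine tsum_congr fun n => ?_
  have := bc_succ (ν := ν) n
  push_cast
  linear_combination (-z ^ n) * this

lemma bg_rec {ν : ℝ} (hν : -1 < ν) (z : ℝ) :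
    bg ν z = (ν + 1) * bg (ν + 1) z - z * bg (ν + 1 + 1) z := by
  have h1 := bc_summable (ν := ν + 1) (by linarith) z
  have h0 := bc_summable hν z
  have h2 := bc_summable (ν := ν + 1 + 1) (by linarith) z
  have h3 : Summable (fun m : ℕ => (m : ℝ) * (bc (ν + 1) m * z ^ m)) := by
    refine (h0.sub (h1.mul_left (ν + 1))).congr fun m => ?_
    have := bc_shift hν m
    linear_combination (-z ^ m) * this
  have e3 : ∑' m : ℕ, (m : ℝ) * (bc (ν + 1) m * z ^ m) = - (z * bg (ν + 1 + 1) z) := by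
    rw [h3.tsum_eq_zero_add]
    simp only [Nat.cast_zero, zero_mul, zero_add]
    rw [bg, ← tsum_mul_left, ← tsum_neg]
    refine tsum_congr fun n => ?_
    have := bc_succ (ν := ν + 1) n
    push_cast
    linear_combination (z ^ (n + 1)) * this
  rw [sub_eq_add_neg, ← e3, bg, bg, ← tsum_mul_left, ← (h1.mul_left _).tsum_add h3]
  refine tsum_congr fun m => ?_
  have := bc_shift hν m
  linear_combination (-z ^ m) * this

lemma besselJ_eq {ν x : ℝ} (hx : 0 < x) : besselJ ν x = (x / 2) ^ ν * bg ν ((x / 2) ^ 2) := by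
  unfold besselJ bg
  rw [← tsum_mul_left]
  refine tsum_congr fun m => ?_
  have h : 0 < x / 2 := by positivity
  rw [Real.rpow_add h, show (2 * (m : ℝ)) = ((2 * m : ℕ) : ℝ) by push_cast; ring, Real.rpow_natCast,
    pow_mul, bc]
  ring

lemma besselJ_rec {ν x : ℝ} (hν : -1 < ν) (hx : 0 < x) :
    besselJ (ν + 1 + 1) x = 2 * (ν + 1) / x * besselJ (ν + 1) x - besselJ ν x := by
  rw [besselJ_eq hx, besselJ_eq hx, besselJ_eq hx, bg_rec hν]
  have h : 0 < x / 2 := by positivity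
  rw [Real.rpow_add h, Real.rpow_add h, Real.rpow_one]
  field_simp
  ring

lemma besselJ_hasDerivAt {ν x : ℝ} (hν : -1 < ν) (hx : 0 < x) :
    HasDerivAt (besselJ ν) (ν / x * besselJ ν x - besselJ (ν + 1) x) x := by
  have h : 0 < x / 2 := by positivity
  have e : besselJ ν =ᶠ[𝓝 x] fun x => (x / 2) ^ ν * bg ν ((x / 2) ^ 2) := by
    filter_upwards [lt_mem_nhds hx] with y hy
    exact besselJ_eq hy
  refine HasDerivAt.congr_of_eventuallyEq ?_ e
  have d1 : HasDerivAt (fun x : ℝ => x / 2) (1 / 2) x := (hasDerivAt_id x).div_const 2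
  have d2 := d1.rpow_const (p := ν) (Or.inl h.ne')
  have d3 := (bg_hasDerivAt hν ((x / 2) ^ 2)).comp x (d1.pow 2)
  refine (d2.mul d3).congr_deriv ?_
  rw [besselJ_eq hx, besselJ_eq hx, Real.rpow_add h, Real.rpow_sub h, Real.rpow_one]
  simp only [Function.comp, Pi.pow_apply]
  field_simp
  ring

lemma besselJ_hasDerivAt' {ν x : ℝ} (hν : -1 < ν) (hx : 0 < x) :
    HasDerivAt (besselJ (ν + 1)) (besselJ ν x - (ν + 1) / x * besselJ (ν + 1) x) x := by
  refine (besselJ_hasDerivAt (ν := ν + 1) (by linarith) hx).congr_deriv ?_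
  rw [besselJ_rec hν hx]
  ring

noncomputable def Kf (μ t : ℝ) : ℂ := ((t ^ μ : ℝ) : ℂ) * ((t : ℂ) - 2 * Complex.I) ^ (μ : ℂ)

noncomputable def Gi (μ : ℝ) (j : ℕ) (x t : ℝ) : ℂ :=
  ((t : ℂ) - Complex.I) ^ j * Kf μ t * Complex.exp ((Complex.I - t) * x)

noncomputable def Gf (μ : ℝ) (j : ℕ) (x : ℝ) : ℂ := ∫ t in Ioi (0 : ℝ), Gi μ j x t

lemma dom_tendsto (s : ℝ) {δ : ℝ} (hδ : 0 < δ) :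
    Tendsto (fun t : ℝ => (t + 2) ^ s * Real.exp (-(δ * t))) atTop (𝓝 0) := by
  have h := (tendsto_rpow_mul_exp_neg_mul_atTop_nhds_zero s δ hδ).comp
    (tendsto_atTop_add_const_right atTop (2 : ℝ) tendsto_id)
  have h2 := h.mul_const (Real.exp (2 * δ))
  rw [zero_mul] at h2
  refine h2.congr fun t => ?_
  simp only [Function.comp, id]
  rw [mul_assoc, ← Real.exp_add]
  congr 2
  ring

lemma dom_integrable (s : ℝ) {δ : ℝ} (hδ : 0 < δ) :
    IntegrableOn (fun t : ℝ => (t + 2) ^ s * Real.exp (-(δ * t))) (Ioi 0) := by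
  refine integrable_of_isBigO_exp_neg (b := δ / 2) (by positivity) ?_ ?_
  · intro t ht
    have : (t + 2) ≠ 0 := by have : (0 : ℝ) ≤ t := ht; positivity
    refine ContinuousAt.continuousWithinAt ?_
    refine ContinuousAt.mul (ContinuousAt.rpow_const (by fun_prop) (Or.inl this)) (by fun_prop)
  · have h := (dom_tendsto s (δ := δ / 2) (by positivity)).isBigO_one ℝ
    have h2 := h.mul (Asymptotics.isBigO_refl (fun t : ℝ => Real.exp (-(δ / 2) * t)) atTop)
    refine (h2.congr_left fun t => ?_).congr_right fun t => by simp
    rw [mul_assoc, ← Real.exp_add]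
    congr 2
    ring

lemma norm_t_sub {t a : ℝ} (ht : 0 < t) (ha : 0 ≤ a) : ‖(t : ℂ) - a * Complex.I‖ ≤ t + a := by
  refine (norm_sub_le _ _).trans ?_
  simp [abs_of_pos ht, abs_of_nonneg ha]

lemma slit {t : ℝ} {a : ℝ} (ha : 0 < a) : (t : ℂ) - a * Complex.I ∈ Complex.slitPlane := by
  right
  simp [ha.ne']

lemma Kf_norm {μ t : ℝ} (hμ : 0 ≤ μ) (ht : 0 < t) : ‖Kf μ t‖ ≤ (t + 2) ^ (2 * μ) := by
  unfold Kf
  rw [norm_mul, Complex.norm_cpow_real, Complex.norm_real, Real.norm_eq_abs,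
    abs_of_nonneg (by positivity), two_mul μ, Real.rpow_add (by positivity)]
  have : ‖(t : ℂ) - 2 * Complex.I‖ ≤ t + 2 := by simpa using norm_t_sub ht (a := 2) (by norm_num)
  gcongr
  linarith

lemma norm_cexp' (x t : ℝ) : ‖Complex.exp ((Complex.I - t) * x)‖ = Real.exp (-(x * t)) := by
  rw [Complex.norm_exp]
  congr 1
  simp
  ring

lemma Gi_norm {μ x t : ℝ} (hμ : 0 ≤ μ) (j : ℕ) (ht : 0 < t) :
    ‖Gi μ j x t‖ ≤ (t + 2) ^ (j + 2 * μ) * Real.exp (-(x * t)) := by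
  unfold Gi
  rw [norm_mul, norm_mul, norm_pow, norm_cexp', Real.rpow_add (by positivity), Real.rpow_natCast]
  have h1 : ‖(t : ℂ) - Complex.I‖ ≤ t + 2 := by
    have := norm_t_sub ht (a := 1) (by norm_num)
    simp at this
    linarith
  have := Kf_norm hμ ht
  gcongr

lemma Kf_meas (μ : ℝ) : Measurable (Kf μ) := by
  unfold Kf
  fun_prop

lemma Gi_meas (μ : ℝ) (j : ℕ) (x : ℝ) : Measurable (Gi μ j x) := by
  have := Kf_meas μ
  unfold Gi
  fun_prop

lemma Gi_integrable {μ x : ℝ} (hμ : 0 ≤ μ) (j : ℕ) (hx : 0 < x) :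
    IntegrableOn (Gi μ j x) (Ioi 0) := by
  refine Integrable.mono' (dom_integrable (j + 2 * μ) hx) (Gi_meas μ j x).aestronglyMeasurable ?_
  filter_upwards [ae_restrict_mem measurableSet_Ioi] with t ht
  exact Gi_norm hμ j ht

lemma Gf_hasDerivAt {μ x : ℝ} (hμ : 0 ≤ μ) (j : ℕ) (hx : 0 < x) :
    HasDerivAt (Gf μ j) (- Gf μ (j + 1) x) x := by
  have := (hasDerivAt_integral_of_dominated_loc_of_deriv_le (μ := volume.restrict (Ioi (0 : ℝ)))
    (F := Gi μ j) (F' := fun x t => - Gi μ (j + 1) x t) (x₀ := x) (s := Ioi (x / 2))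
    (bound := fun t => (t + 2) ^ ((j + 1 : ℕ) + 2 * μ) * Real.exp (-(x / 2 * t)))
    (Ioi_mem_nhds (by linarith)) (Eventually.of_forall fun y => (Gi_meas μ j y).aestronglyMeasurable)
    (Gi_integrable hμ j hx) (Gi_meas μ (j + 1) x).neg.aestronglyMeasurable ?_
    (dom_integrable _ (by positivity)) ?_).2
  · rw [integral_neg] at this
    exact this
  · filter_upwards [ae_restrict_mem measurableSet_Ioi] with t ht y hy
    have ht' : 0 < t := ht
    have hy' : x / 2 < y := hy
    rw [norm_neg]
    refine (Gi_norm hμ (j + 1) ht).trans ?_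
    gcongr
  · refine Eventually.of_forall fun t y _ => ?_
    unfold Gi
    have d : HasDerivAt (fun y : ℝ => (Complex.I - t) * (y : ℂ)) ((Complex.I - t) * 1) y :=
      (HasDerivAt.ofReal_comp (hasDerivAt_id y)).const_mul _
    refine (d.cexp.const_mul _).congr_deriv ?_
    rw [pow_succ]
    ring

lemma Gf_rel {μ x : ℝ} (hμ : 0 ≤ μ) (hx : 0 < x) :
    (x : ℂ) * (Gf μ 2 x + Gf μ 0 x) = 2 * (μ + 1) * Gf μ 1 x := by
  set M : ℝ → ℂ := fun t => Kf (μ + 1) t * Complex.exp ((Complex.I - t) * x) with hM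
  have hd : ∀ t ∈ Ioi (0 : ℝ), HasDerivAt M
      (2 * (μ + 1) * Gi μ 1 x t - x * (Gi μ 2 x t + Gi μ 0 x t)) t := by
    intro t ht
    have ht' : 0 < t := ht
    have d1 : HasDerivAt (fun t : ℝ => ((t ^ (μ + 1) : ℝ) : ℂ)) (((μ + 1) * t ^ μ : ℝ) : ℂ) t := by
      have := (Real.hasDerivAt_rpow_const (x := t) (p := μ + 1) (Or.inl ht'.ne')).ofReal_comp
      simpa using this
    have d0 : HasDerivAt (fun t : ℝ => (t : ℂ)) 1 t := HasDerivAt.ofReal_comp (hasDerivAt_id t)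
    have hs : (t : ℂ) - 2 * Complex.I ∈ Complex.slitPlane := by simpa using slit (t := t) (a := 2) (by norm_num)
    have d2 : HasDerivAt (fun t : ℝ => ((t : ℂ) - 2 * Complex.I) ^ ((μ + 1 : ℝ) : ℂ))
        (((μ + 1 : ℝ) : ℂ) * ((t : ℂ) - 2 * Complex.I) ^ (((μ + 1 : ℝ) : ℂ) - 1) * 1) t := by
      have a := ((hasDerivAt_id ((t : ℂ))).sub_const (2 * Complex.I)).cpow_const (c := ((μ + 1 : ℝ) : ℂ)) hs
      exact a.comp_ofReal
    have d3 : HasDerivAt (fun t : ℝ => (Complex.I - t) * (x : ℂ)) ((-1) * (x : ℂ)) t :=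
      (d0.const_sub Complex.I).mul_const _
    refine ((d1.mul d2).mul d3.cexp).congr_deriv ?_
    unfold Gi Kf
    have hne := Complex.slitPlane_ne_zero hs
    have e1 : ((t : ℂ) - 2 * Complex.I) ^ ((μ + 1 : ℝ) : ℂ)
        = ((t : ℂ) - 2 * Complex.I) ^ (μ : ℂ) * ((t : ℂ) - 2 * Complex.I) := by
      push_cast
      rw [Complex.cpow_add _ _ hne, Complex.cpow_one]
    have e2 : ((t : ℂ) - 2 * Complex.I) ^ (((μ + 1 : ℝ) : ℂ) - 1) = ((t : ℂ) - 2 * Complex.I) ^ (μ : ℂ) := by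
      push_cast
      rw [add_sub_cancel_right]
    simp only [Pi.mul_apply]
    rw [e1, e2, Real.rpow_add ht', Real.rpow_one]
    push_cast
    set A := ((t : ℂ) - 2 * Complex.I) ^ (μ : ℂ)
    set B := ((t ^ μ : ℝ) : ℂ)
    set E := Complex.exp ((Complex.I - t) * x)
    have hI := Complex.I_sq
    linear_combination (x * A * B * E) * hI
  have h2 := Gi_integrable hμ 2 hx
  have h1 := Gi_integrable hμ 1 hx
  have h0 := Gi_integrable hμ 0 hx
  have hc : ContinuousWithinAt M (Ici 0) 0 := by
    refine ContinuousAt.continuousWithinAt ?_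
    have hs : ((0 : ℝ) : ℂ) - 2 * Complex.I ∈ Complex.slitPlane := by simpa using slit (t := 0) (a := 2) (by norm_num)
    refine ContinuousAt.mul (ContinuousAt.mul ?_ ?_) (by fun_prop)
    · exact Complex.continuous_ofReal.continuousAt.comp
        (Real.continuousAt_rpow_const _ _ (Or.inr (by linarith)))
    · exact ContinuousAt.cpow (by fun_prop) (by fun_prop) hs
  have hlim : Tendsto M atTop (𝓝 0) := by
    refine squeeze_zero_norm' ?_ (dom_tendsto (2 * (μ + 1)) hx)
    filter_upwards [eventually_gt_atTop 0] with t ht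
    rw [hM, norm_mul, norm_cexp']
    have := Kf_norm (μ := μ + 1) (by linarith) ht
    gcongr
  have hint := integral_Ioi_of_hasDerivAt_of_tendsto hc hd
    ((h1.const_mul _).sub ((h2.add h0).const_mul _)) hlim
  have hM0 : M 0 = 0 := by
    have : μ + 1 ≠ 0 := by linarith
    simp [hM, Kf, Real.zero_rpow this]
  have hadd : Integrable (fun t => Gi μ 2 x t + Gi μ 0 x t) (volume.restrict (Ioi 0)) := h2.add h0
  rw [hM0, integral_sub (h1.const_mul _) (hadd.const_mul _), integral_const_mul, integral_const_mul,
    integral_add h2 h0] at hint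
  unfold Gf
  linear_combination -hint

lemma gamma_int {s : ℝ} (hs : 0 < s) (c : ℂ) :
    ∫ v in Ioi (0 : ℝ), (((Real.exp (-v) * v ^ (s - 1) : ℝ)) : ℂ) * c = (Real.Gamma s : ℂ) * c := by
  rw [Real.Gamma_eq_integral hs, integral_mul_const, integral_complex_ofReal]

lemma Gf_scale {μ x : ℝ} (j : ℕ) (hx : 0 < x) :
    Gf μ j x = ((x⁻¹ : ℝ) : ℂ) * ∫ v in Ioi (0 : ℝ), Gi μ j x (x⁻¹ * v) := by
  have := integral_comp_mul_left_Ioi (Gi μ j x) 0 (b := x⁻¹) (by positivity)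
  rw [this]
  have : (x : ℂ) ≠ 0 := by exact_mod_cast hx.ne'
  simp [Gf, this]

lemma Gf_atTop {μ : ℝ} (hμ : 0 ≤ μ) (j : ℕ) :
    Tendsto (fun x : ℝ => ((x ^ (μ + 1) : ℝ) : ℂ) * Complex.exp (-(Complex.I * x)) * Gf μ j x) atTop
      (𝓝 ((Real.Gamma (μ + 1) : ℂ) * ((-Complex.I) ^ j * (-(2 * Complex.I)) ^ (μ : ℂ)))) := by
  rw [← gamma_int (by linarith)]
  have key : (fun x : ℝ => ((x ^ (μ + 1) : ℝ) : ℂ) * Complex.exp (-(Complex.I * x)) * Gf μ j x)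
      =ᶠ[atTop] fun x : ℝ => ∫ v in Ioi (0 : ℝ), ((Real.exp (-v) * v ^ (μ + 1 - 1) : ℝ) : ℂ)
        * ((((x⁻¹ * v : ℝ) : ℂ) - Complex.I) ^ j * (((x⁻¹ * v : ℝ) : ℂ) - 2 * Complex.I) ^ (μ : ℂ)) := by
    filter_upwards [eventually_gt_atTop 0] with x hx
    rw [Gf_scale j hx, ← mul_assoc, ← integral_const_mul]
    refine setIntegral_congr_fun measurableSet_Ioi fun v hv => ?_
    have hv' : 0 < v := hv
    have hx' : (x : ℂ) ≠ 0 := by exact_mod_cast hx.ne'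
    simp only [Gi, Kf]
    rw [Real.mul_rpow (by positivity) hv'.le, Real.inv_rpow hx.le, Real.rpow_add hx, Real.rpow_one, add_sub_cancel_right]
    have hxm : ((x ^ μ : ℝ) : ℂ) ≠ 0 := by exact_mod_cast (Real.rpow_pos_of_pos hx _).ne'
    have e : Complex.exp ((Complex.I - ((x⁻¹ * v : ℝ) : ℂ)) * x) = Complex.exp (Complex.I * x) * ((Real.exp (-v) : ℝ) : ℂ) := by
      push_cast
      rw [← Complex.exp_add]
      congr 1
      field_simp
      ring
    rw [e, Complex.exp_neg]
    have := Complex.exp_ne_zero (Complex.I * x)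
    push_cast
    field_simp
  refine Tendsto.congr' key.symm ?_
  refine tendsto_integral_filter_of_dominated_convergence
    (fun v => (v + 2) ^ (j + 2 * μ) * Real.exp (-(1 * v))) ?_ ?_ (dom_integrable _ one_pos) ?_
  · refine Eventually.of_forall fun x => Measurable.aestronglyMeasurable ?_
    fun_prop
  · filter_upwards [eventually_ge_atTop 1] with x hx
    filter_upwards [ae_restrict_mem measurableSet_Ioi] with v hv
    have hv' : 0 < v := hv
    have hx0 : 0 < x := by linarith
    have hle : x⁻¹ * v ≤ v := by
      have : x⁻¹ ≤ 1 := inv_le_one_of_one_le₀ hx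
      nlinarith
    have hp : 0 < x⁻¹ * v := by positivity
    rw [norm_mul, norm_mul, norm_pow, Complex.norm_cpow_real, Complex.norm_real, Real.norm_eq_abs,
      abs_of_nonneg (by positivity), add_sub_cancel_right, Real.rpow_add (by positivity), two_mul μ, Real.rpow_add (by positivity), Real.rpow_natCast, one_mul]
    have h1 : ‖((x⁻¹ * v : ℝ) : ℂ) - Complex.I‖ ≤ v + 2 := by
      have := norm_t_sub hp (a := 1) (by norm_num)
      rw [Complex.ofReal_one, one_mul] at this
      linarith
    have h2 : ‖((x⁻¹ * v : ℝ) : ℂ) - 2 * Complex.I‖ ≤ v + 2 := by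
      have := norm_t_sub hp (a := 2) (by norm_num)
      rw [Complex.ofReal_ofNat] at this
      linarith
    calc Real.exp (-v) * v ^ μ * (‖((x⁻¹ * v : ℝ) : ℂ) - Complex.I‖ ^ j * ‖((x⁻¹ * v : ℝ) : ℂ) - 2 * Complex.I‖ ^ μ)
        ≤ Real.exp (-v) * (v + 2) ^ μ * ((v + 2) ^ j * (v + 2) ^ μ) := by gcongr; linarith
      _ = _ := by ring
  · refine Eventually.of_forall fun v => ?_
    refine Tendsto.const_mul _ ?_
    have ht : Tendsto (fun x : ℝ => ((x⁻¹ * v : ℝ) : ℂ)) atTop (𝓝 0) := by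
      have := (Complex.continuous_ofReal.tendsto _).comp (tendsto_inv_atTop_zero.mul_const v)
      simpa [Function.comp_def] using this
    have hs : -(2 * Complex.I) ∈ Complex.slitPlane := by simpa using slit (t := 0) (a := 2) (by norm_num)
    refine Tendsto.mul (Tendsto.pow ?_ _) ?_
    · simpa using ht.sub_const Complex.I
    · refine Tendsto.cpow ?_ tendsto_const_nhds hs
      simpa using ht.sub_const (2 * Complex.I)

lemma real_mul_cpow {a μ : ℝ} {z : ℂ} (ha : 0 < a) (hz : z ≠ 0) :
    ((a : ℂ) * z) ^ (μ : ℂ) = ((a ^ μ : ℝ) : ℂ) * z ^ (μ : ℂ) := by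
  have ha' : (a : ℂ) ≠ 0 := by exact_mod_cast ha.ne'
  rw [Complex.cpow_def_of_ne_zero (mul_ne_zero ha' hz), Complex.cpow_def_of_ne_zero hz,
    Complex.log_ofReal_mul ha hz, add_mul, Complex.exp_add, Real.rpow_def_of_pos ha]
  push_cast
  rfl

lemma Gf_zero {μ : ℝ} (hμ : 0 ≤ μ) (j : ℕ) :
    Tendsto (fun x : ℝ => ((x ^ (2 * μ + 1 + j) : ℝ) : ℂ) * Gf μ j x) (𝓝[>] 0)
      (𝓝 (Real.Gamma (2 * μ + 1 + j) : ℂ)) := by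
  have hj : (0 : ℝ) ≤ j := j.cast_nonneg
  rw [← mul_one (Real.Gamma (2 * μ + 1 + j) : ℂ), ← gamma_int (by linarith)]
  have key : (fun x : ℝ => ((x ^ (2 * μ + 1 + j) : ℝ) : ℂ) * Gf μ j x)
      =ᶠ[𝓝[>] 0] fun x : ℝ => ∫ v in Ioi (0 : ℝ), ((Real.exp (-v) * v ^ μ : ℝ) : ℂ)
        * (((v : ℂ) - (x : ℂ) * Complex.I) ^ j * ((v : ℂ) - ((2 * x : ℝ) : ℂ) * Complex.I) ^ (μ : ℂ)) * Complex.exp (Complex.I * x) := by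
    filter_upwards [self_mem_nhdsWithin] with x hx
    have hx : 0 < x := hx
    rw [Gf_scale j hx, ← mul_assoc, ← integral_const_mul]
    refine setIntegral_congr_fun measurableSet_Ioi fun v hv => ?_
    have hv' : 0 < v := hv
    have hx' : (x : ℂ) ≠ 0 := by exact_mod_cast hx.ne'
    simp only [Gi, Kf]
    have c1 : ((x⁻¹ * v : ℝ) : ℂ) - Complex.I = (x : ℂ)⁻¹ * ((v : ℂ) - (x : ℂ) * Complex.I) := by
      push_cast
      field_simp
    have c2 : (((x⁻¹ * v : ℝ) : ℂ) - 2 * Complex.I) ^ (μ : ℂ)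
        = (((x ^ μ)⁻¹ : ℝ) : ℂ) * ((v : ℂ) - ((2 * x : ℝ) : ℂ) * Complex.I) ^ (μ : ℂ) := by
      have : ((x⁻¹ * v : ℝ) : ℂ) - 2 * Complex.I = ((x⁻¹ : ℝ) : ℂ) * ((v : ℂ) - ((2 * x : ℝ) : ℂ) * Complex.I) := by
        push_cast
        field_simp
      rw [this, real_mul_cpow (by positivity) (Complex.slitPlane_ne_zero (slit (by positivity))), Real.inv_rpow hx.le]
    rw [c1, c2, mul_pow, Real.mul_rpow (by positivity) hv'.le, Real.inv_rpow hx.le, Real.rpow_add hx, Real.rpow_add hx, Real.rpow_one,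
      two_mul, Real.rpow_add hx, Real.rpow_natCast]
    have hxm : ((x ^ μ : ℝ) : ℂ) ≠ 0 := by exact_mod_cast (Real.rpow_pos_of_pos hx _).ne'
    have e : Complex.exp ((Complex.I - ((x⁻¹ * v : ℝ) : ℂ)) * x) = Complex.exp (Complex.I * x) * ((Real.exp (-v) : ℝ) : ℂ) := by
      push_cast
      rw [← Complex.exp_add]
      congr 1
      field_simp
      ring
    rw [e, inv_pow]
    push_cast
    field_simp
  refine Tendsto.congr' key.symm ?_
  refine tendsto_integral_filter_of_dominated_convergence
    (fun v => (v + 2) ^ (j + 2 * μ) * Real.exp (-(1 * v))) ?_ ?_ (dom_integrable _ one_pos) ?_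
  · refine Eventually.of_forall fun x => Measurable.aestronglyMeasurable ?_
    fun_prop
  · filter_upwards [Ioo_mem_nhdsGT (show (0 : ℝ) < 1 by norm_num)] with x hx
    filter_upwards [ae_restrict_mem measurableSet_Ioi] with v hv
    have hv' : 0 < v := hv
    have hx0 := hx.1
    have hx1 := hx.2
    have en : ‖Complex.exp (Complex.I * x)‖ = 1 := by rw [mul_comm]; exact Complex.norm_exp_ofReal_mul_I x
    rw [norm_mul, en, mul_one, norm_mul, norm_mul, norm_pow, Complex.norm_cpow_real, Complex.norm_real, Real.norm_eq_abs,
      abs_of_nonneg (by positivity), Real.rpow_add (by positivity), two_mul μ, Real.rpow_add (by positivity), Real.rpow_natCast, one_mul]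
    have h1 : ‖(v : ℂ) - (x : ℂ) * Complex.I‖ ≤ v + 2 := by
      have := norm_t_sub hv' hx0.le
      linarith
    have h2 : ‖(v : ℂ) - ((2 * x : ℝ) : ℂ) * Complex.I‖ ≤ v + 2 := by
      have := norm_t_sub hv' (a := 2 * x) (by linarith)
      linarith
    calc Real.exp (-v) * v ^ μ * (‖(v : ℂ) - (x : ℂ) * Complex.I‖ ^ j * ‖(v : ℂ) - ((2 * x : ℝ) : ℂ) * Complex.I‖ ^ μ)
        ≤ Real.exp (-v) * (v + 2) ^ μ * ((v + 2) ^ j * (v + 2) ^ μ) := by gcongr; linarith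
      _ = _ := by ring
  · filter_upwards [ae_restrict_mem measurableSet_Ioi] with v hv
    have hv' : 0 < v := hv
    have hs : (v : ℂ) ∈ Complex.slitPlane := Or.inl (by simpa using hv')
    have e : ((Real.exp (-v) * v ^ (2 * μ + 1 + j - 1) : ℝ) : ℂ) * 1
        = ((Real.exp (-v) * v ^ μ : ℝ) : ℂ) * ((v : ℂ) ^ j * (v : ℂ) ^ (μ : ℂ)) * 1 := by
      rw [← Complex.ofReal_cpow hv'.le, show 2 * μ + 1 + j - 1 = μ + (j + μ) by ring, Real.rpow_add hv', Real.rpow_add hv', Real.rpow_natCast]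
      push_cast
      ring
    rw [e]
    have ht : Tendsto (fun x : ℝ => (x : ℂ)) (𝓝[>] 0) (𝓝 0) := by
      have := (Complex.continuous_ofReal.tendsto 0).mono_left (nhdsWithin_le_nhds (s := Ioi (0 : ℝ)))
      simpa using this
    refine Tendsto.mul (Tendsto.const_mul _ (Tendsto.mul (Tendsto.pow ?_ _) ?_)) ?_
    · simpa using (ht.mul_const Complex.I).const_sub (v : ℂ)
    · refine Tendsto.cpow ?_ tendsto_const_nhds hs
      have := ((ht.const_mul 2).mul_const Complex.I).const_sub (v : ℂ)
      simpa using this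
    · have := (Complex.continuous_exp.tendsto _).comp (ht.const_mul Complex.I)
      simpa [Function.comp_def] using this
lemma wronsk {ν x : ℝ} (hν : 1 ≤ ν) (hx : 0 < x) :
    ((x ^ (ν + 1) : ℝ) : ℂ) * ((besselJ ν x : ℂ) * Gf (ν - 1 / 2) 1 x - (besselJ (ν + 1) x : ℂ) * Gf (ν - 1 / 2) 0 x)
      = (((1 / 2) ^ ν * bg ν 0 * Real.Gamma (2 * ν + 1) : ℝ) : ℂ) := by
  have hν1 : -1 < ν := by linarith
  have hμ : 0 ≤ ν - 1 / 2 := by linarith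
  set C : ℝ → ℂ := fun x => ((x ^ (ν + 1) : ℝ) : ℂ) * ((besselJ ν x : ℂ) * Gf (ν - 1 / 2) 1 x - (besselJ (ν + 1) x : ℂ) * Gf (ν - 1 / 2) 0 x) with hC
  have hd : ∀ y ∈ Ioi (0 : ℝ), HasDerivAt C 0 y := by
    intro y hy
    have hy : 0 < y := hy
    have d0 := (Real.hasDerivAt_rpow_const (x := y) (p := ν + 1) (Or.inl hy.ne')).ofReal_comp
    have d1 := (besselJ_hasDerivAt hν1 hy).ofReal_comp
    have d2 := (besselJ_hasDerivAt' hν1 hy).ofReal_comp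
    have d3 := Gf_hasDerivAt hμ 0 hy
    have d4 := Gf_hasDerivAt hμ 1 hy
    have hr := Gf_rel hμ hy
    refine (d0.mul ((d1.mul d4).sub (d2.mul d3))).congr_deriv ?_
    have hy' : (y : ℂ) ≠ 0 := by exact_mod_cast hy.ne'
    rw [add_sub_cancel_right, Real.rpow_add hy, Real.rpow_one]
    push_cast at hr ⊢
    simp only [Pi.mul_apply, Pi.sub_apply]
    norm_num at hr ⊢
    generalize Gf (ν - 1 / 2) 0 y = g0 at *
    generalize Gf (ν - 1 / 2) 1 y = g1 at *
    generalize Gf (ν - 1 / 2) 2 y = g2 at *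
    field_simp
    linear_combination (-(y ^ ν : ℝ) * (besselJ ν y : ℂ)) * hr
  have hconst : ∀ y ∈ Ioi (0 : ℝ), C y = C x := fun y hy =>
    isOpen_Ioi.is_const_of_deriv_eq_zero isPreconnected_Ioi
      (fun z hz => (hd z hz).differentiableAt.differentiableWithinAt)
      (fun z hz => (hd z hz).deriv) hy hx
  have hlim1 : Tendsto C (𝓝[>] 0) (𝓝 (C x)) := by
    refine tendsto_const_nhds.congr' ?_
    filter_upwards [self_mem_nhdsWithin] with y hy
    exact (hconst y hy).symm
  refine tendsto_nhds_unique hlim1 ?_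
  have t1 := Gf_zero hμ 1
  have t0 := Gf_zero hμ 0
  have tx : Tendsto (fun y : ℝ => y) (𝓝[>] 0) (𝓝 0) := nhdsWithin_le_nhds
  have tb : ∀ κ : ℝ, -1 < κ → Tendsto (fun y : ℝ => bg κ ((y / 2) ^ 2)) (𝓝[>] 0) (𝓝 (bg κ 0)) := by
    intro κ hκ
    have := (bg_hasDerivAt hκ 0).continuousAt.tendsto
    refine this.comp ?_
    simpa using (tx.div_const 2).pow 2
  have ta := (Complex.continuous_ofReal.tendsto _).comp ((tb ν hν1).const_mul ((1 / 2) ^ ν))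
  have tc := (Complex.continuous_ofReal.tendsto _).comp (((tb (ν + 1) (by linarith)).const_mul ((1 / 2) ^ (ν + 1))).mul (tx.pow 2))
  have tt := (ta.mul t1).sub (tc.mul t0)
  have e1 : 2 * (ν - 1 / 2) + 1 + ((1 : ℕ) : ℝ) = 2 * ν + 1 := by push_cast; ring
  have e0 : 2 * (ν - 1 / 2) + 1 + ((0 : ℕ) : ℝ) = 2 * ν := by push_cast; ring
  rw [e1, e0] at tt
  convert tt.congr' ?_ using 2
  · push_cast
    ring
  · filter_upwards [self_mem_nhdsWithin] with y hy
    have hy : 0 < y := hy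
    simp only [Function.comp]
    rw [besselJ_eq hy, besselJ_eq hy, div_eq_mul_one_div y 2, Real.mul_rpow hy.le (by norm_num), Real.mul_rpow hy.le (by norm_num),
      Real.rpow_add hy, Real.rpow_add hy, two_mul, Real.rpow_add hy, Real.rpow_one]
    push_cast
    ring

lemma limit_large {ν : ℝ} (hν : 1 ≤ ν) :
    Tendsto (fun x => x * besselJ ν x ^ 2 + x * besselJ (ν + 1) x ^ 2) atTop (𝓝 (2 / π)) := by
  have hμ : 0 ≤ ν - 1 / 2 := by linarith
  set W : ℝ := (1 / 2) ^ ν * bg ν 0 * Real.Gamma (2 * ν + 1) with hW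
  set c : ℂ := (Real.Gamma (ν - 1 / 2 + 1) : ℂ) * (-(2 * Complex.I)) ^ ((ν - 1 / 2 : ℝ) : ℂ) with hc
  set q : ℝ → ℂ := fun x => ((x ^ (ν - 1 / 2 + 1) : ℝ) : ℂ) * Complex.exp (-(Complex.I * x)) * Gf (ν - 1 / 2) 1 x with hq
  set p : ℝ → ℂ := fun x => ((x ^ (ν - 1 / 2 + 1) : ℝ) : ℂ) * Complex.exp (-(Complex.I * x)) * Gf (ν - 1 / 2) 0 x with hp
  have tq : Tendsto q atTop (𝓝 (-Complex.I * c)) := by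
    have := Gf_atTop hμ 1
    convert this using 2
    rw [hc]; ring
  have tp : Tendsto p atTop (𝓝 c) := by
    have := Gf_atTop hμ 0
    convert this using 2
    rw [hc]; ring
  have hg1 : 0 < Real.Gamma (ν - 1 / 2 + 1) := Real.Gamma_pos_of_pos (by linarith)
  have hg2 : 0 < Real.Gamma (2 * ν + 1) := Real.Gamma_pos_of_pos (by linarith)
  have hg3 : 0 < Real.Gamma (ν + 1) := Real.Gamma_pos_of_pos (by linarith)
  have hb0 : bg ν 0 = 1 / Real.Gamma (ν + 1) := by
    unfold bg
    rw [tsum_eq_single 0 (by intro b hb; simp [hb])]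
    simp [bc]
  have hcn : ‖c‖ = Real.Gamma (ν - 1 / 2 + 1) * 2 ^ (ν - 1 / 2) := by
    rw [hc, norm_mul, Complex.norm_cpow_real, Complex.norm_real, Real.norm_of_nonneg hg1.le]
    simp
  have hcpos : 0 < ‖c‖ := by rw [hcn]; positivity
  have hWpos : 0 < W := by rw [hW, hb0]; positivity
  set η : ℝ → ℝ := fun x => ‖q x - -Complex.I * c‖ + ‖p x - c‖ with hη
  have tη : Tendsto η atTop (𝓝 0) := by
    have := (tendsto_iff_norm_sub_tendsto_zero.1 tq).add (tendsto_iff_norm_sub_tendsto_zero.1 tp)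
    rw [add_zero] at this
    exact this
  set r : ℝ → ℝ := fun x => √(x * besselJ ν x ^ 2 + x * besselJ (ν + 1) x ^ 2) with hr
  have main : ∀ x : ℝ, 0 < x → |W - ‖c‖ * r x| ≤ η x * r x := by
    intro x hx
    set a : ℝ := √x * besselJ ν x with ha
    set b : ℝ := √x * besselJ (ν + 1) x with hb
    have hsx : √x ^ 2 = x := Real.sq_sqrt hx.le
    have hrr : r x = √(a ^ 2 + b ^ 2) := by
      rw [hr, ha, hb, mul_pow, mul_pow, hsx]
    have har : |a| ≤ r x := by rw [hrr]; exact Real.abs_le_sqrt (by nlinarith [sq_nonneg b])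
    have hbr : |b| ≤ r x := by rw [hrr]; exact Real.abs_le_sqrt (by nlinarith [sq_nonneg a])
    have hn : ‖(-Complex.I * a - b : ℂ)‖ = r x := by
      rw [hrr, Complex.norm_def, Complex.normSq_apply]
      congr 1
      simp
      ring
    have hw := wronsk hν hx
    have hw' : (a : ℂ) * q x - b * p x = Complex.exp (-(Complex.I * x)) * W := by
      rw [hW, ← hw, hq, hp, ha, hb, Real.sqrt_eq_rpow, show ν + 1 = 1 / 2 + (ν - 1 / 2 + 1) by ring, Real.rpow_add hx (1 / 2) (ν - 1 / 2 + 1)]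
      push_cast
      ring
    have hnw : ‖(a : ℂ) * q x - b * p x‖ = W := by
      rw [hw', norm_mul, Complex.norm_real, Real.norm_of_nonneg hWpos.le]
      have : ‖Complex.exp (-(Complex.I * x))‖ = 1 := by
        rw [Complex.norm_exp]; simp
      rw [this, one_mul]
    have hnc : ‖c * (-Complex.I * a - b : ℂ)‖ = ‖c‖ * r x := by rw [norm_mul, hn]
    rw [← hnc]
    conv_lhs => rw [← hnw]
    refine (abs_norm_sub_norm_le _ _).trans ?_
    have : (a : ℂ) * q x - b * p x - c * (-Complex.I * a - b) = a * (q x - -Complex.I * c) - b * (p x - c) := by ring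
    rw [this]
    refine (norm_sub_le _ _).trans ?_
    rw [norm_mul, norm_mul, Complex.norm_real, Complex.norm_real, Real.norm_eq_abs, Real.norm_eq_abs, hη]
    have h1 := norm_nonneg (q x - -Complex.I * c)
    have h2 := norm_nonneg (p x - c)
    simp only
    nlinarith
  have tr : Tendsto r atTop (𝓝 (W / ‖c‖)) := by
    have l1 : Tendsto (fun x => W / (‖c‖ + η x)) atTop (𝓝 (W / ‖c‖)) := by
      have := (tη.const_add ‖c‖)
      rw [add_zero] at this
      exact tendsto_const_nhds.div this hcpos.ne'
    have l2 : Tendsto (fun x => W / (‖c‖ - η x)) atTop (𝓝 (W / ‖c‖)) := by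
      have := (tη.const_sub ‖c‖)
      rw [sub_zero] at this
      exact tendsto_const_nhds.div this hcpos.ne'
    refine tendsto_of_tendsto_of_tendsto_of_le_of_le' l1 l2 ?_ ?_
    · filter_upwards [eventually_gt_atTop 0] with x hx
      have hη0 : 0 ≤ η x := by rw [hη]; positivity
      rw [div_le_iff₀ (by positivity)]
      have := (abs_le.1 (main x hx)).2
      linarith
    · filter_upwards [eventually_gt_atTop 0, tη.eventually_lt_const hcpos] with x hx hlt
      rw [le_div_iff₀ (by linarith)]
      have := (abs_le.1 (main x hx)).1
      linarith
  have hval : (W / ‖c‖) ^ 2 = 2 / π := by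
    have hdup := Real.Gamma_mul_Gamma_add_half (ν + 1 / 2)
    rw [show ν + 1 / 2 + 1 / 2 = ν + 1 by ring, show 2 * (ν + 1 / 2) = 2 * ν + 1 by ring,
      show 1 - (2 * ν + 1) = - ν + - ν by ring, Real.rpow_add two_pos] at hdup
    have hq : W / ‖c‖ = √2 / √π := by
      rw [show ν - 1 / 2 + 1 = ν + 1 / 2 by ring] at hg1 hcn
      rw [hW, hcn, hb0, one_div (2 : ℝ), Real.inv_rpow (by norm_num), ← one_div (2 : ℝ), Real.rpow_sub two_pos, ← Real.sqrt_eq_rpow]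
      rw [Real.rpow_neg two_pos.le] at hdup
      have : (0 : ℝ) < 2 ^ ν := by positivity
      have : 0 < √π := Real.sqrt_pos.2 pi_pos
      field_simp at hdup ⊢
      linear_combination -hdup
    rw [hq, div_pow, Real.sq_sqrt (by norm_num), Real.sq_sqrt pi_pos.le]
  rw [← hval]
  refine (tr.pow 2).congr' ?_
  filter_upwards [eventually_gt_atTop 0] with x hx
  rw [hr]
  exact Real.sq_sqrt (by positivity)

lemma limit_down {ν : ℝ} (hν : -1 < ν)
    (h : Tendsto (fun x => x * besselJ (ν + 1) x ^ 2 + x * besselJ (ν + 1 + 1) x ^ 2) atTop (𝓝 (2 / π))) :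
    Tendsto (fun x => x * besselJ ν x ^ 2 + x * besselJ (ν + 1) x ^ 2) atTop (𝓝 (2 / π)) := by
  have hdiff : Tendsto (fun x => (x * besselJ ν x ^ 2 + x * besselJ (ν + 1) x ^ 2)
      - (x * besselJ (ν + 1) x ^ 2 + x * besselJ (ν + 1 + 1) x ^ 2)) atTop (𝓝 0) := by
    set k := |2 * (ν + 1)| with hk
    have hb : Tendsto (fun x : ℝ => (k * x⁻¹) * (k * x⁻¹ + 2) * (x * besselJ (ν + 1) x ^ 2 + x * besselJ (ν + 1 + 1) x ^ 2)) atTop (𝓝 0) := by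
      have t := tendsto_inv_atTop_zero (𝕜 := ℝ) |>.const_mul k
      have := (t.mul (t.add_const 2)).mul h
      simpa using this
    refine squeeze_zero_norm' ?_ hb
    filter_upwards [eventually_gt_atTop 0] with x hx
    have hrec := besselJ_rec hν hx
    set A := besselJ (ν + 1) x
    set B := besselJ (ν + 1 + 1) x
    have hJ : besselJ ν x = 2 * (ν + 1) * x⁻¹ * A - B := by rw [hrec]; ring
    set m := 2 * (ν + 1) * x⁻¹ with hm
    have hkm : k * x⁻¹ = |m| := by rw [hm, abs_mul, abs_of_pos (inv_pos.2 hx)]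
    rw [hkm, hJ, Real.norm_eq_abs]
    have e : x * (m * A - B) ^ 2 + x * A ^ 2 - (x * A ^ 2 + x * B ^ 2) = x * (m * (m * A ^ 2 - 2 * (A * B))) := by ring
    have hAB : |A * B| ≤ (A ^ 2 + B ^ 2) := by
      rw [abs_le]; constructor <;> nlinarith [sq_nonneg (A + B), sq_nonneg (A - B), sq_nonneg A, sq_nonneg B]
    have h1 : |m * A ^ 2 - 2 * (A * B)| ≤ (|m| + 2) * (A ^ 2 + B ^ 2) := by
      refine (abs_sub _ _).trans ?_
      rw [abs_mul m, abs_mul 2, abs_of_nonneg (sq_nonneg A), abs_two]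
      nlinarith [abs_nonneg m, sq_nonneg B, mul_nonneg (abs_nonneg m) (sq_nonneg B)]
    rw [e, abs_mul, abs_mul, abs_of_pos hx]
    calc x * (|m| * |m * A ^ 2 - 2 * (A * B)|) ≤ x * (|m| * ((|m| + 2) * (A ^ 2 + B ^ 2))) := by gcongr
      _ = _ := by ring
  have := hdiff.add h
  simpa using this

lemma limit_all {ν : ℝ} (hν : -1 < ν) :
    Tendsto (fun x => x * besselJ ν x ^ 2 + x * besselJ (ν + 1) x ^ 2) atTop (𝓝 (2 / π)) :=
  limit_down hν (limit_down (by linarith) (limit_large (by linarith)))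

/-- For `ν > -1` and `ξ > 0`,
`ξ J_ν(ξ)² + ξ J_{ν+1}(ξ)² − (2ν+1) J_ν(ξ) J_{ν+1}(ξ)
  = 2/π − (2ν+1) ∫_ξ^∞ x⁻¹ J_ν(x) J_{ν+1}(x) dx`. -/
theorem stmt11 (ν : ℝ) (hν : -1 < ν) (ξ : ℝ) (hξ : 0 < ξ) :
    ξ * besselJ ν ξ ^ 2 + ξ * besselJ (ν + 1) ξ ^ 2
        - (2 * ν + 1) * besselJ ν ξ * besselJ (ν + 1) ξ
      = 2 / π - (2 * ν + 1) * ∫ x in Set.Ioi ξ, x⁻¹ * besselJ ν x * besselJ (ν + 1) x := by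
  have hE := limit_all hν
  have hd1 : ∀ x : ℝ, 0 < x → HasDerivAt (besselJ ν) _ x := fun x hx => besselJ_hasDerivAt hν hx
  have hd2 : ∀ x : ℝ, 0 < x → HasDerivAt (besselJ (ν + 1)) _ x := fun x hx => besselJ_hasDerivAt' hν hx
  set F : ℝ → ℝ := fun x => x * besselJ ν x ^ 2 + x * besselJ (ν + 1) x ^ 2
        - (2 * ν + 1) * besselJ ν x * besselJ (ν + 1) x with hF
  have hdF : ∀ x : ℝ, 0 < x → HasDerivAt F ((2 * ν + 1) * (x⁻¹ * besselJ ν x * besselJ (ν + 1) x)) x := by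
    intro x hx
    have h1 := hd1 x hx
    have h2 := hd2 x hx
    have h0 := hasDerivAt_id x
    refine (((h0.mul (h1.pow 2)).add (h0.mul (h2.pow 2))).sub ((h1.const_mul (2 * ν + 1)).mul h2)).congr_deriv ?_
    simp only [id, Pi.pow_apply, Nat.cast_ofNat]
    field_simp
    ring
  have hprod : ∀ x : ℝ, 0 < x → |besselJ ν x * besselJ (ν + 1) x|
      ≤ x⁻¹ * (x * besselJ ν x ^ 2 + x * besselJ (ν + 1) x ^ 2) := by
    intro x hx
    rw [← mul_add, inv_mul_cancel_left₀ hx.ne', abs_le]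
    constructor <;> nlinarith [sq_nonneg (besselJ ν x + besselJ (ν + 1) x), sq_nonneg (besselJ ν x - besselJ (ν + 1) x),
      sq_nonneg (besselJ ν x), sq_nonneg (besselJ (ν + 1) x)]
  have hp0 : Tendsto (fun x => besselJ ν x * besselJ (ν + 1) x) atTop (𝓝 0) := by
    have := (tendsto_inv_atTop_zero (𝕜 := ℝ)).mul hE
    rw [zero_mul] at this
    refine squeeze_zero_norm' ?_ this
    filter_upwards [eventually_gt_atTop 0] with x hx
    exact hprod x hx
  have hFlim : Tendsto F atTop (𝓝 (2 / π)) := by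
    have := hE.sub (hp0.const_mul (2 * ν + 1))
    rw [mul_zero, sub_zero] at this
    refine this.congr fun x => ?_
    rw [hF]; ring
  have hint : IntegrableOn (fun x : ℝ => x⁻¹ * besselJ ν x * besselJ (ν + 1) x) (Ioi ξ) := by
    have hcont : ContinuousOn (fun x : ℝ => x⁻¹ * besselJ ν x * besselJ (ν + 1) x) (Ici ξ) := by
      intro x hx
      have hx0 : 0 < x := lt_of_lt_of_le hξ hx
      exact (((continuousAt_inv₀ hx0.ne').mul (hd1 x hx0).continuousAt).mul
        (hd2 x hx0).continuousAt).continuousWithinAt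
    refine (hcont.locallyIntegrableOn measurableSet_Ici).integrableOn_of_isBigO_atTop
      (g := fun x : ℝ => x ^ (-2 : ℝ)) ?_ ?_ |>.mono_set Ioi_subset_Ici_self
    · refine Asymptotics.IsBigO.of_bound (2 / π + 1) ?_
      filter_upwards [eventually_gt_atTop 0, hE.eventually_le_const (show 2 / π < 2 / π + 1 by linarith)] with x hx hle
      rw [mul_assoc, norm_mul, Real.norm_eq_abs, Real.norm_eq_abs, Real.norm_eq_abs, abs_of_pos (inv_pos.2 hx),
        abs_of_pos (Real.rpow_pos_of_pos hx _), Real.rpow_neg hx.le, Real.rpow_two]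
      calc x⁻¹ * |besselJ ν x * besselJ (ν + 1) x| ≤ x⁻¹ * (x⁻¹ * (2 / π + 1)) := by
            gcongr
            refine (hprod x hx).trans ?_
            gcongr
        _ = _ := by field_simp
    · exact ⟨Ioi 1, Ioi_mem_atTop 1, integrableOn_Ioi_rpow_of_lt (by norm_num) one_pos⟩
  have := integral_Ioi_of_hasDerivAt_of_tendsto (hdF ξ hξ).continuousAt.continuousWithinAt
    (fun x hx => hdF x (lt_trans hξ hx)) (hint.const_mul _) hFlim
  rw [integral_const_mul] at this
  rw [this, hF]
  ring
end

section
/- Let A be a real M×3 matrix with rank A = 3, δ > 0, R > 0, and suppose the operator norm |A| ≤ δ^{-1}. Suppose there exist real entire functions F, G : ℂ³ → ℂ of exponential type at most 2πδ, integrable on ℝ³, with F(x) ≤ χ_R(x) ≤ G(x) on ℝ³ and ∫_{ℝ³}(G − F) dx = 4πδ^{-1}R²(1 − (sin(πδR)/(πδR))²)^{-1} (the extremal majorant/minorant pair). Then for every x ∈ ℝ³, |(det AᵀA)^{1/2} Σ_{m ∈ ℤ³} χ_R(A(m+x)) − (4/3)πR³| ≤ 4πδ^{-1}R²(1 − (sin(πδR)/(πδR))²)^{-1}.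 -/
open Real Matrix MeasureTheory

/-- The normalized characteristic function of the ball of radius `R` in `ℝ^K`:
value `1` inside, `1/2` on the boundary, `0` outside. -/
noncomputable def chiR (R : ℝ) {K : ℕ} (y : Fin K → ℝ) : ℝ :=
  if Real.sqrt (∑ i, y i ^ 2) < R then 1
  else if Real.sqrt (∑ i, y i ^ 2) = R then 1 / 2 else 0

/-- Stein's norm on `ℂ^K`: `‖z‖ = sup{|z·t| : t ∈ ℝ^K, |t| ≤ 1}`. -/
noncomputable def steinNorm {K : ℕ} (z : Fin K → ℂ) : ℝ :=
  sSup {r : ℝ | ∃ t : Fin K → ℝ, (∑ i, t i ^ 2) ≤ 1 ∧ r = ‖∑ i, z i * (t i : ℂ)‖}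

open Filter Topology Complex in
/-- Phragmen-Lindelof on the upper half plane. -/
lemma pl_upper_s19 (P : ℂ → ℂ) (hP : Differentiable ℂ P) (a K : ℝ)
    (hexp : ∀ ε > 0, ∃ C : ℝ, ∀ z, ‖P z‖ ≤ C * Real.exp ((a + ε) * ‖z‖))
    (hK : ∀ x : ℝ, ‖P x‖ ≤ K) (w : ℂ) (hw : 0 ≤ w.im) :
    ‖P w‖ ≤ K * Real.exp (a * w.im) := by
  have key : ∀ ε > 0, ‖P w‖ ≤ K * Real.exp ((a + ε) * w.im) := by
    intro ε hε
    obtain ⟨C, hC⟩ := hexp ε hε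
    have hC0 : 0 ≤ C := by
      have := (norm_nonneg _).trans (hC 0)
      simpa using this
    let f : ℂ → ℂ := fun z => P (I * z) * cexp (-((a + ε : ℝ) : ℂ) * z)
    have hf : Differentiable ℂ f := by
      have : Differentiable ℂ fun z : ℂ => P (I * z) := hP.comp (by fun_prop)
      fun_prop
    have hnorm : ∀ z, ‖f z‖ = ‖P (I * z)‖ * Real.exp (-(a + ε) * z.re) := by
      intro z
      simp only [f, norm_mul, Complex.norm_exp]
      congr 2
      rw [← Complex.ofReal_neg, Complex.re_ofReal_mul]
    have h := PhragmenLindelof.right_half_plane_of_bounded_on_real (f := f) (C := K)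
      (z := -I * w) hf.diffContOnCl ⟨1, by norm_num, |a + ε| + |a + ε|, ?_⟩ ?_ ?_ (by simpa using hw)
    · rw [hnorm] at h
      have e1 : I * (-I * w) = w := by
        rw [← mul_assoc]; simp
      have e2 : (-I * w).re = w.im := by simp
      rw [e1, e2] at h
      have h2 : ‖P w‖ = ‖P w‖ * Real.exp (-(a + ε) * w.im) * Real.exp ((a + ε) * w.im) := by
        rw [mul_assoc, ← Real.exp_add]; ring_nf; simp
      rw [h2]
      gcongr
    · refine Asymptotics.IsBigO.of_bound C (Eventually.of_forall fun z => ?_)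
      rw [hnorm]
      calc _ ≤ (C * Real.exp ((a + ε) * ‖I * z‖)) * Real.exp (|a + ε| * ‖z‖) := by
            refine mul_le_mul (hC _) (Real.exp_le_exp.2 ?_) (by positivity) (by positivity)
            calc -(a + ε) * z.re ≤ |-(a + ε) * z.re| := le_abs_self _
              _ = |a + ε| * |z.re| := by rw [abs_mul, abs_neg]
              _ ≤ _ := by gcongr; exact Complex.abs_re_le_norm z
        _ = C * Real.exp ((a + ε) * ‖z‖ + |a + ε| * ‖z‖) := by
            rw [Real.exp_add]; simp; ring
        _ ≤ _ := by
            rw [Real.norm_of_nonneg (Real.exp_pos _).le]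
            refine mul_le_mul_of_nonneg_left (Real.exp_le_exp.2 ?_) hC0
            rw [Real.rpow_one]
            nlinarith [le_abs_self (a + ε), norm_nonneg z]
    · refine ⟨C, ?_⟩
      simp only [eventually_map]
      filter_upwards [eventually_ge_atTop 0] with x hx
      rw [hnorm]
      calc _ ≤ C * Real.exp ((a + ε) * ‖I * (x : ℂ)‖) * Real.exp (-(a + ε) * (x : ℂ).re) := by
            gcongr; exact hC _
        _ = C := by
            rw [mul_assoc, ← Real.exp_add]
            simp [abs_of_nonneg hx]
            ring_nf
            simp
    · intro x
      rw [hnorm]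
      have e1 : I * ((x : ℂ) * I) = ((-x : ℝ) : ℂ) := by
        push_cast
        linear_combination (x : ℂ) * Complex.I_mul_I
      rw [e1]
      simpa using hK (-x)
  have ht : Tendsto (fun ε : ℝ => K * Real.exp ((a + ε) * w.im)) (𝓝[>] 0)
      (𝓝 (K * Real.exp ((a + 0) * w.im))) := by
    apply Tendsto.mono_left _ nhdsWithin_le_nhds
    exact Continuous.tendsto (by fun_prop) 0
  rw [add_zero] at ht
  refine ge_of_tendsto ht ?_
  filter_upwards [self_mem_nhdsWithin] with ε hε using key ε hε

lemma pl_full (P : ℂ → ℂ) (hP : Differentiable ℂ P) (a K : ℝ)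
    (hexp : ∀ ε > 0, ∃ C : ℝ, ∀ z, ‖P z‖ ≤ C * Real.exp ((a + ε) * ‖z‖))
    (hK : ∀ x : ℝ, ‖P x‖ ≤ K) (w : ℂ) :
    ‖P w‖ ≤ K * Real.exp (a * |w.im|) := by
  rcases le_total 0 w.im with h | h
  · rw [abs_of_nonneg h]; exact pl_upper_s19 P hP a K hexp hK w h
  · have := pl_upper_s19 (fun z => P (-z)) (hP.comp (by fun_prop)) a K
      (fun ε hε => by
        obtain ⟨C, hC⟩ := hexp ε hε
        exact ⟨C, fun z => by simpa using hC (-z)⟩)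
      (fun x => by simpa using hK (-x)) (-w) (by simpa using h)
    simpa [abs_of_nonpos h] using this

/-- An `L^1` entire function of exponential type `a`: pointwise bounds. -/
lemma exp_type_bound (g : ℂ → ℂ) (hg : Differentiable ℂ g) (a : ℝ) (ha : 0 ≤ a)
    (hexp : ∀ ε > 0, ∃ C : ℝ, ∀ z, ‖g z‖ ≤ C * Real.exp ((a + ε) * ‖z‖))
    (hint : Integrable (fun s : ℝ => g s)) :
    ∃ K : ℝ, ∀ z, ‖g z‖ ≤ K * Real.exp (a * |z.im|) := by
  obtain ⟨P, hP0, hPd⟩ := hg.isExactOn_univ.with_val_at 0 0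
  have hPd : ∀ z, HasDerivAt P (g z) z := fun z => hPd z trivial
  have hPdiff : Differentiable ℂ P := fun z => (hPd z).differentiableAt
  have hPK : ∀ x : ℝ, ‖P x‖ ≤ ∫ s : ℝ, ‖g s‖ := by
    intro x
    have h1 : ∫ s in (0:ℝ)..x, g s = P x - P (0:ℝ) := by
      apply intervalIntegral.integral_eq_sub_of_hasDerivAt
        (f := fun s : ℝ => P s) (fun s _ => (hPd s).comp_ofReal)
      exact hint.intervalIntegrable
    have h2 : P x = ∫ s in (0:ℝ)..x, g s := by rw [h1]; simp [hP0]
    rw [h2]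
    refine (intervalIntegral.norm_integral_le_integral_norm_uIoc).trans ?_
    exact setIntegral_le_integral hint.norm (Filter.Eventually.of_forall fun _ => norm_nonneg _)
  have hPexp : ∀ ε > 0, ∃ C : ℝ, ∀ z, ‖P z‖ ≤ C * Real.exp ((a + ε) * ‖z‖) := by
    intro ε hε
    obtain ⟨C, hC⟩ := hexp (ε/2) (by positivity)
    have hC0 : 0 ≤ C := by
      have := (norm_nonneg _).trans (hC 0)
      simpa using this
    refine ⟨C * (2 / ε), fun z => ?_⟩
    have h1 : ‖P z - P 0‖ ≤ (C * Real.exp ((a + ε/2) * ‖z‖)) * ‖z - 0‖ := by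
      apply Convex.norm_image_sub_le_of_norm_hasDerivWithin_le (s := Metric.closedBall 0 ‖z‖)
        (fun w _ => (hPd w).hasDerivWithinAt) _ (convex_closedBall _ _) (by simp) (by simp)
      intro w hw
      refine (hC w).trans ?_
      gcongr
      simpa using hw
    rw [hP0, sub_zero, sub_zero] at h1
    refine h1.trans ?_
    have h2 : ‖z‖ ≤ (2/ε) * Real.exp (ε/2 * ‖z‖) := by
      have := Real.add_one_le_exp (ε/2 * ‖z‖)
      calc ‖z‖ = (2/ε) * (ε/2 * ‖z‖) := by field_simp
        _ ≤ _ := by gcongr; linarith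
    calc _ ≤ C * Real.exp ((a + ε/2) * ‖z‖) * ((2/ε) * Real.exp (ε/2 * ‖z‖)) := by gcongr
      _ = C * (2/ε) * (Real.exp ((a + ε/2) * ‖z‖) * Real.exp (ε/2 * ‖z‖)) := by ring
      _ = _ := by rw [← Real.exp_add]; ring_nf
  set K := ∫ s : ℝ, ‖g s‖
  have hK0 : 0 ≤ K := integral_nonneg fun _ => norm_nonneg _
  refine ⟨K * Real.exp a, fun z => ?_⟩
  have := Complex.norm_deriv_le_of_forall_mem_sphere_norm_le (f := P) (c := z) (R := 1)
    (C := K * Real.exp a * Real.exp (a * |z.im|)) one_pos hPdiff.diffContOnCl ?_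
  · rw [(hPd z).deriv] at this
    simpa using this
  · intro w hw
    refine (pl_full P hPdiff a K hPexp hPK w).trans ?_
    rw [mul_assoc, ← Real.exp_add]
    gcongr
    have h1 : |w.im - z.im| ≤ 1 := by
      have := Complex.abs_im_le_norm (w - z)
      rw [mem_sphere_iff_norm.1 hw] at this
      simpa using this
    have h2 : |w.im| ≤ 1 + |z.im| := by
      calc |w.im| = |(w.im - z.im) + z.im| := by ring_nf
        _ ≤ _ := (abs_add_le _ _).trans (by gcongr)
    nlinarith

open Filter Topology Complex in
lemma contour_eta (h : ℂ → ℂ) (hh : Differentiable ℂ h) (K : ℝ)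
    (hK : ∀ z : ℂ, z.im ≤ 0 → ‖h z‖ ≤ K) (hint : Integrable (fun s : ℝ => h s))
    (η : ℝ) (hη : 0 < η) : ∫ s : ℝ, h s * ((1 + I * η * s) ^ 2)⁻¹ = 0 := by
  have hK0 : 0 ≤ K := (norm_nonneg _).trans (hK 0 (by simp))
  have hre : ∀ z : ℂ, (1 + I * η * z).re = 1 - η * z.im := by intro z; simp [sub_eq_add_neg]
  have him : ∀ z : ℂ, (1 + I * η * z).im = η * z.re := by intro z; simp
  have hge1 : ∀ z : ℂ, z.im ≤ 0 → 1 ≤ ‖1 + I * η * z‖ := by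
    intro z hz
    refine le_trans ?_ (Complex.re_le_norm _)
    rw [hre]; nlinarith
  have hne : ∀ z : ℂ, z.im ≤ 0 → 1 + I * η * z ≠ 0 := by
    intro z hz h0
    have := hge1 z hz
    rw [h0] at this; norm_num at this
  have hgeR : ∀ z : ℂ, z.im ≤ 0 → η * |z.re| ≤ ‖1 + I * η * z‖ := by
    intro z hz
    refine le_trans ?_ (Complex.abs_im_le_norm _)
    rw [him, abs_mul, abs_of_pos hη]
  have hgeI : ∀ z : ℂ, z.im ≤ 0 → η * |z.im| ≤ ‖1 + I * η * z‖ := by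
    intro z hz
    refine le_trans ?_ (Complex.re_le_norm _)
    rw [hre, abs_of_nonpos hz]; nlinarith
  let H : ℂ → ℂ := fun z => h z * ((1 + I * η * z) ^ 2)⁻¹
  have hHint : Integrable (fun s : ℝ => H s) := by
    refine hint.mono ?_ (Eventually.of_forall fun s => ?_)
    · refine Continuous.aestronglyMeasurable ?_
      refine (hh.continuous.comp Complex.continuous_ofReal).mul ?_
      refine Continuous.inv₀ (by fun_prop) fun s => pow_ne_zero 2 (hne s (by simp))
    · simp only [H, norm_mul, norm_inv, norm_pow]
      refine mul_le_of_le_one_right (norm_nonneg _) ?_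
      exact inv_le_one_of_one_le₀ (one_le_pow₀ (hge1 s (by simp)))
  have hHb : ∀ T > 0, ∀ z : ℂ, z.im ≤ 0 → (T ≤ |z.re| ∨ T ≤ |z.im|) → ‖H z‖ ≤ K / (η * T) ^ 2 := by
    intro T hT z hz hor
    simp only [H, norm_mul, norm_inv, norm_pow]
    rw [← div_eq_mul_inv]
    gcongr
    · exact hK z hz
    · rcases hor with h1 | h1
      · exact le_trans (by gcongr) (hgeR z hz)
      · exact le_trans (by gcongr) (hgeI z hz)
  have hlim : Tendsto (fun T : ℝ => ∫ s in (-T)..T, H s) atTop (𝓝 (∫ s : ℝ, H s)) :=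
    intervalIntegral_tendsto_integral hHint tendsto_neg_atTop_atBot tendsto_id
  have hb : ∀ T > 0, ‖∫ s in (-T)..T, H s‖ ≤ 4 * K / η ^ 2 * T⁻¹ := by
    intro T hT
    have hrect := Complex.integral_boundary_rect_eq_zero_of_differentiableOn H
      (-T + -T * I) (T + 0 * I) ?_
    · simp only [add_re, add_im, mul_re, mul_im, neg_re, neg_im, ofReal_re, ofReal_im, I_re, I_im,
        smul_eq_mul, mul_zero, mul_one, zero_mul, neg_zero, sub_zero, add_zero,
        zero_add, ofReal_zero] at hrect
      have e : (∫ s in (-T)..T, H s) = (∫ x in (-T)..T, H (x + ((-T : ℝ) : ℂ) * I))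
          + I * (∫ y in (-T)..0, H (T + y * I)) - I * (∫ y in (-T)..0, H (((-T : ℝ) : ℂ) + y * I)) := by
        linear_combination -hrect
      rw [e]
      have b1 : ‖∫ x in (-T)..T, H (x + ((-T : ℝ) : ℂ) * I)‖ ≤ K / (η * T) ^ 2 * |T - -T| := by
        apply intervalIntegral.norm_integral_le_of_norm_le_const
        intro x _
        apply hHb T hT
        · simp [hT.le]
        · right; simp [le_abs_self]
      have b2 : ‖∫ y in (-T)..0, H (T + y * I)‖ ≤ K / (η * T) ^ 2 * |0 - -T| := by
        apply intervalIntegral.norm_integral_le_of_norm_le_const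
        intro x hx
        rw [Set.uIoc_of_le (by linarith)] at hx
        apply hHb T hT
        · simpa using hx.2
        · left; simp [le_abs_self]
      have b3 : ‖∫ y in (-T)..0, H (((-T : ℝ) : ℂ) + y * I)‖ ≤ K / (η * T) ^ 2 * |0 - -T| := by
        apply intervalIntegral.norm_integral_le_of_norm_le_const
        intro x hx
        rw [Set.uIoc_of_le (by linarith)] at hx
        apply hHb T hT
        · simpa using hx.2
        · left; simp [le_abs_self]
      rw [abs_of_pos (by linarith)] at b1 b2 b3
      calc _ ≤ K / (η * T) ^ 2 * (T - -T) + K / (η * T) ^ 2 * (0 - -T) + K / (η * T) ^ 2 * (0 - -T) := by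
            refine (norm_sub_le _ _).trans (add_le_add ((norm_add_le _ _).trans (add_le_add b1 ?_)) ?_)
            · rw [norm_mul, norm_I, one_mul]; exact b2
            · rw [norm_mul, norm_I, one_mul]; exact b3
        _ = _ := by field_simp; ring
    · intro z hz
      have hz2 : z.im ≤ 0 := by
        have := hz.2
        simp only [Set.mem_preimage] at this
        simp at this
        rw [Set.uIcc_of_le (by linarith)] at this
        exact this.2
      refine DifferentiableAt.differentiableWithinAt ?_
      refine (hh z).mul ?_
      refine DifferentiableAt.inv (by fun_prop) (pow_ne_zero 2 (hne z hz2))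
  have h0 : Tendsto (fun T : ℝ => ∫ s in (-T)..T, H s) atTop (𝓝 0) := by
    refine squeeze_zero_norm' (a := fun T => 4 * K / η ^ 2 * T⁻¹) ?_ ?_
    · filter_upwards [eventually_gt_atTop 0] with T hT using hb T hT
    · simpa using (tendsto_inv_atTop_zero (𝕜 := ℝ)).const_mul (4 * K / η ^ 2)
  exact tendsto_nhds_unique hlim h0

open Filter Topology Complex in
lemma contour (h : ℂ → ℂ) (hh : Differentiable ℂ h) (K : ℝ)
    (hK : ∀ z : ℂ, z.im ≤ 0 → ‖h z‖ ≤ K) (hint : Integrable (fun s : ℝ => h s)) :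
    ∫ s : ℝ, h s = 0 := by
  have hge1 : ∀ (η : ℝ) (s : ℝ), 1 ≤ ‖1 + I * η * (s:ℂ)‖ := by
    intro η s
    refine le_trans ?_ (Complex.re_le_norm _)
    simp
  have hne : ∀ (η : ℝ) (s : ℝ), 1 + I * η * (s:ℂ) ≠ 0 := by
    intro η s h0
    have := hge1 η s
    rw [h0] at this; norm_num at this
  have hlim : Tendsto (fun η : ℝ => ∫ s : ℝ, h s * ((1 + I * η * s) ^ 2)⁻¹) (𝓝[>] 0)
      (𝓝 (∫ s : ℝ, h s)) := by
    refine tendsto_integral_filter_of_dominated_convergence (fun s : ℝ => ‖h s‖) ?_ ?_ hint.norm ?_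
    · refine Eventually.of_forall fun η => Continuous.aestronglyMeasurable ?_
      refine (hh.continuous.comp Complex.continuous_ofReal).mul ?_
      exact Continuous.inv₀ (by fun_prop) fun s => pow_ne_zero 2 (hne η s)
    · refine Eventually.of_forall fun η => Eventually.of_forall fun s => ?_
      simp only [norm_mul, norm_inv, norm_pow]
      refine mul_le_of_le_one_right (norm_nonneg _) ?_
      exact inv_le_one_of_one_le₀ (one_le_pow₀ (hge1 η s))
    · refine Eventually.of_forall fun s => Tendsto.mono_left ?_ nhdsWithin_le_nhds
      have hc : Continuous fun η : ℝ => h s * ((1 + I * η * s) ^ 2)⁻¹ :=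
        continuous_const.mul (Continuous.inv₀ (by fun_prop) fun η => pow_ne_zero 2 (hne η s))
      have := hc.tendsto 0
      simpa using this
  refine tendsto_nhds_unique hlim (Tendsto.congr' ?_ tendsto_const_nhds)
  filter_upwards [self_mem_nhdsWithin] with η hη
  exact (contour_eta h hh K hK hint η hη).symm

open Complex in
lemma fourier_vanish_pos (g : ℂ → ℂ) (hg : Differentiable ℂ g)
    (hexp : ∀ ε > 0, ∃ C : ℝ, ∀ z, ‖g z‖ ≤ C * Real.exp ((2 * π + ε) * ‖z‖))
    (hint : Integrable (fun s : ℝ => g s)) (r : ℝ) (hr : 1 ≤ r) :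
    ∫ s : ℝ, g s * cexp (-(2 * π * r * s) * I) = 0 := by
  obtain ⟨K, hK⟩ := exp_type_bound g hg (2 * π) (by positivity) hexp hint
  have hK0 : 0 ≤ K := by simpa using (norm_nonneg _).trans (hK 0)
  have hn : ∀ z : ℂ, ‖cexp (-(2 * π * r * z) * I)‖ = Real.exp (2 * π * r * z.im) := by
    intro z
    rw [Complex.norm_exp]
    simp
  refine contour (fun z => g z * cexp (-(2 * π * r * z) * I)) (by fun_prop) K ?_ ?_
  · intro z hz
    rw [norm_mul, hn]
    calc _ ≤ K * Real.exp (2 * π * |z.im|) * Real.exp (2 * π * r * z.im) := by gcongr; exact hK z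
      _ = K * Real.exp (2 * π * |z.im| + 2 * π * r * z.im) := by rw [Real.exp_add]; ring
      _ ≤ K * 1 := by
        gcongr
        rw [Real.exp_le_one_iff, abs_of_nonpos hz]
        have : 0 ≤ 2 * π := by positivity
        nlinarith [mul_nonneg this (mul_nonneg (sub_nonneg.2 hr) (neg_nonneg.2 hz))]
      _ = K := mul_one K
  · refine hint.mono ?_ (Filter.Eventually.of_forall fun s => ?_)
    · exact Continuous.aestronglyMeasurable
        ((hg.continuous.comp Complex.continuous_ofReal).mul (by fun_prop))
    · rw [norm_mul, hn]; simp

open Complex in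
lemma fourier_vanish (g : ℂ → ℂ) (hg : Differentiable ℂ g)
    (hexp : ∀ ε > 0, ∃ C : ℝ, ∀ z, ‖g z‖ ≤ C * Real.exp ((2 * π + ε) * ‖z‖))
    (hint : Integrable (fun s : ℝ => g s)) (r : ℝ) (hr : 1 ≤ |r|) :
    ∫ s : ℝ, g s * cexp (-(2 * π * r * s) * I) = 0 := by
  rcases le_abs.1 hr with h | h
  · exact fourier_vanish_pos g hg hexp hint r h
  · have := fourier_vanish_pos (fun z => g (-z)) (hg.comp (by fun_prop)) (fun ε hε => by
        obtain ⟨C, hC⟩ := hexp ε hε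
        exact ⟨C, fun z => by simpa using hC (-z)⟩) (by simpa using hint.comp_neg) (-r) h
    rw [← this, ← integral_neg_eq_self]
    simp

/-- The character `x ↦ e(k·x)`. -/
noncomputable def ek (k : Fin 3 → ℤ) (x : Fin 3 → ℝ) : ℂ :=
  Complex.exp (2 * π * Complex.I * ∑ j, (k j : ℂ) * (x j : ℂ))

lemma ek_continuous (k : Fin 3 → ℤ) : Continuous (ek k) := by
  unfold ek; fun_prop

lemma ek_norm (k : Fin 3 → ℤ) (x : Fin 3 → ℝ) : ‖ek k x‖ = 1 := by
  have : ek k x = Complex.exp (((2 * π * ∑ j, (k j : ℝ) * x j : ℝ) : ℂ) * Complex.I) := by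
    unfold ek; congr 1; push_cast; ring
  rw [this, Complex.norm_exp_ofReal_mul_I]

lemma ek_add (k l : Fin 3 → ℤ) (x : Fin 3 → ℝ) : ek (k + l) x = ek k x * ek l x := by
  unfold ek
  rw [← Complex.exp_add]
  congr 1
  simp only [Pi.add_apply, Int.cast_add, add_mul, Finset.sum_add_distrib, mul_add]

lemma ek_add' (k : Fin 3 → ℤ) (x y : Fin 3 → ℝ) : ek k (x + y) = ek k x * ek k y := by
  unfold ek
  rw [← Complex.exp_add]
  congr 1
  simp only [Pi.add_apply, Complex.ofReal_add, mul_add, Finset.sum_add_distrib]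

lemma ek_integrable_mul {f : (Fin 3 → ℝ) → ℂ} {μ : Measure (Fin 3 → ℝ)} (hf : Integrable f μ)
    (k : Fin 3 → ℤ) : Integrable (fun x => ek k x * f x) μ := by
  refine hf.mono ((ek_continuous k).aestronglyMeasurable.mul hf.1)
    (Filter.Eventually.of_forall fun x => ?_)
  rw [norm_mul, ek_norm, one_mul]

lemma vanish3 (Φ : (Fin 3 → ℂ) → ℂ) (hΦ : Differentiable ℂ Φ)
    (hint : Integrable (fun x : Fin 3 → ℝ => Φ fun i => (x i : ℂ)))
    (hexp : ∀ (i : Fin 3) (y : Fin 2 → ℝ), ∀ ε > 0, ∃ C : ℝ, ∀ z : ℂ,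
      ‖Φ (i.insertNth z (fun j => (y j : ℂ)))‖ ≤ C * Real.exp ((2 * π + ε) * ‖z‖))
    (k : Fin 3 → ℤ) (hk : k ≠ 0) :
    ∫ x : Fin 3 → ℝ, ek k x * Φ (fun i => (x i : ℂ)) = 0 := by
  obtain ⟨i, hi⟩ := Function.ne_iff.1 hk
  have hi : k i ≠ 0 := hi
  have hmp := (volume_preserving_piFinSuccAbove (fun _ : Fin 3 => ℝ) i).symm
  have hsymm : ∀ (s : ℝ) (y : Fin 2 → ℝ),
      (MeasurableEquiv.piFinSuccAbove (fun _ : Fin 3 => ℝ) i).symm (s, y) = i.insertNth s y :=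
    fun _ _ => rfl
  have hins : ∀ (s : ℝ) (y : Fin 2 → ℝ),
      (fun j => (((MeasurableEquiv.piFinSuccAbove (fun _ : Fin 3 => ℝ) i).symm (s, y) j : ℝ) : ℂ))
        = i.insertNth (s : ℂ) (fun j => (y j : ℂ)) := by
    intro s y
    refine (Fin.eq_insertNth_iff).2 ⟨?_, ?_⟩
    · simp [hsymm]
    · funext j; simp [Fin.removeNth, hsymm]
  have hek : ∀ (s : ℝ) (y : Fin 2 → ℝ),
      ek k ((MeasurableEquiv.piFinSuccAbove (fun _ : Fin 3 => ℝ) i).symm (s, y))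
        = Complex.exp (2 * π * Complex.I * ∑ j, (k (i.succAbove j) : ℂ) * (y j : ℂ)) *
          Complex.exp (-(2 * π * ((-k i : ℤ) : ℝ) * s) * Complex.I) := by
    intro s y
    unfold ek
    rw [← Complex.exp_add, Fin.sum_univ_succAbove _ i]
    congr 1
    simp [hsymm]
    ring
  have hint1 := (hmp.integrable_comp_emb (MeasurableEquiv.measurableEmbedding _)).2 hint
  have hint2 := (hmp.integrable_comp_emb (MeasurableEquiv.measurableEmbedding _)).2
    (ek_integrable_mul hint k)
  rw [← hmp.integral_comp (MeasurableEquiv.measurableEmbedding _)]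
  rw [Measure.volume_eq_prod, integral_prod_symm _ (by rw [← Measure.volume_eq_prod]; exact hint2)]
  have hae := (Integrable.swap (α := ℝ) (β := Fin 2 → ℝ) (μ := volume) (ν := volume) (by rw [← Measure.volume_eq_prod]; exact hint1)).prod_right_ae
  refine integral_eq_zero_of_ae ?_
  filter_upwards [hae] with y hy
  simp only [Function.comp_def, Prod.swap, hins] at hy
  simp only [hins, hek, mul_assoc, Pi.zero_apply]
  rw [integral_const_mul]
  have h1 : Differentiable ℂ fun z : ℂ => Φ (i.insertNth z (fun j => (y j : ℂ))) := by
    refine hΦ.comp ?_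
    refine differentiable_pi.2 fun j => ?_
    refine Fin.succAboveCases i ?_ (fun j => ?_) j
    · simp
    · simp
  have := fourier_vanish _ h1 (hexp i y) hy ((-k i : ℤ) : ℝ) (by
    rw [← Int.cast_abs, abs_neg]
    exact_mod_cast Int.one_le_abs hi)
  rw [mul_eq_zero]; right
  rw [← this]
  congr 1
  funext s
  rw [mul_comm]
  simp [mul_assoc]

/-- The unit cube centred at the origin. -/
def Q0 : Set (Fin 3 → ℝ) := Set.Icc (fun _ => -(1/2)) (fun _ => 1/2)

/-- The peak trigonometric polynomial. -/
noncomputable def cf (x : Fin 3 → ℝ) : ℝ := ∏ i, (1 + Real.cos (2 * π * x i))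

lemma Q0_eq : Q0 = Set.univ.pi (fun _ : Fin 3 => Set.Icc (-(1/2) : ℝ) (1/2)) := by
  rw [Set.pi_univ_Icc]; rfl

lemma Q0_compact : IsCompact Q0 := isCompact_Icc

lemma int_circle (n : ℤ) (hn : n ≠ 0) :
    ∫ x in Set.Icc (-(1/2) : ℝ) (1/2), Complex.exp (2 * π * Complex.I * ((n : ℂ) * (x : ℂ))) = 0 := by
  rw [integral_Icc_eq_integral_Ioc, ← intervalIntegral.integral_of_le (by norm_num)]
  have hc : (2 * π * Complex.I * n : ℂ) ≠ 0 := by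
    have := Real.pi_ne_zero
    simp [hn, this]
  have := integral_exp_mul_complex (a := -(1/2)) (b := 1/2) hc
  simp only [← mul_assoc]
  rw [this]
  rw [div_eq_zero_iff]; left
  rw [sub_eq_zero, Complex.exp_eq_exp_iff_exists_int]
  refine ⟨n, ?_⟩
  push_cast
  ring

lemma int_Q0_ek (k : Fin 3 → ℤ) (hk : k ≠ 0) : ∫ x in Q0, ek k x = 0 := by
  obtain ⟨i, hi⟩ := Function.ne_iff.1 hk
  have hi : k i ≠ 0 := hi
  rw [Q0_eq, volume_pi, Measure.restrict_pi_pi]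
  have : ∀ x : Fin 3 → ℝ, ek k x = ∏ j, Complex.exp (2 * π * Complex.I * ((k j : ℂ) * (x j : ℂ))) := by
    intro x
    rw [← Complex.exp_sum, ← Finset.mul_sum]; rfl
  simp only [this]
  rw [integral_fintype_prod_eq_prod (𝕜 := ℂ)
    (fun j (t : ℝ) => Complex.exp (2 * π * Complex.I * ((k j : ℂ) * (t : ℂ))))]
  exact Finset.prod_eq_zero (Finset.mem_univ i) (int_circle (k i) hi)

lemma vol_Q0 : volume.real Q0 = 1 := by
  rw [Q0, Measure.real, Real.volume_Icc_pi]
  norm_num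

lemma ek_zero (x : Fin 3 → ℝ) : ek 0 x = 1 := by simp [ek]

/-- Functions for which the one-term Poisson pairing holds, after all modulations. -/
def Good (f φ : (Fin 3 → ℝ) → ℂ) : Prop :=
  Continuous φ ∧ (∃ D : ℝ, ∀ x, ‖φ x‖ ≤ D) ∧
    ∀ k : Fin 3 → ℤ, ∫ x, ek k x * (φ x * f x) = (∫ x, f x) * ∫ x in Q0, ek k x * φ x

lemma good_one (f : (Fin 3 → ℝ) → ℂ) (hOT : ∀ k : Fin 3 → ℤ, k ≠ 0 → ∫ x, ek k x * f x = 0) :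
    Good f (fun _ => 1) := by
  refine ⟨continuous_const, ⟨1, by simp⟩, fun k => ?_⟩
  by_cases hk : k = 0
  · subst hk
    simp [ek_zero, vol_Q0]
  · simp only [one_mul, mul_one]
    rw [hOT k hk, int_Q0_ek k hk, mul_zero]

lemma cos_ek (i : Fin 3) (x : Fin 3 → ℝ) :
    (((1 + Real.cos (2 * π * x i) : ℝ)) : ℂ) =
      1 + 1 / 2 * ek (Pi.single i 1) x + 1 / 2 * ek (-Pi.single i 1) x := by
  have h1 : ek (Pi.single i 1) x = Complex.exp ((2 * π * x i) * Complex.I) := by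
    unfold ek
    rw [Finset.sum_eq_single i]
    · simp; ring_nf
    · intro j _ hj; simp [hj]
    · simp
  have h2 : ek (-Pi.single i 1) x = Complex.exp (-(2 * π * x i) * Complex.I) := by
    unfold ek
    rw [Finset.sum_eq_single i]
    · simp; ring_nf
    · intro j _ hj; simp [hj]
    · simp
  rw [h1, h2]
  push_cast
  rw [Complex.cos]
  ring

lemma int_three {μ : Measure (Fin 3 → ℝ)} {a b c : (Fin 3 → ℝ) → ℂ} (ha : Integrable a μ)
    (hb : Integrable b μ) (hc : Integrable c μ) :
    ∫ x, (a x + 1 / 2 * b x + 1 / 2 * c x) ∂μ =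
      (∫ x, a x ∂μ) + 1 / 2 * (∫ x, b x ∂μ) + 1 / 2 * (∫ x, c x ∂μ) := by
  have hab : Integrable (fun x => a x + 1 / 2 * b x) μ := ha.add (hb.const_mul _)
  rw [integral_add hab (hc.const_mul _), integral_add ha (hb.const_mul _),
    integral_const_mul, integral_const_mul]

lemma good_mul (f φ : (Fin 3 → ℝ) → ℂ) (hf : Integrable f) (h : Good f φ) (i : Fin 3) :
    Good f (fun x => ((1 + Real.cos (2 * π * x i) : ℝ) : ℂ) * φ x) := by
  obtain ⟨hc, ⟨D, hD⟩, hk⟩ := h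
  refine ⟨by fun_prop, ⟨2 * D, fun x => ?_⟩, fun k => ?_⟩
  · rw [norm_mul]
    have h1 : ‖((1 + Real.cos (2 * π * x i) : ℝ) : ℂ)‖ ≤ 2 := by
      rw [Complex.norm_real, Real.norm_eq_abs, abs_le]
      constructor <;> linarith [Real.cos_le_one (2 * π * x i), Real.neg_one_le_cos (2 * π * x i)]
    exact mul_le_mul h1 (hD x) (norm_nonneg _) (by norm_num)
  · have hφf : Integrable (fun x => φ x * f x) := hf.bdd_mul hc.aestronglyMeasurable
      (Filter.Eventually.of_forall hD)
    have hφQ : Integrable φ (volume.restrict Q0) := hc.continuousOn.integrableOn_compact Q0_compact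
    have e1 : ∀ x, ek k x * (((1 + Real.cos (2 * π * x i) : ℝ) : ℂ) * φ x * f x) =
        ek k x * (φ x * f x) + 1 / 2 * (ek (k + Pi.single i 1) x * (φ x * f x))
          + 1 / 2 * (ek (k + -Pi.single i 1) x * (φ x * f x)) := by
      intro x; rw [cos_ek, ek_add, ek_add]; ring
    have e2 : ∀ x, ek k x * (((1 + Real.cos (2 * π * x i) : ℝ) : ℂ) * φ x) =
        ek k x * (φ x) + 1 / 2 * (ek (k + Pi.single i 1) x * (φ x))
          + 1 / 2 * (ek (k + -Pi.single i 1) x * (φ x)) := by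
      intro x; rw [cos_ek, ek_add, ek_add]; ring
    simp only [e1, e2]
    have a1 := fun k => ek_integrable_mul hφf k
    have a2 := fun k => ek_integrable_mul hφQ k
    rw [int_three (a1 _) (a1 _) (a1 _), int_three (a2 _) (a2 _) (a2 _), hk, hk, hk]
    ring

lemma good_pow (f : (Fin 3 → ℝ) → ℂ) (hf : Integrable f)
    (hOT : ∀ k : Fin 3 → ℤ, k ≠ 0 → ∫ x, ek k x * f x = 0) (n : ℕ) :
    Good f (fun x => ((cf x ^ n : ℝ) : ℂ)) := by
  induction n with
  | zero => simpa using good_one f hOT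
  | succ n ih =>
    have := good_mul f _ hf (good_mul f _ hf (good_mul f _ hf ih 2) 1) 0
    convert this using 2 with x
    rw [cf, Fin.prod_univ_three]
    push_cast
    ring

lemma cf_continuous : Continuous cf := by unfold cf; fun_prop

lemma cf_nonneg (x : Fin 3 → ℝ) : 0 ≤ cf x :=
  Finset.prod_nonneg fun i _ => by linarith [Real.neg_one_le_cos (2 * π * x i)]

lemma cf_le (x : Fin 3 → ℝ) : cf x ≤ 8 := by
  calc cf x ≤ ∏ i : Fin 3, (2:ℝ) := Finset.prod_le_prod
        (fun i _ => by linarith [Real.neg_one_le_cos (2 * π * x i)])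
        (fun i _ => by linarith [Real.cos_le_one (2 * π * x i)])
    _ = 8 := by norm_num

lemma cf_zero : cf 0 = 8 := by simp [cf]; norm_num

lemma cf_neg (x : Fin 3 → ℝ) : cf (-x) = cf x := by simp [cf]

lemma cf_add_int (x : Fin 3 → ℝ) (m : Fin 3 → ℤ) : cf (x + fun i => (m i : ℝ)) = cf x := by
  unfold cf
  refine Finset.prod_congr rfl fun i _ => ?_
  rw [Pi.add_apply, mul_add, mul_comm (2 * π) (m i : ℝ), Real.cos_add_int_mul_two_pi]

lemma cf_lt (x : Fin 3 → ℝ) (hx : x ∈ Q0) (hx0 : x ≠ 0) : cf x < cf 0 := by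
  obtain ⟨i, hi⟩ := Function.ne_iff.1 hx0
  have hi : x i ≠ 0 := hi
  have h1 : Real.cos (2 * π * x i) < 1 := by
    refine lt_of_le_of_ne (Real.cos_le_one _) fun h => ?_
    have l1 : -(1/2) ≤ x i := hx.1 i
    have l2 : x i ≤ 1/2 := hx.2 i
    have := (Real.cos_eq_one_iff_of_lt_of_lt (by nlinarith [Real.pi_pos])
      (by nlinarith [Real.pi_pos])).1 h
    have := Real.pi_ne_zero
    simp_all
  rw [cf_zero]
  calc cf x = (1 + Real.cos (2 * π * x i)) * ∏ j ∈ Finset.univ.erase i, (1 + Real.cos (2 * π * x j)) :=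
        (Finset.mul_prod_erase _ _ (Finset.mem_univ i)).symm
    _ ≤ (1 + Real.cos (2 * π * x i)) * ∏ j ∈ Finset.univ.erase i, (2:ℝ) := by
        refine mul_le_mul_of_nonneg_left ?_ (by linarith [Real.neg_one_le_cos (2 * π * x i)])
        exact Finset.prod_le_prod
          (fun i _ => by linarith [Real.neg_one_le_cos (2 * π * x i)])
          (fun i _ => by linarith [Real.cos_le_one (2 * π * x i)])
    _ = (1 + Real.cos (2 * π * x i)) * 4 := by simp; norm_num
    _ < 8 := by linarith

open Filter Topology in
lemma peak (g : (Fin 3 → ℝ) → ℝ) (hg : IntegrableOn g Q0) (hc : ContinuousAt g 0) :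
    Tendsto (fun n : ℕ => (∫ x in Q0, cf x ^ n)⁻¹ * ∫ x in Q0, cf x ^ n * g x) atTop (𝓝 (g 0)) := by
  refine tendsto_setIntegral_pow_smul_of_unique_maximum_of_isCompact_of_integrableOn Q0_compact
    cf_continuous.continuousOn cf_lt (fun x _ => cf_nonneg x) (by rw [cf_zero]; norm_num) ?_ hg
    hc.continuousWithinAt
  refine subset_closure (mem_interior_iff_mem_nhds.2 ?_)
  rw [Q0_eq]
  exact set_pi_mem_nhds Set.finite_univ fun i _ => Icc_mem_nhds (by norm_num) (by norm_num)

open Filter Topology in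
lemma int_pos (n : ℕ) : 0 < ∫ x in Q0, cf x ^ n := by
  have hnn : 0 ≤ ∫ x in Q0, cf x ^ n := integral_nonneg fun x => pow_nonneg (cf_nonneg x) n
  refine lt_of_le_of_ne hnn fun h => ?_
  have hcont : ContinuousOn (fun x => cf x ^ n) Q0 := (cf_continuous.pow n).continuousOn
  have := (setIntegral_eq_zero_iff_of_nonneg_ae (μ := volume) (s := Q0) (f := fun x => cf x ^ n)
    (Eventually.of_forall fun x => pow_nonneg (cf_nonneg x) n)
    (hcont.integrableOn_compact Q0_compact)).1 h.symm
  have h0 : Q0 ∈ 𝓝 (0 : Fin 3 → ℝ) := by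
    rw [Q0_eq]
    exact set_pi_mem_nhds Set.finite_univ fun i _ => Icc_mem_nhds (by norm_num) (by norm_num)
  have h1 : ∀ᶠ x in 𝓝 (0 : Fin 3 → ℝ), 0 < cf x :=
    cf_continuous.continuousAt.eventually_const_lt (by rw [cf_zero]; norm_num)
  obtain ⟨U, hU, hUo, hU0⟩ := mem_nhds_iff.1 (inter_mem h0 h1)
  have hvol : 0 < volume U := hUo.measure_pos volume ⟨0, hU0⟩
  have h2 := ae_imp_of_ae_restrict this
  have : volume U = 0 := by
    refine measure_mono_null ?_ h2
    intro x hx hx2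
    have hx3 := hU hx
    exact (pow_pos hx3.2 n).ne' (hx2 hx3.1)
  exact hvol.ne' this

/-- real-valued consequence of the one-term property, with a shift -/
lemma ot_real (f : (Fin 3 → ℝ) → ℝ) (hf : Integrable f)
    (hOT : ∀ k : Fin 3 → ℤ, k ≠ 0 → ∫ x, ek k x * (f x : ℂ) = 0) (x0 : Fin 3 → ℝ) (n : ℕ) :
    ∫ x, cf x ^ n * f (x0 + x) = (∫ x, f x) * ∫ x in Q0, cf x ^ n := by
  have hf' : Integrable (fun x => ((f (x0 + x) : ℝ) : ℂ)) := (hf.comp_add_left x0).ofReal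
  have hOT' : ∀ k : Fin 3 → ℤ, k ≠ 0 → ∫ x, ek k x * (f (x0 + x) : ℂ) = 0 := by
    intro k hk
    have h1 : ∫ x, ek k (x0 + x) * (f (x0 + x) : ℂ) = 0 := by
      rw [integral_add_left_eq_self (fun x => ek k x * (f x : ℂ)), hOT k hk]
    simp only [ek_add', mul_assoc] at h1
    rw [integral_const_mul] at h1
    refine (mul_eq_zero.1 h1).resolve_left fun h => ?_
    have := ek_norm k x0
    rw [h] at this; simp at this
  have := (good_pow _ hf' hOT' n).2.2 0
  simp only [ek_zero, one_mul, ← Complex.ofReal_mul] at this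
  rw [integral_complex_ofReal, integral_complex_ofReal, integral_complex_ofReal,
    integral_add_left_eq_self f] at this
  exact_mod_cast this

/-- half-open unit cube -/
def Qh : Set (Fin 3 → ℝ) := Set.univ.pi fun _ => Set.Ico (-(1/2) : ℝ) (1/2)

/-- translates of the half-open cube -/
def Tm (m : Fin 3 → ℤ) : Set (Fin 3 → ℝ) := {x | x + (fun i => -(m i : ℝ)) ∈ Qh}

lemma Qh_meas : MeasurableSet Qh := MeasurableSet.univ_pi fun _ => measurableSet_Ico

lemma Tm_meas (m : Fin 3 → ℤ) : MeasurableSet (Tm m) :=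
  (measurable_add_const _) Qh_meas

lemma mem_Tm (m : Fin 3 → ℤ) (x : Fin 3 → ℝ) :
    x ∈ Tm m ↔ ∀ i, -(1/2) ≤ x i - m i ∧ x i - m i < 1/2 := by
  simp [Tm, Qh, Set.mem_pi, sub_eq_add_neg]

lemma Tm_cover (x : Fin 3 → ℝ) : ∃ m, x ∈ Tm m := by
  refine ⟨fun i => ⌊x i + 1/2⌋, (mem_Tm _ _).2 fun i => ?_⟩
  have h1 := Int.floor_le (x i + 1/2)
  have h2 := Int.lt_floor_add_one (x i + 1/2)
  constructor <;> linarith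

lemma Tm_disj (m m' : Fin 3 → ℤ) (h : m ≠ m') : Disjoint (Tm m) (Tm m') := by
  rw [Set.disjoint_left]
  intro x hx hx'
  apply h
  funext i
  have h1 := (mem_Tm _ _).1 hx i
  have h2 := (mem_Tm _ _).1 hx' i
  have h3 : (m i : ℝ) < m' i + 1 := by linarith
  have h4 : (m' i : ℝ) < m i + 1 := by linarith
  have h3 : m i < m' i + 1 := by exact_mod_cast h3
  have h4 : m' i < m i + 1 := by exact_mod_cast h4
  omega

lemma Qh_ae : Qh =ᵐ[volume] Q0 := by
  rw [Q0_eq, Qh]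
  exact Measure.ae_eq_set_pi fun i _ => Ico_ae_eq_Icc

lemma integrable_cf_mul {u : (Fin 3 → ℝ) → ℝ} {μ : Measure (Fin 3 → ℝ)} (hu : Integrable u μ)
    (n : ℕ) : Integrable (fun x => cf x ^ n * u x) μ := by
  refine hu.bdd_mul (c := 8 ^ n) (cf_continuous.pow n).aestronglyMeasurable
    (Filter.Eventually.of_forall fun x => ?_)
  rw [norm_pow, Real.norm_of_nonneg (cf_nonneg x)]
  exact pow_le_pow_left₀ (cf_nonneg x) (cf_le x) n

lemma decomp (u : (Fin 3 → ℝ) → ℝ) (hu : Integrable u) (n : ℕ) (N : Finset (Fin 3 → ℤ)) :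
    ∫ x in ⋃ m ∈ N, Tm m, cf x ^ n * u x =
      ∫ x in Q0, cf x ^ n * ∑ m ∈ N, u (x + fun i => (m i : ℝ)) := by
  rw [integral_biUnion_finset N (fun m _ => Tm_meas m) (fun m _ m' _ h => Tm_disj m m' h)
    (fun m _ => (integrable_cf_mul hu n).integrableOn)]
  simp only [Finset.mul_sum]
  rw [integral_finsetSum]
  · refine Finset.sum_congr rfl fun m _ => ?_
    have hmp := measurePreserving_add_right (volume : Measure (Fin 3 → ℝ)) (fun i => (m i : ℝ))
    rw [← hmp.setIntegral_preimage_emb (measurableEmbedding_addRight _)]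
    have : (fun x : Fin 3 → ℝ => x + fun i => (m i : ℝ)) ⁻¹' Tm m = Qh := by
      ext x
      simp [mem_Tm, Qh, Set.mem_pi]
    rw [this, setIntegral_congr_set Qh_ae]
    simp only [cf_add_int]
  · intro m _
    exact integrable_cf_mul (hu.comp_add_right _).restrict n

lemma poisson_upper (g : (Fin 3 → ℝ) → ℝ) (hg : Integrable g) (hc : Continuous g)
    (h0 : ∀ x, 0 ≤ g x)
    (hOT : ∀ k : Fin 3 → ℤ, k ≠ 0 → ∫ x, ek k x * (g x : ℂ) = 0) (x0 : Fin 3 → ℝ)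
    (N : Finset (Fin 3 → ℤ)) :
    ∑ m ∈ N, g (x0 + fun i => (m i : ℝ)) ≤ ∫ x, g x := by
  have hgi : Integrable (fun x => g (x0 + x)) := hg.comp_add_left x0
  let g0 : (Fin 3 → ℝ) → ℝ := fun x => ∑ m ∈ N, g (x0 + (x + fun i => (m i : ℝ)))
  have hg0 : Continuous g0 := by unfold g0; fun_prop
  have hp := peak g0 (hg0.continuousOn.integrableOn_compact Q0_compact) hg0.continuousAt
  have e : g0 0 = ∑ m ∈ N, g (x0 + fun i => (m i : ℝ)) := by simp [g0]
  rw [e] at hp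
  refine le_of_tendsto' hp fun n => ?_
  rw [← decomp (fun x => g (x0 + x)) hgi n N]
  have h1 : ∫ x in ⋃ m ∈ N, Tm m, cf x ^ n * g (x0 + x) ≤ (∫ x, g x) * ∫ x in Q0, cf x ^ n := by
    rw [← ot_real g hg hOT x0 n]
    exact setIntegral_le_integral (integrable_cf_mul hgi n) (Filter.Eventually.of_forall
      fun x => mul_nonneg (pow_nonneg (cf_nonneg x) n) (h0 _))
  rw [inv_mul_le_iff₀ (int_pos n), mul_comm]
  exact h1

open Filter Topology in
lemma poisson_lower (f u : (Fin 3 → ℝ) → ℝ) (hf : Integrable f) (hu : Integrable u)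
    (hfu : ∀ x, f x ≤ u x)
    (hOT : ∀ k : Fin 3 → ℤ, k ≠ 0 → ∫ x, ek k x * (f x : ℂ) = 0) (x0 : Fin 3 → ℝ)
    (hloc : ∀ y, ∀ᶠ v in 𝓝 (0 : Fin 3 → ℝ), u (y + v) + u (y + -v) ≤ 2 * u y)
    (N : Finset (Fin 3 → ℤ)) (hN : ∀ x, u (x0 + x) ≠ 0 → ∀ m, x ∈ Tm m → m ∈ N) :
    ∫ x, f x ≤ ∑ m ∈ N, u (x0 + fun i => (m i : ℝ)) := by
  have hui : Integrable (fun x => u (x0 + x)) := hu.comp_add_left x0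
  have hfi : Integrable (fun x => f (x0 + x)) := hf.comp_add_left x0
  let S : (Fin 3 → ℝ) → ℝ := fun x => ∑ m ∈ N, u (x0 + (x + fun i => (m i : ℝ)))
  have hS : Integrable S := integrable_finsetSum _ fun m _ => hui.comp_add_right _
  have hSn : Integrable (fun x => S (-x)) := hS.comp_neg
  let g0 : (Fin 3 → ℝ) → ℝ := fun x => max ((S x + S (-x)) / 2) (S 0)
  have hg0 : IntegrableOn g0 Q0 := by
    refine Integrable.sup ((hS.add hSn).div_const 2).restrict ?_
    have : IntegrableOn (fun _ : Fin 3 → ℝ => S 0) Q0 := continuous_const.continuousOn.integrableOn_compact Q0_compact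
    exact this
  have hev : ∀ᶠ x in 𝓝 (0 : Fin 3 → ℝ), g0 x = S 0 := by
    have : ∀ᶠ v in 𝓝 (0 : Fin 3 → ℝ), ∀ m ∈ N, u ((x0 + fun i => (m i : ℝ)) + v)
        + u ((x0 + fun i => (m i : ℝ)) + -v) ≤ 2 * u (x0 + fun i => (m i : ℝ)) :=
      (Filter.eventually_all_finset N).2 fun m _ => hloc _
    filter_upwards [this] with v hv
    refine max_eq_right ?_
    have := Finset.sum_le_sum hv
    rw [Finset.sum_add_distrib, ← Finset.mul_sum] at this
    have e1 : ∀ v, S v = ∑ m ∈ N, u ((x0 + fun i => (m i : ℝ)) + v) := by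
      intro v
      refine Finset.sum_congr rfl fun m _ => ?_
      congr 1; abel
    have e2 : S 0 = ∑ m ∈ N, u (x0 + fun i => (m i : ℝ)) := by simp [S]
    rw [e1 v, e1 (-v), e2]
    linarith
  have hg00 : g0 0 = S 0 := by simp [g0]
  have hp := peak g0 hg0 (by
    have : Tendsto g0 (𝓝 0) (𝓝 (S 0)) := tendsto_const_nhds.congr' (hev.mono fun x hx => hx.symm)
    rw [ContinuousAt, hg00]; exact this)
  have e : g0 0 = ∑ m ∈ N, u (x0 + fun i => (m i : ℝ)) := by rw [hg00]; simp [S]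
  rw [e] at hp
  refine ge_of_tendsto' hp fun n => ?_
  rw [le_inv_mul_iff₀ (int_pos n), mul_comm, ← ot_real f hf hOT x0 n]
  calc ∫ x, cf x ^ n * f (x0 + x) ≤ ∫ x, cf x ^ n * u (x0 + x) := by
        refine integral_mono (integrable_cf_mul hfi n) (integrable_cf_mul hui n) fun x => ?_
        exact mul_le_mul_of_nonneg_left (hfu _) (pow_nonneg (cf_nonneg x) n)
    _ = ∫ x in ⋃ m ∈ N, Tm m, cf x ^ n * u (x0 + x) := by
        refine (setIntegral_eq_integral_of_forall_compl_eq_zero fun x hx => ?_).symm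
        by_contra hne
        have hux : u (x0 + x) ≠ 0 := fun h => hne (by rw [h, mul_zero])
        obtain ⟨m, hm⟩ := Tm_cover x
        exact hx (Set.mem_biUnion (hN x hux m hm) hm)
    _ = ∫ x in Q0, cf x ^ n * S x := decomp (fun x => u (x0 + x)) hui n N
    _ = ∫ x in Q0, cf x ^ n * ((S x + S (-x)) / 2) := by
        have hsym : ∫ x in Q0, cf x ^ n * S (-x) = ∫ x in Q0, cf x ^ n * S x := by
          have hmp := Measure.measurePreserving_neg (volume : Measure (Fin 3 → ℝ))
          rw [← hmp.setIntegral_preimage_emb (MeasurableEquiv.neg (Fin 3 → ℝ)).measurableEmbedding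
            (fun x => cf x ^ n * S x) Q0]
          have : (Neg.neg ⁻¹' Q0 : Set (Fin 3 → ℝ)) = Q0 := by
            ext x
            simp only [Q0, Set.mem_preimage, Set.mem_Icc, Pi.le_def, Pi.neg_apply]
            constructor
            · rintro ⟨h1, h2⟩; exact ⟨fun i => by linarith [h2 i], fun i => by linarith [h1 i]⟩
            · rintro ⟨h1, h2⟩; exact ⟨fun i => by linarith [h2 i], fun i => by linarith [h1 i]⟩
          rw [this]
          simp only [cf_neg]
        have e : ∀ x, cf x ^ n * ((S x + S (-x)) / 2) =
            (cf x ^ n * S x + cf x ^ n * S (-x)) / 2 := fun x => by ring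
        simp only [e]
        rw [integral_div, integral_add (integrable_cf_mul hS.restrict n)
          (integrable_cf_mul hSn.restrict n), hsym]
        ring
    _ ≤ ∫ x in Q0, cf x ^ n * g0 x := by
        refine integral_mono (integrable_cf_mul ((hS.add hSn).div_const 2).restrict n)
          (integrable_cf_mul hg0 n) fun x => ?_
        exact mul_le_mul_of_nonneg_left (le_max_left _ _) (pow_nonneg (cf_nonneg x) n)

open scoped MatrixOrder in
lemma exists_B {M : ℕ} (A : Matrix (Fin M) (Fin 3) ℝ) :
    ∃ B : Matrix (Fin 3) (Fin 3) ℝ, Bᵀ * B = Aᵀ * A := by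
  have hA : (Aᵀ * A).PosSemidef := by
    simpa [Matrix.conjTranspose_eq_transpose_of_trivial] using posSemidef_conjTranspose_mul_self A
  obtain ⟨X, hX, -, h⟩ := CFC.exists_sqrt_of_isSelfAdjoint_of_quasispectrumRestricts
    hA.isHermitian (QuasispectrumRestricts.nnreal_of_nonneg hA.nonneg)
  refine ⟨X, ?_⟩
  have h2 : Xᵀ = X := by
    have := hX.star_eq
    rwa [Matrix.star_eq_conjTranspose, Matrix.conjTranspose_eq_transpose_of_trivial] at this
  rw [h2]; exact h

lemma sum_sq_mulVec {M : ℕ} (A : Matrix (Fin M) (Fin 3) ℝ) (v : Fin 3 → ℝ) :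
    ∑ i, (A.mulVec v i) ^ 2 = v ⬝ᵥ ((Aᵀ * A).mulVec v) := by
  rw [← Matrix.mulVec_mulVec, Matrix.mulVec_transpose, dotProduct_comm,
    ← Matrix.dotProduct_mulVec]
  simp [dotProduct, sq]

lemma det_ne {M : ℕ} (A : Matrix (Fin M) (Fin 3) ℝ) (hrank : A.rank = 3)
    (B : Matrix (Fin 3) (Fin 3) ℝ) (hB : Bᵀ * B = Aᵀ * A) : B.det ≠ 0 := by
  have h1 : B.rank = 3 := by
    rw [← Matrix.rank_transpose_mul_self, hB, Matrix.rank_transpose_mul_self, hrank]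
  have h2 : LinearMap.range B.mulVecLin = ⊤ := by
    apply Submodule.eq_top_of_finrank_eq
    rw [← Matrix.rank, h1]; simp
  have h3 : Function.Surjective B.mulVec := by
    have := LinearMap.range_eq_top.1 h2
    exact this
  have h4 := Matrix.mulVec_surjective_iff_isUnit.1 h3
  exact ((Matrix.isUnit_iff_isUnit_det _).1 h4).ne_zero

lemma col_bound {M : ℕ} (A : Matrix (Fin M) (Fin 3) ℝ)
    (B : Matrix (Fin 3) (Fin 3) ℝ) (hB : Bᵀ * B = Aᵀ * A) (D : ℝ)
    (hopnorm : sSup {r : ℝ | ∃ x : Fin 3 → ℝ, (∑ i, x i ^ 2) ≤ 1 ∧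
        r = Real.sqrt (∑ i, (A.mulVec x i) ^ 2)} ≤ D) (i : Fin 3) :
    Real.sqrt (∑ j, (B j i) ^ 2) ≤ D := by
  refine le_trans (le_csSup ?_ ?_) hopnorm
  · refine ⟨Real.sqrt (∑ i, ∑ j, A i j ^ 2), ?_⟩
    rintro r ⟨x, hx, rfl⟩
    refine Real.sqrt_le_sqrt (Finset.sum_le_sum fun i _ => ?_)
    refine (Finset.sum_mul_sq_le_sq_mul_sq Finset.univ (fun j => A i j) x).trans ?_
    have : 0 ≤ ∑ j, A i j ^ 2 := Finset.sum_nonneg fun j _ => sq_nonneg _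
    nlinarith
  · refine ⟨Pi.single i 1, ?_, ?_⟩
    · simp [Pi.single_apply]
    · rw [sum_sq_mulVec, ← hB, ← sum_sq_mulVec]
      simp

lemma steinNorm_line (a b : Fin 3 → ℝ) (ζ : ℂ) :
    steinNorm (fun j => (a j : ℂ) + ζ * (b j : ℂ)) ≤
      Real.sqrt (∑ j, a j ^ 2) + ‖ζ‖ * Real.sqrt (∑ j, b j ^ 2) := by
  have key : ∀ (c t : Fin 3 → ℝ), (∑ i, t i ^ 2) ≤ 1 →
      |∑ j, c j * t j| ≤ Real.sqrt (∑ j, c j ^ 2) := by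
    intro c t ht
    rw [← Real.sqrt_sq_eq_abs]
    refine Real.sqrt_le_sqrt ?_
    refine (Finset.sum_mul_sq_le_sq_mul_sq _ _ _).trans ?_
    have : 0 ≤ ∑ j, c j ^ 2 := Finset.sum_nonneg fun j _ => sq_nonneg _
    nlinarith
  refine csSup_le ⟨_, 0, by simp, rfl⟩ ?_
  rintro r ⟨t, ht, rfl⟩
  have : ∑ i, ((a i : ℂ) + ζ * (b i : ℂ)) * (t i : ℂ) =
      ((∑ i, a i * t i : ℝ) : ℂ) + ζ * ((∑ i, b i * t i : ℝ) : ℂ) := by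
    push_cast
    rw [Finset.mul_sum, ← Finset.sum_add_distrib]
    exact Finset.sum_congr rfl fun i _ => by ring
  rw [this]
  refine (norm_add_le _ _).trans ?_
  rw [norm_mul, Complex.norm_real, Complex.norm_real, Real.norm_eq_abs, Real.norm_eq_abs]
  gcongr
  · exact key a t ht
  · exact key b t ht

/-- Change of variables for the linear substitution `B`. -/
lemma chg {E : Type*} [NormedAddCommGroup E] [NormedSpace ℝ E]
    (B : Matrix (Fin 3) (Fin 3) ℝ) (hB : B.det ≠ 0) (f : (Fin 3 → ℝ) → E) (hf : Integrable f) :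
    Integrable (fun x => f (B.mulVec x)) ∧ ∫ x, f (B.mulVec x) = |B.det|⁻¹ • ∫ x, f x := by
  have hm := Real.map_matrix_volume_pi_eq_smul_volume_pi hB
  have hmeas : Measurable (toLin' B) := (LinearMap.continuous_of_finiteDimensional _).measurable
  have h1 : Integrable f (Measure.map (toLin' B) volume) := by
    rw [hm]; exact hf.smul_measure ENNReal.ofReal_ne_top
  constructor
  · exact (integrable_map_measure h1.1 hmeas.aemeasurable).1 h1
  · have := integral_map hmeas.aemeasurable h1.1
    rw [hm, integral_smul_measure, ENNReal.toReal_ofReal (abs_nonneg _), abs_inv] at this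
    rw [this]; rfl

/-- Orthogonality to nontrivial characters for an entire function composed with `B`. -/
lemma OT_comp (B : Matrix (Fin 3) (Fin 3) ℝ) (hB : B.det ≠ 0) (δ : ℝ) (hδ : 0 < δ)
    (hcol : ∀ i, Real.sqrt (∑ j, (B j i) ^ 2) ≤ δ⁻¹)
    (F : (Fin 3 → ℂ) → ℂ) (hF : Differentiable ℂ F)
    (him : ∀ x : Fin 3 → ℝ, (F fun i => (x i : ℂ)).im = 0)
    (hexp : ∀ ε > 0, ∃ C : ℝ, ∀ z : Fin 3 → ℂ,
        ‖F z‖ ≤ C * Real.exp ((2 * π * δ + ε) * steinNorm z))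
    (hint : Integrable (fun x : Fin 3 → ℝ => F fun i => (x i : ℂ)))
    (k : Fin 3 → ℤ) (hk : k ≠ 0) :
    ∫ x, ek k x * (((F fun i => ((B.mulVec x i : ℝ) : ℂ)).re : ℝ) : ℂ) = 0 := by
  set Φ : (Fin 3 → ℂ) → ℂ := fun z => F (fun j => ∑ l, (B j l : ℂ) * z l) with hΦ
  have hΦr : ∀ x : Fin 3 → ℝ, Φ (fun i => (x i : ℂ)) = F fun i => ((B.mulVec x i : ℝ) : ℂ) := by
    intro x
    simp only [hΦ]
    congr 1
    funext j
    simp [Matrix.mulVec, dotProduct]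
  have hv := vanish3 Φ (hF.comp (by fun_prop)) ?_ ?_ k hk
  · rw [← hv]
    congr 1
    funext x
    rw [hΦr]
    congr 1
    exact Complex.ext (by simp) (by simp [him])
  · simp only [hΦr]
    exact (chg B hB _ hint).1
  · intro i y ε hε
    obtain ⟨C, hC⟩ := hexp (ε * δ) (by positivity)
    set a : Fin 3 → ℝ := fun j => ∑ l, B j (i.succAbove l) * y l with ha
    refine ⟨|C| * Real.exp ((2 * π * δ + ε * δ) * Real.sqrt (∑ j, a j ^ 2)), fun z => ?_⟩
    have h1 : Φ (i.insertNth z (fun j => (y j : ℂ))) =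
        F (fun j => (a j : ℂ) + z * ((B j i : ℝ) : ℂ)) := by
      simp only [hΦ]
      congr 1
      funext j
      rw [Fin.sum_univ_succAbove _ i]
      simp [ha]
      ring
    rw [h1]
    have hpos : 0 ≤ 2 * π * δ + ε * δ := by positivity
    calc _ ≤ C * _ := hC _
      _ ≤ |C| * Real.exp ((2 * π * δ + ε * δ) *
          (Real.sqrt (∑ j, a j ^ 2) + ‖z‖ * δ⁻¹)) := by
        gcongr
        · exact le_abs_self C
        · refine (steinNorm_line a (fun j => B j i) z).trans ?_
          gcongr
          exact hcol i
      _ = _ := by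
        have e : (2 * π * δ + ε * δ) * (Real.sqrt (∑ j, a j ^ 2) + ‖z‖ * δ⁻¹) =
            (2 * π * δ + ε * δ) * Real.sqrt (∑ j, a j ^ 2) + (2 * π + ε) * ‖z‖ := by
          field_simp
        rw [e, Real.exp_add, ← mul_assoc]

lemma chi_integral (R : ℝ) (hR : 0 < R) :
    Integrable (fun x : Fin 3 → ℝ => chiR R x) ∧
      ∫ x : Fin 3 → ℝ, chiR R x = 4 / 3 * π * R ^ 3 := by
  have hmp := PiLp.volume_preserving_toLp (Fin 3)
  have hme : MeasurableEmbedding (WithLp.toLp 2 : (Fin 3 → ℝ) → EuclideanSpace ℝ (Fin 3)) :=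
    (MeasurableEquiv.toLp 2 (Fin 3 → ℝ)).measurableEmbedding
  have hsph : ∀ᵐ x : EuclideanSpace ℝ (Fin 3), ‖x‖ ≠ R := by
    have := Measure.addHaar_sphere (volume : Measure (EuclideanSpace ℝ (Fin 3))) 0 R
    rw [ae_iff]
    convert this using 2
    ext x; simp
  let h : EuclideanSpace ℝ (Fin 3) → ℝ := (Metric.ball 0 R).indicator (fun _ => 1)
  have hae : ∀ᵐ x : Fin 3 → ℝ, h (WithLp.toLp 2 x) = chiR R x := by
    filter_upwards [hmp.quasiMeasurePreserving.ae hsph] with x hx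
    rw [EuclideanSpace.norm_eq] at hx
    have hx' : Real.sqrt (∑ i, x i ^ 2) ≠ R := by simpa using hx
    have hmem : WithLp.toLp 2 x ∈ Metric.ball (0 : EuclideanSpace ℝ (Fin 3)) R ↔
        Real.sqrt (∑ i, x i ^ 2) < R := by
      rw [mem_ball_zero_iff, EuclideanSpace.norm_eq]
      simp
    unfold chiR
    rw [if_neg hx']
    by_cases hlt : Real.sqrt (∑ i, x i ^ 2) < R
    · rw [if_pos hlt]
      exact Set.indicator_of_mem (hmem.2 hlt) _
    · rw [if_neg hlt]
      exact Set.indicator_of_notMem (fun hh => hlt (hmem.1 hh)) _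
  have hvol := EuclideanSpace.volume_ball_fin_three 0 R
  have hi : Integrable h := by
    refine (integrable_indicator_iff Metric.isOpen_ball.measurableSet).2 ?_
    refine integrableOn_const ?_
    rw [hvol]
    exact ENNReal.mul_ne_top (by simp) (by simp)
  constructor
  · exact ((hmp.integrable_comp_emb hme).2 hi).congr hae
  · rw [← integral_congr_ae hae, hmp.integral_comp hme]
    simp only [h]
    rw [integral_indicator Metric.isOpen_ball.measurableSet]
    simp only [integral_const, MeasurableSet.univ, measureReal_restrict_apply, Set.univ_inter,
      smul_eq_mul, mul_one]
    rw [Measure.real, hvol, ENNReal.toReal_mul, ENNReal.toReal_pow, ENNReal.toReal_ofReal hR.le,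
      ENNReal.toReal_ofReal (by positivity)]
    ring

lemma chi_nonneg (R : ℝ) (y : Fin 3 → ℝ) : 0 ≤ chiR R y := by
  unfold chiR; split_ifs <;> norm_num

lemma chi_le_one (R : ℝ) (y : Fin 3 → ℝ) : chiR R y ≤ 1 := by
  unfold chiR; split_ifs <;> norm_num

lemma chi_in (R : ℝ) (hR : 0 < R) (y : Fin 3 → ℝ) (h : ∑ i, y i ^ 2 < R ^ 2) :
    chiR R y = 1 := by
  unfold chiR; rw [if_pos ((Real.sqrt_lt' hR).2 h)]

lemma chi_out (R : ℝ) (hR : 0 < R) (y : Fin 3 → ℝ) (h : R ^ 2 < ∑ i, y i ^ 2) :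
    chiR R y = 0 := by
  have := (Real.lt_sqrt hR.le).2 h
  unfold chiR; rw [if_neg this.not_gt, if_neg this.ne']

lemma chi_loc (R : ℝ) (hR : 0 < R) (w : Fin 3 → ℝ) :
    ∀ᶠ v in nhds (0 : Fin 3 → ℝ), chiR R (w + v) + chiR R (w + -v) ≤ 2 * chiR R w := by
  rcases lt_trichotomy (∑ i, w i ^ 2) (R ^ 2) with h | h | h
  · refine Filter.Eventually.of_forall fun v => ?_
    rw [chi_in R hR w h]
    linarith [chi_le_one R (w + v), chi_le_one R (w + -v)]
  · refine Filter.Eventually.of_forall fun v => ?_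
    by_cases hv : v = 0
    · subst hv; simp; linarith
    have hw : chiR R w = 1 / 2 := by
      unfold chiR; rw [h, Real.sqrt_sq hR.le]; simp
    have hvp : 0 < ∑ i, v i ^ 2 := by
      obtain ⟨j, hj⟩ := Function.ne_iff.1 hv
      exact Finset.sum_pos' (fun i _ => sq_nonneg _)
        ⟨j, Finset.mem_univ _, by have : v j ≠ 0 := hj
                                  positivity⟩
    have hpar : ∑ i, (w + v) i ^ 2 + ∑ i, (w + -v) i ^ 2 =
        2 * ∑ i, w i ^ 2 + 2 * ∑ i, v i ^ 2 := by
      rw [Finset.mul_sum, Finset.mul_sum, ← Finset.sum_add_distrib, ← Finset.sum_add_distrib]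
      exact Finset.sum_congr rfl fun i _ => by simp; ring
    rw [hw]
    by_cases h1 : R ^ 2 < ∑ i, (w + v) i ^ 2
    · linarith [chi_out R hR _ h1, chi_le_one R (w + -v)]
    · have h2 : R ^ 2 < ∑ i, (w + -v) i ^ 2 := by linarith
      linarith [chi_out R hR _ h2, chi_le_one R (w + v)]
  · have e1 : ∀ᶠ v in nhds (0 : Fin 3 → ℝ), R ^ 2 < ∑ i, (w + v) i ^ 2 := by
      have hc : Continuous fun v : Fin 3 → ℝ => ∑ i, (w + v) i ^ 2 := by fun_prop
      exact hc.continuousAt.eventually_const_lt (by simpa using h)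
    have e2 : ∀ᶠ v in nhds (0 : Fin 3 → ℝ), R ^ 2 < ∑ i, (w + -v) i ^ 2 := by
      have hc : Continuous fun v : Fin 3 → ℝ => ∑ i, (w + -v) i ^ 2 := by fun_prop
      exact hc.continuousAt.eventually_const_lt (by simpa using h)
    filter_upwards [e1, e2] with v h1 h2
    rw [chi_out R hR _ h1, chi_out R hR _ h2]
    linarith [chi_nonneg R w]

lemma chi_supp (B : Matrix (Fin 3) (Fin 3) ℝ) (hB : B.det ≠ 0) (R : ℝ) (hR : 0 < R) :
    ∃ ρ : ℝ, ∀ y : Fin 3 → ℝ, chiR R (B.mulVec y) ≠ 0 → ∀ i, |y i| ≤ ρ := by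
  refine ⟨∑ i, ∑ j, |B⁻¹ i j| * R, fun y hy i => ?_⟩
  have h1 : ∑ i, B.mulVec y i ^ 2 ≤ R ^ 2 := by
    by_contra h
    exact hy (chi_out R hR _ (not_le.1 h))
  have h2 : ∀ j, |B.mulVec y j| ≤ R := fun j => by
    refine abs_le_of_sq_le_sq ?_ hR.le
    exact (Finset.single_le_sum (f := fun j => B.mulVec y j ^ 2) (fun i _ => sq_nonneg _)
      (Finset.mem_univ j)).trans h1
  have h3 : y i = ∑ j, B⁻¹ i j * B.mulVec y j := by
    have : B⁻¹.mulVec (B.mulVec y) = y := by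
      rw [Matrix.mulVec_mulVec, Matrix.nonsing_inv_mul _ hB.isUnit, Matrix.one_mulVec]
    exact (congrFun this i).symm
  calc |y i| ≤ ∑ j, |B⁻¹ i j * B.mulVec y j| := by
        rw [h3]; exact Finset.abs_sum_le_sum_abs _ _
    _ ≤ ∑ j, |B⁻¹ i j| * R := Finset.sum_le_sum fun j _ => by
        rw [abs_mul]; exact mul_le_mul_of_nonneg_left (h2 j) (abs_nonneg _)
    _ ≤ _ := Finset.single_le_sum (f := fun i => ∑ j, |B⁻¹ i j| * R)
        (fun i _ => by positivity) (Finset.mem_univ i)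

/-- A finite index set carrying the lattice sum. -/
lemma exists_N (u : (Fin 3 → ℝ) → ℝ) (ρ : ℝ) (hu : ∀ y, u y ≠ 0 → ∀ i, |y i| ≤ ρ)
    (x0 : Fin 3 → ℝ) : ∃ N : Finset (Fin 3 → ℤ),
    ∀ x, u (x0 + x) ≠ 0 → ∀ m, x ∈ Tm m → m ∈ N := by
  set L : ℤ := ⌈ρ + ∑ i, |x0 i| + 1⌉ with hL
  refine ⟨Fintype.piFinset fun _ => Finset.Icc (-L) L, fun x hx m hm => ?_⟩
  rw [Fintype.mem_piFinset]
  intro i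
  have h1 := abs_le.1 (hu _ hx i)
  have h2 := (mem_Tm ..).1 hm i
  have h3 : |x0 i| ≤ ∑ i, |x0 i| :=
    Finset.single_le_sum (f := fun i => |x0 i|) (fun i _ => abs_nonneg _) (Finset.mem_univ i)
  have h4 := abs_le.1 h3
  have h5 : ρ + ∑ i, |x0 i| + 1 ≤ (L : ℝ) := Int.le_ceil _
  simp only [Pi.add_apply] at h1
  rw [Finset.mem_Icc]
  constructor
  · have : (-(L : ℝ)) ≤ (m i : ℝ) := by linarith [h1.1, h1.2, h2.1, h2.2, h4.1, h4.2]
    exact_mod_cast this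
  · have : (m i : ℝ) ≤ (L : ℝ) := by linarith [h1.1, h1.2, h2.1, h2.2, h4.1, h4.2]
    exact_mod_cast this

/-- Lattice point count in a ball for `N = 3`, assuming the existence of the
extremal majorant/minorant pair of entire functions of exponential type at most `2πδ`. -/
theorem stmt19 (M : ℕ) (A : Matrix (Fin M) (Fin 3) ℝ) (hrank : A.rank = 3)
    (δ R : ℝ) (hδ : 0 < δ) (hR : 0 < R)
    (hopnorm : sSup {r : ℝ | ∃ x : Fin 3 → ℝ, (∑ i, x i ^ 2) ≤ 1 ∧
        r = Real.sqrt (∑ i, (A.mulVec x i) ^ 2)} ≤ δ⁻¹)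
    (hexist : ∃ F G : (Fin 3 → ℂ) → ℂ,
      Differentiable ℂ F ∧ Differentiable ℂ G ∧
      (∀ x : Fin 3 → ℝ, (F fun i => (x i : ℂ)).im = 0) ∧
      (∀ x : Fin 3 → ℝ, (G fun i => (x i : ℂ)).im = 0) ∧
      (∀ ε > 0, ∃ C : ℝ, ∀ z : Fin 3 → ℂ,
        ‖F z‖ ≤ C * Real.exp ((2 * π * δ + ε) * steinNorm z)) ∧
      (∀ ε > 0, ∃ C : ℝ, ∀ z : Fin 3 → ℂ,
        ‖G z‖ ≤ C * Real.exp ((2 * π * δ + ε) * steinNorm z)) ∧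
      Integrable (fun x : Fin 3 → ℝ => F fun i => (x i : ℂ)) ∧
      Integrable (fun x : Fin 3 → ℝ => G fun i => (x i : ℂ)) ∧
      (∀ x : Fin 3 → ℝ,
        (F fun i => (x i : ℂ)).re ≤ chiR R x ∧ chiR R x ≤ (G fun i => (x i : ℂ)).re) ∧
      (∫ x : Fin 3 → ℝ, ((G fun i => (x i : ℂ)).re - (F fun i => (x i : ℂ)).re))
        = 4 * π * δ⁻¹ * R ^ 2 * (1 - (Real.sin (π * δ * R) / (π * δ * R)) ^ 2)⁻¹) :
    ∀ x : Fin 3 → ℝ,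
      |Real.sqrt (Aᵀ * A).det *
          ∑' m : Fin 3 → ℤ, chiR R (A.mulVec (fun i => x i + (m i : ℝ)))
        - 4 / 3 * π * R ^ 3|
      ≤ 4 * π * δ⁻¹ * R ^ 2 * (1 - (Real.sin (π * δ * R) / (π * δ * R)) ^ 2)⁻¹ := by
  obtain ⟨F, G, hF, hG, hFim, hGim, hFe, hGe, hFi, hGi, hle, hval⟩ := hexist
  intro x0
  rw [← hval]
  obtain ⟨B, hB⟩ := exists_B A
  have hdet := det_ne A hrank B hB
  have hcol := col_bound A B hB δ⁻¹ hopnorm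
  have hsq : Real.sqrt (Aᵀ * A).det = |B.det| := by
    rw [← hB, Matrix.det_mul, Matrix.det_transpose, Real.sqrt_mul_self_eq_abs]
  have hchi : ∀ v, chiR R (A.mulVec v) = chiR R (B.mulVec v) := fun v => by
    unfold chiR
    rw [sum_sq_mulVec A, sum_sq_mulVec B, hB]
  have hFr : Integrable (fun x : Fin 3 → ℝ => (F fun i => (x i : ℂ)).re) := hFi.re
  have hGr : Integrable (fun x : Fin 3 → ℝ => (G fun i => (x i : ℂ)).re) := hGi.re
  obtain ⟨hci, hcv⟩ := chi_integral R hR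
  obtain ⟨hFB, hFBv⟩ := chg B hdet _ hFr
  obtain ⟨hGB, hGBv⟩ := chg B hdet _ hGr
  obtain ⟨hcB, -⟩ := chg B hdet _ hci
  have hmc : Continuous fun v : Fin 3 → ℝ => B.mulVec v :=
    Continuous.matrix_mulVec continuous_const continuous_id
  obtain ⟨ρ, hρ⟩ := chi_supp B hdet R hR
  obtain ⟨N, hN⟩ := exists_N (fun y => chiR R (B.mulVec y)) ρ hρ x0
  have hsum : ∑' m : Fin 3 → ℤ, chiR R (A.mulVec (fun i => x0 i + (m i : ℝ))) =
      ∑ m ∈ N, chiR R (B.mulVec (x0 + fun i => (m i : ℝ))) := by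
    simp only [hchi]
    refine tsum_eq_sum fun m hm => ?_
    by_contra hne
    refine hm (hN (fun i => (m i : ℝ)) hne m ?_)
    rw [mem_Tm]
    intro i
    constructor <;> norm_num
  have hlow := poisson_lower _ (fun y => chiR R (B.mulVec y)) hFB hcB (fun x => (hle _).1)
    (OT_comp B hdet δ hδ hcol F hF hFim hFe hFi) x0 (fun y => by
      have h0 : Filter.Tendsto (fun v : Fin 3 → ℝ => B.mulVec v) (nhds 0) (nhds 0) := by
        simpa using hmc.tendsto 0
      filter_upwards [h0.eventually (chi_loc R hR (B.mulVec y))] with v hv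
      simpa [Matrix.mulVec_add, Matrix.mulVec_neg] using hv) N hN
  have hup := poisson_upper (fun x => (G fun i => ((B.mulVec x i : ℝ) : ℂ)).re) hGB
    (Complex.continuous_re.comp (hG.continuous.comp (continuous_pi fun i =>
      Complex.continuous_ofReal.comp ((continuous_apply i).comp hmc))))
    (fun x => (chi_nonneg R _).trans (hle _).2)
    (OT_comp B hdet δ hδ hcol G hG hGim hGe hGi) x0 N
  have hup2 : ∑ m ∈ N, chiR R (B.mulVec (x0 + fun i => (m i : ℝ))) ≤
      ∫ x, (G fun i => ((B.mulVec x i : ℝ) : ℂ)).re :=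
    (Finset.sum_le_sum fun m _ => (hle _).2).trans hup
  have hd : 0 < |B.det| := abs_pos.2 hdet
  rw [hsum, hsq, integral_sub hGr hFr]
  rw [hFBv, smul_eq_mul, inv_mul_le_iff₀ hd] at hlow
  rw [hGBv, smul_eq_mul, le_inv_mul_iff₀ hd] at hup2
  have i1 := integral_mono hFr hci fun x => (hle x).1
  have i2 := integral_mono hci hGr fun x => (hle x).2
  rw [hcv] at i1 i2
  rw [abs_le]
  constructor <;> linarith
end
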